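/- Let β > 1 be a real number. There exists a constant σ > 0 (depending only on β) such that both: (i) for every y ∈ ℝ, the Lebesgue measure of {x ∈ [0,1) : (k_n(x) − (6·log 2·log β/π²)·n)/(σ·√n) ≤ y} converges to (1/√(2π)) ∫_{−∞}^{y} e^{−t²/2} dt as n → ∞; and (ii) for Lebesgue-almost all x ∈ [0,1), limsup_{n→∞} (k_n(x) − (6·log 2·log β/π²)·n)/(σ·√(2n·log log n)) = 1 and liminf_{n→∞} (k_n(x) − (6·log 2·log β/π²)·n)/(σ·√(2n·log log n)) = −1. -/

import Mathlib

open MeasureTheory Filter Set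

/-- The β-transformation `T_β x = βx - ⌊βx⌋` on `[0,1)`. -/
noncomputable def betaT (β : ℝ) (x : ℝ) : ℝ := β * x - ⌊β * x⌋

/-- The `i`-th digit (for `i ≥ 1`) of the β-expansion of `x`. -/
noncomputable def betaEps (β : ℝ) (i : ℕ) (x : ℝ) : ℤ := ⌊β * (betaT β)^[i - 1] x⌋

/-- The cylinder of order `n` of the β-expansion containing `x`. -/
def betaCyl (β : ℝ) (n : ℕ) (x : ℝ) : Set ℝ :=
  {y ∈ Set.Ico (0:ℝ) 1 | ∀ i, 1 ≤ i → i ≤ n → betaEps β i y = betaEps β i x}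

/-- The Gauss map, with `T 0 = 0`. -/
noncomputable def gaussMap (x : ℝ) : ℝ := if x = 0 then 0 else 1 / x - ⌊1 / x⌋

/-- The `i`-th partial quotient (for `i ≥ 1`) of the continued fraction expansion of `x`. -/
noncomputable def cfA (i : ℕ) (x : ℝ) : ℤ := ⌊1 / (gaussMap^[i - 1] x)⌋

/-- The cylinder of order `m` of the continued fraction expansion containing `x`. -/
def cfCyl (m : ℕ) (x : ℝ) : Set ℝ :=
  {y ∈ Set.Ico (0:ℝ) 1 | ∀ i, 1 ≤ i → i ≤ m → cfA i y = cfA i x}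

/-- `k_n(x)`: the exact number of partial quotients of the continued fraction of `x`
determined by the first `n` β-expansion digits of `x`. -/
noncomputable def kCF (β : ℝ) (n : ℕ) (x : ℝ) : ℕ :=
  sSup {m | betaCyl β n x ⊆ cfCyl m x}

/-- Denominators `q_n(x)` of the continued fraction convergents of `x`
(`q_0 = 1`, `q_1 = a_1`, `q_n = a_n q_{n-1} + q_{n-2}`). -/
noncomputable def cfQ (x : ℝ) : ℕ → ℤ
  | 0 => 1
  | 1 => cfA 1 x
  | (n + 2) => cfA (n + 2) x * cfQ x (n + 1) + cfQ x n

/-- Numerators `p_n(x)` of the continued fraction convergents of `x`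
(`p_0 = 0`, `p_1 = 1`, `p_n = a_n p_{n-1} + p_{n-2}`). -/
noncomputable def cfP (x : ℝ) : ℕ → ℤ
  | 0 => 0
  | 1 => 1
  | (n + 2) => cfA (n + 2) x * cfP x (n + 1) + cfP x n

/-- `l_n(x)`: the length of the longest string of zeros just after the `n`-th digit
of the β-expansion of `x`. -/
noncomputable def lZero (β : ℝ) (n : ℕ) (x : ℝ) : ℕ :=
  sSup {k | ∀ j, 1 ≤ j → j ≤ k → betaEps β (n + j) x = 0}


namespace KN
open MeasureTheory Filter Set
open scoped Topology
open Real (log exp sqrt)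
noncomputable section
def br (a : ℕ) (x : ℝ) : ℝ := 1 / (a + 1 + x)
def wt (a : ℕ) (x : ℝ) : ℝ := (1 + x) / ((a + 1 + x) * (a + 2 + x))
def tl (a : ℕ) (x : ℝ) : ℝ := (1 + x) / (a + 1 + x)
def LL (ψ : ℝ → ℝ) (x : ℝ) : ℝ := ∑' a, wt a x * ψ (br a x)
def Lp (K : ℝ) (ψ : ℝ → ℝ) : Prop :=
  ∀ x ∈ Ioo (0:ℝ) 1, ∀ y ∈ Ioo (0:ℝ) 1, |ψ x - ψ y| ≤ K * |x - y|
lemma br_mem {a : ℕ} {x : ℝ} (hx : x ∈ Ioo (0:ℝ) 1) : br a x ∈ Ioo (0:ℝ) 1 := by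
  have h0 := hx.1
  have ha : (0:ℝ) ≤ a := Nat.cast_nonneg a
  constructor
  · unfold br; positivity
  · unfold br; rw [div_lt_one (by positivity)]; linarith
lemma wt_pos {a : ℕ} {x : ℝ} (hx : x ∈ Ioo (0:ℝ) 1) : 0 < wt a x := by
  have h0 := hx.1
  unfold wt; positivity
lemma wt_eq {a : ℕ} {x : ℝ} (hx : x ∈ Ioo (0:ℝ) 1) : wt a x = tl a x - tl (a+1) x := by
  have h0 := hx.1
  unfold wt tl; push_cast; field_simp; ring
lemma tl_tendsto (x : ℝ) : Tendsto (fun a => tl a x) atTop (𝓝 0) := by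
  unfold tl
  apply Tendsto.div_atTop tendsto_const_nhds
  apply tendsto_atTop_add_const_right
  apply tendsto_atTop_add_const_right
  exact tendsto_natCast_atTop_atTop
lemma wt_hasSum {x : ℝ} (hx : x ∈ Ioo (0:ℝ) 1) : HasSum (fun a => wt a x) 1 := by
  rw [hasSum_iff_tendsto_nat_of_nonneg (fun a => (wt_pos hx).le)]
  have h0 : tl 0 x = 1 := by
    have := hx.1
    unfold tl; push_cast; field_simp; ring
  have : ∀ n, ∑ i ∈ Finset.range n, wt i x = 1 - tl n x := by
    intro n
    rw [Finset.sum_congr rfl (fun a _ => wt_eq hx), Finset.sum_range_sub', h0]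
  simp_rw [this]
  simpa using (tl_tendsto x).const_sub 1
lemma wt_le {a : ℕ} {x : ℝ} (hx : x ∈ Ioo (0:ℝ) 1) : wt a x ≤ 2 / ((a+1) * (a+2)) := by
  have h0 := hx.1
  have h1 := hx.2
  unfold wt
  have ha : (0:ℝ) ≤ a := Nat.cast_nonneg a
  have e1 : (a:ℝ) + 1 ≤ a + 1 + x := by linarith
  have e2 : (a:ℝ) + 2 ≤ a + 2 + x := by linarith
  have e3 : 1 + x ≤ 2 := by linarith
  exact div_le_div₀ (by norm_num) e3 (by positivity) (mul_le_mul e1 e2 (by positivity) (by positivity))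
lemma smul_summable {x : ℝ} (hx : x ∈ Ioo (0:ℝ) 1) {F : ℕ → ℝ} {B : ℝ} (hF : ∀ a, |F a| ≤ B) :
    Summable (fun a => wt a x * F a) := by
  refine Summable.of_norm_bounded ((wt_hasSum hx).summable.mul_right B) fun a => ?_
  rw [Real.norm_eq_abs, abs_mul, abs_of_pos (wt_pos hx)]
  exact mul_le_mul_of_nonneg_left (hF a) (wt_pos hx).le
lemma Lp.bdd {K : ℝ} {ψ : ℝ → ℝ} (h : Lp K ψ) (hK : 0 ≤ K) {x : ℝ} (hx : x ∈ Ioo (0:ℝ) 1) :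
    |ψ x| ≤ |ψ (1/2)| + K := by
  have h2 : (1/2:ℝ) ∈ Ioo (0:ℝ) 1 := by norm_num
  have := h x hx _ h2
  have h3 : |x - 1/2| ≤ 1 := by rw [abs_le]; constructor <;> linarith [hx.1, hx.2]
  have h4 : |ψ x| ≤ |ψ x - ψ (1/2)| + |ψ (1/2)| := by
    simpa using abs_add_le (ψ x - ψ (1/2)) (ψ (1/2))
  nlinarith
lemma Lp.dist {K : ℝ} {ψ : ℝ → ℝ} (h : Lp K ψ) (hK : 0 ≤ K) {x y : ℝ} (hx : x ∈ Ioo (0:ℝ) 1)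
    (hy : y ∈ Ioo (0:ℝ) 1) : |ψ x - ψ y| ≤ K := by
  have := h x hx _ hy
  have h3 : |x - y| ≤ 1 := by rw [abs_le]; constructor <;> linarith [hx.1, hx.2, hy.1, hy.2]
  nlinarith
lemma Lp.summable {K : ℝ} {ψ : ℝ → ℝ} (h : Lp K ψ) (hK : 0 ≤ K) {x : ℝ} (hx : x ∈ Ioo (0:ℝ) 1) :
    Summable (fun a => wt a x * ψ (br a x)) :=
  smul_summable hx (fun _ => h.bdd hK (br_mem hx))
lemma br_sub {a : ℕ} {x y : ℝ} (hx : x ∈ Ioo (0:ℝ) 1) (hy : y ∈ Ioo (0:ℝ) 1) :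
    |br a x - br a y| = |x - y| / ((a+1+x)*(a+1+y)) := by
  have h0 := hx.1
  have h1 := hy.1
  have : br a x - br a y = (y - x) / ((a+1+x)*(a+1+y)) := by
    unfold br; field_simp; ring
  rw [this, abs_div, abs_sub_comm, abs_of_pos (a := _ * _) (by positivity)]
/-- auxiliary constants in the contraction bound -/
def k1 (a : ℕ) : ℝ := if a = 0 then 1/2 else (1/3) * (1/(a+1) - 1/(a+2))
def k2 (a : ℕ) : ℝ := (1/2) * (1/((a+1)*(a+2)) - 1/((a+2)*(a+3)))
lemma k1_sum (n : ℕ) : ∑ a ∈ Finset.range n, k1 a ≤ 2/3 := by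
  have : ∀ n : ℕ, ∑ a ∈ Finset.range (n+1), k1 a = 2/3 - (1/3) * (1/(n+2)) + 0 := by
    intro n
    induction n with
    | zero => simp [k1]; norm_num
    | succ n ih =>
      rw [Finset.sum_range_succ, ih]
      simp only [k1, Nat.succ_ne_zero, if_false]
      push_cast
      simp
      field_simp
      ring
  cases n with
  | zero => norm_num
  | succ n => rw [this]; have : (0:ℝ) ≤ 1/(n+2) := by positivity
              linarith
lemma k2_sum (n : ℕ) : ∑ a ∈ Finset.range n, k2 a ≤ 1/4 := by
  have : ∑ a ∈ Finset.range n, k2 a = 1/4 - (1/2) * (1/((n+1)*(n+2))) := by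
    induction n with
    | zero => norm_num
    | succ n ih =>
      rw [Finset.sum_range_succ, ih]
      simp only [k2]
      push_cast
      field_simp
      ring
  rw [this]
  have : (0:ℝ) ≤ 1/((n+1)*(n+2)) := by positivity
  linarith
lemma term1 {a : ℕ} {x y : ℝ} (hx : x ∈ Ioo (0:ℝ) 1) (hy : y ∈ Ioo (0:ℝ) 1) :
    wt a y / ((a+1+x)*(a+1+y)) ≤ k1 a := by
  have h0 := hx.1
  have h1 := hy.1
  have h2 := hy.2
  unfold k1 wt
  split_ifs with h
  · subst h
    push_cast
    rw [div_div, div_le_div_iff₀ (by positivity) (by norm_num)]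
    have e1 : 0 < x * y := by positivity
    nlinarith [mul_pos h0 h1, mul_pos e1 h1, mul_pos (mul_pos e1 h1) h1, mul_pos h1 h1, mul_pos (mul_pos h1 h1) h1]
  · have ha : (1:ℝ) ≤ a := by exact_mod_cast Nat.one_le_iff_ne_zero.2 h
    have e : (1/3:ℝ) * (1/(a+1) - 1/(a+2)) = 1 / (3 * (a+1) * (a+2)) := by field_simp; ring
    rw [e, div_div, div_le_div_iff₀ (by positivity) (by positivity)]
    have e1 : (1 + y) * 3 ≤ 6 := by linarith
    have e2 : (2+y)*(2:ℝ) ≤ (a+1+y)*(a+1+x) := by gcongr <;> linarith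
    have e3 : (1+y)*3 ≤ (a+1+y)*(a+1+x) := by nlinarith
    have e4 : ((a:ℝ)+1)*(a+2) ≤ (a+1+y)*(a+2+y) := mul_le_mul (by linarith) (by linarith) (by positivity) (by positivity)
    calc (1+y)*(3*(a+1)*(a+2)) = ((1+y)*3)*((a+1)*(a+2)) := by ring
      _ ≤ ((a+1+y)*(a+1+x)) * ((a+1+y)*(a+2+y)) := by gcongr
      _ = _ := by ring
lemma tl_sub {a : ℕ} {x y : ℝ} (hx : x ∈ Ioo (0:ℝ) 1) (hy : y ∈ Ioo (0:ℝ) 1) :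
    |tl a x - tl a y| = |x - y| * (a / ((a+1+x)*(a+1+y))) := by
  have h0 := hx.1
  have h1 := hy.1
  have : tl a x - tl a y = (x - y) * (a / ((a+1+x)*(a+1+y))) := by
    unfold tl; field_simp; ring
  rw [this, abs_mul, abs_of_nonneg (a := _ / _) (by positivity)]
lemma term2 {a : ℕ} {x y : ℝ} (hx : x ∈ Ioo (0:ℝ) 1) (hy : y ∈ Ioo (0:ℝ) 1) :
    ((a+1:ℕ) / (((a+1:ℕ)+1+x)*((a+1:ℕ)+1+y))) * (1/((a+1+x)*((a+1:ℕ)+1+x))) ≤ k2 a := by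
  have h0 := hx.1
  have h1 := hy.1
  have ha : (0:ℝ) ≤ a := Nat.cast_nonneg a
  unfold k2
  push_cast
  have e : (1/2:ℝ) * (1/((a+1)*(a+2)) - 1/((a+2)*(a+3))) = 1 / ((a+1)*(a+2)*(a+3)) := by field_simp; ring
  rw [e, div_mul_div_comm, mul_one]
  calc (a+1:ℝ) / ((a+1+1+x)*(a+1+1+y) * ((a+1+x)*(a+1+1+x)))
      ≤ (a+1:ℝ) / ((a+1+1)*(a+1+1) * ((a+1)*(a+1+1))) := by
        refine div_le_div_of_nonneg_left (by positivity) (by positivity) ?_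
        refine mul_le_mul ?_ ?_ (by positivity) (by positivity) <;>
          exact mul_le_mul (by linarith) (by linarith) (by positivity) (by positivity)
    _ ≤ _ := by
      rw [div_le_div_iff₀ (by positivity) (by positivity)]
      nlinarith [pow_nonneg ha 2, pow_nonneg ha 3, pow_nonneg ha 4]
lemma contraction {K : ℝ} {ψ : ℝ → ℝ} (h : Lp K ψ) (hK : 0 ≤ K) : Lp (11/12 * K) (LL ψ) := by
  intro x hx y hy
  obtain ⟨M, hM⟩ : ∃ M, M = |ψ (1/2)| + K := ⟨_, rfl⟩
  have hb : ∀ z ∈ Ioo (0:ℝ) 1, |ψ z| ≤ M := fun z hz => hM ▸ h.bdd hK hz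
  have hM0 : 0 ≤ M := hM ▸ by positivity
  have key : ∀ n : ℕ, |∑ a ∈ Finset.range (n+1), wt a x * ψ (br a x) -
      ∑ a ∈ Finset.range (n+1), wt a y * ψ (br a y)| ≤
      11/12 * K * |x - y| + |tl (n+1) x - tl (n+1) y| * M := by
    intro n
    have abel : ∀ n : ℕ, ∑ a ∈ Finset.range (n+1), (wt a x - wt a y) * ψ (br a x) =
        ∑ a ∈ Finset.range n, (tl (a+1) x - tl (a+1) y) * (ψ (br (a+1) x) - ψ (br a x))
          - (tl (n+1) x - tl (n+1) y) * ψ (br n x) := by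
      intro n
      induction n with
      | zero =>
        have e : ∀ z ∈ Ioo (0:ℝ) 1, tl 0 z = 1 := by
          intro z hz; have := hz.1; unfold tl; push_cast; field_simp; ring
        simp [wt_eq hx, wt_eq hy, e x hx, e y hy]; ring
      | succ n ih =>
        rw [Finset.sum_range_succ, ih, Finset.sum_range_succ, wt_eq hx, wt_eq hy]; ring
    have split : ∑ a ∈ Finset.range (n+1), wt a x * ψ (br a x) -
      ∑ a ∈ Finset.range (n+1), wt a y * ψ (br a y) =
      ∑ a ∈ Finset.range (n+1), wt a y * (ψ (br a x) - ψ (br a y)) +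
      ∑ a ∈ Finset.range (n+1), (wt a x - wt a y) * ψ (br a x) := by
      rw [← Finset.sum_sub_distrib, ← Finset.sum_add_distrib]
      exact Finset.sum_congr rfl fun a _ => by ring
    rw [split, abel]
    have b1 : |∑ a ∈ Finset.range (n+1), wt a y * (ψ (br a x) - ψ (br a y))| ≤ 2/3 * K * |x-y| := by
      refine (Finset.abs_sum_le_sum_abs _ _).trans ?_
      calc _ ≤ ∑ a ∈ Finset.range (n+1), k1 a * (K * |x-y|) := by
            refine Finset.sum_le_sum fun a _ => ?_
            rw [abs_mul, abs_of_pos (wt_pos hy)]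
            have := h _ (br_mem (a := a) hx) _ (br_mem (a := a) hy)
            rw [br_sub hx hy] at this
            calc _ ≤ wt a y * (K * (|x-y| / ((a+1+x)*(a+1+y)))) :=
                  mul_le_mul_of_nonneg_left this (wt_pos hy).le
              _ = wt a y / ((a+1+x)*(a+1+y)) * (K * |x-y|) := by ring
              _ ≤ _ := by gcongr; exact term1 hx hy
        _ = (∑ a ∈ Finset.range (n+1), k1 a) * (K * |x-y|) := by rw [Finset.sum_mul]
        _ ≤ 2/3 * (K * |x-y|) := by gcongr; exact k1_sum _
        _ = _ := by ring
    have b2 : |∑ a ∈ Finset.range n, (tl (a+1) x - tl (a+1) y) * (ψ (br (a+1) x) - ψ (br a x))|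
        ≤ 1/4 * K * |x-y| := by
      refine (Finset.abs_sum_le_sum_abs _ _).trans ?_
      calc _ ≤ ∑ a ∈ Finset.range n, k2 a * (K * |x-y|) := by
            refine Finset.sum_le_sum fun a _ => ?_
            rw [abs_mul, tl_sub hx hy]
            have h0 := hx.1
            have := h _ (br_mem (a := a+1) hx) _ (br_mem (a := a) hx)
            have e : |br (a+1) x - br a x| = 1/((a+1+x)*((a+1:ℕ)+1+x)) := by
              have : br (a+1) x - br a x = - (1/((a+1+x)*((a+1:ℕ)+1+x))) := by
                unfold br; push_cast; field_simp; ring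
              rw [this, abs_neg, abs_of_pos (by positivity)]
            rw [e] at this
            have h1 := hy.1
            calc _ ≤ |x - y| * ((a+1:ℕ) / (((a+1:ℕ)+1+x)*((a+1:ℕ)+1+y))) *
                    (K * (1/((a+1+x)*((a+1:ℕ)+1+x)))) := by gcongr
              _ = ((a+1:ℕ) / (((a+1:ℕ)+1+x)*((a+1:ℕ)+1+y))) * (1/((a+1+x)*((a+1:ℕ)+1+x)))
                  * (K * |x-y|) := by ring
              _ ≤ _ := by gcongr; exact term2 hx hy
        _ = (∑ a ∈ Finset.range n, k2 a) * (K * |x-y|) := by rw [Finset.sum_mul]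
        _ ≤ 1/4 * (K * |x-y|) := by gcongr; exact k2_sum _
        _ = _ := by ring
    have b3 : |(tl (n+1) x - tl (n+1) y) * ψ (br n x)| ≤ |tl (n+1) x - tl (n+1) y| * M := by
      rw [abs_mul]; gcongr; exact hb _ (br_mem hx)
    have := abs_add_le (∑ a ∈ Finset.range (n+1), wt a y * (ψ (br a x) - ψ (br a y)))
      (∑ a ∈ Finset.range n, (tl (a+1) x - tl (a+1) y) * (ψ (br (a+1) x) - ψ (br a x))
          - (tl (n+1) x - tl (n+1) y) * ψ (br n x))
    have := abs_sub (∑ a ∈ Finset.range n, (tl (a+1) x - tl (a+1) y) * (ψ (br (a+1) x) - ψ (br a x)))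
          ((tl (n+1) x - tl (n+1) y) * ψ (br n x))
    linarith
  have t1 := ((h.summable hK hx).hasSum.tendsto_sum_nat).comp (tendsto_add_atTop_nat 1)
  have t2 := ((h.summable hK hy).hasSum.tendsto_sum_nat).comp (tendsto_add_atTop_nat 1)
  have t3 : Tendsto (fun n : ℕ => 11/12 * K * |x - y| + |tl (n+1) x - tl (n+1) y| * M) atTop
      (𝓝 (11/12 * K * |x - y| + |(0:ℝ) - 0| * M)) := by
    have := (((tl_tendsto x).sub (tl_tendsto y)).abs).comp (tendsto_add_atTop_nat 1)
    exact (this.mul_const M).const_add _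
  have := le_of_tendsto_of_tendsto' ((t1.sub t2).abs) t3 key
  simpa [LL] using this
lemma LL_sub_le {K : ℝ} {ψ : ℝ → ℝ} (h : Lp K ψ) (hK : 0 ≤ K) {x y : ℝ}
    (hx : x ∈ Ioo (0:ℝ) 1) (hy : y ∈ Ioo (0:ℝ) 1) : |LL ψ x - ψ y| ≤ K := by
  have e : HasSum (fun a => wt a x * (ψ (br a x) - ψ y)) (LL ψ x - ψ y) := by
    have := (h.summable hK hx).hasSum.sub ((wt_hasSum hx).mul_right (ψ y))
    simpa [mul_sub, LL] using this
  have e2 := (wt_hasSum hx).mul_right K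
  rw [one_mul] at e2
  have hb : ∀ a, |wt a x * (ψ (br a x) - ψ y)| ≤ wt a x * K := fun a => by
    rw [abs_mul, abs_of_pos (wt_pos hx)]
    exact mul_le_mul_of_nonneg_left (h.dist hK (br_mem hx) hy) (wt_pos hx).le
  exact abs_le.2 ⟨by simpa using hasSum_le (fun a => (abs_le.1 (hb a)).1) e2.neg e,
    hasSum_le (fun a => (abs_le.1 (hb a)).2) e e2⟩
lemma LL_ge {K : ℝ} {ψ : ℝ → ℝ} (h : Lp K ψ) (hK : 0 ≤ K) {m : ℝ}
    (hm : ∀ x ∈ Ioo (0:ℝ) 1, m ≤ ψ x) : ∀ x ∈ Ioo (0:ℝ) 1, m ≤ LL ψ x := by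
  intro x hx
  have e2 := (wt_hasSum hx).mul_right m
  rw [one_mul] at e2
  exact hasSum_le (fun a => mul_le_mul_of_nonneg_left (hm _ (br_mem hx)) (wt_pos hx).le) e2
    (h.summable hK hx).hasSum
lemma Lp.continuousOn {K : ℝ} {ψ : ℝ → ℝ} (h : Lp K ψ) (hK : 0 ≤ K) :
    LipschitzOnWith ⟨K, hK⟩ ψ (Ioo 0 1) := by
  apply LipschitzOnWith.of_dist_le_mul
  intro x hx y hy
  rw [Real.dist_eq, Real.dist_eq]; exact h x hx y hy
lemma poisson {K : ℝ} {φ : ℝ → ℝ} (h : Lp K φ) (hK : 0 ≤ K) :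
    ∃ (c : ℝ) (u : ℝ → ℝ) (K' : ℝ), 0 ≤ K' ∧ Continuous u ∧ Lp K' u ∧
      (∀ x ∈ Ioo (0:ℝ) 1, u x - LL u x = φ x - c) ∧
      ∀ m, (∀ x ∈ Ioo (0:ℝ) 1, m ≤ φ x) → m ≤ c := by
  obtain ⟨ψ, hψ⟩ : ∃ ψ : ℕ → ℝ → ℝ, ψ = fun n => LL^[n] φ := ⟨_, rfl⟩
  have hs : ∀ n, ψ (n+1) = LL (ψ n) := fun n => by
    rw [hψ]; exact Function.iterate_succ_apply' _ _ _
  have h0 : ψ 0 = φ := by rw [hψ]; rfl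
  have hr : ∀ n : ℕ, 0 ≤ (11/12:ℝ)^n * K := fun n => by positivity
  have hL : ∀ n, Lp ((11/12)^n * K) (ψ n) := by
    intro n
    induction n with
    | zero => simpa [h0] using h
    | succ n ih =>
      rw [hs, pow_succ']; have := contraction ih (hr n)
      rwa [mul_assoc]
  have half : (1/2:ℝ) ∈ Ioo (0:ℝ) 1 := by norm_num
  have hstep : ∀ x ∈ Ioo (0:ℝ) 1, ∀ n, dist (ψ n x) (ψ (n+1) x) ≤ K * (11/12)^n := by
    intro x hx n
    rw [dist_comm, Real.dist_eq, hs, mul_comm]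
    exact LL_sub_le (hL n) (hr n) hx hx
  obtain ⟨c, hc⟩ := cauchySeq_tendsto_of_complete
    (cauchySeq_of_le_geometric (11/12:ℝ) K (by norm_num) (hstep _ half))
  have hgeo : Tendsto (fun n : ℕ => (11/12:ℝ)^n * K) atTop (𝓝 0) := by
    simpa using (tendsto_pow_atTop_nhds_zero_of_lt_one (by norm_num : (0:ℝ) ≤ 11/12)
      (by norm_num)).mul_const K
  have hcx : ∀ x ∈ Ioo (0:ℝ) 1, Tendsto (fun n => ψ n x) atTop (𝓝 c) := by
    intro x hx
    have : Tendsto (fun n => ψ n x - ψ n (1/2)) atTop (𝓝 0) :=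
      squeeze_zero_norm (fun n => (hL n).dist (hr n) hx half) hgeo
    simpa using this.add hc
  have hbd : ∀ x ∈ Ioo (0:ℝ) 1, ∀ n, |ψ n x - c| ≤ 12 * K * (11/12)^n := by
    intro x hx n
    have := dist_le_of_le_geometric_of_tendsto (11/12:ℝ) K (by norm_num) (hstep _ hx) (hcx x hx) n
    rw [Real.dist_eq] at this
    refine this.trans (le_of_eq ?_)
    field_simp; ring
  have sgeo : Summable (fun n : ℕ => 12 * K * (11/12:ℝ)^n) :=
    (summable_geometric_of_lt_one (by norm_num) (by norm_num)).mul_left _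
  have hsum : ∀ x ∈ Ioo (0:ℝ) 1, Summable (fun n => ψ n x - c) := fun x hx =>
    Summable.of_norm_bounded sgeo (fun n => hbd x hx n)
  obtain ⟨u0, hu0⟩ : ∃ u0 : ℝ → ℝ, u0 = fun x => ∑' n, (ψ n x - c) := ⟨_, rfl⟩
  have hu0L : Lp (12 * K) u0 := by
    intro x hx y hy
    rw [hu0]
    simp only
    rw [← (hsum x hx).tsum_sub (hsum y hy)]
    have : HasSum (fun n : ℕ => (11/12:ℝ)^n * (K * |x-y|)) (12 * K * |x-y|) := by
      have := (hasSum_geometric_of_lt_one (r := (11/12:ℝ)) (by norm_num) (by norm_num)).mul_right (K * |x-y|)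
      rwa [show 12*K*|x-y| = (1-11/12:ℝ)⁻¹*(K*|x-y|) by norm_num [mul_assoc]]
    rw [← Real.norm_eq_abs]
    refine tsum_of_norm_bounded this fun n => ?_
    have := hL n x hx y hy
    rw [Real.norm_eq_abs]
    calc _ = |ψ n x - ψ n y| := by rw [sub_sub_sub_cancel_right]
      _ ≤ _ := this
      _ = _ := by ring
  obtain ⟨u, hu, hue⟩ := (hu0L.continuousOn (by positivity)).extend_real
  have huL : Lp (12 * K) u := by
    intro x hx y hy
    rw [← hue hx, ← hue hy]; exact hu0L x hx y hy
  refine ⟨c, u, 12 * K, by positivity, hu.continuous, huL, ?_, ?_⟩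
  · intro x hx
    obtain ⟨U, hU⟩ : ∃ U : ℕ → ℝ → ℝ, U = fun N y => ∑ n ∈ Finset.range N, (ψ n y - c) := ⟨_, rfl⟩
    have tU : ∀ y ∈ Ioo (0:ℝ) 1, Tendsto (fun N => U N y) atTop (𝓝 (u y)) := by
      intro y hy
      rw [← hue hy, hu0, hU]
      exact (hsum y hy).hasSum.tendsto_sum_nat
    have bU : ∀ y ∈ Ioo (0:ℝ) 1, ∀ N, |U N y| ≤ ∑' n : ℕ, 12 * K * (11/12:ℝ)^n := by
      intro y hy N
      rw [hU]
      refine (Finset.abs_sum_le_sum_abs _ _).trans ((Finset.sum_le_sum fun n _ => hbd y hy n).trans ?_)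
      exact sgeo.sum_le_tsum _ (fun n _ => by positivity)
    have t1 : Tendsto (fun N => LL (U N) x) atTop (𝓝 (LL u x)) := by
      unfold LL
      refine tendsto_tsum_of_dominated_convergence
        (bound := fun a => wt a x * ∑' n : ℕ, 12 * K * (11/12:ℝ)^n)
        ((wt_hasSum hx).summable.mul_right _) (fun a => (tU _ (br_mem hx)).const_mul _) ?_
      refine Eventually.of_forall fun N a => ?_
      rw [Real.norm_eq_abs, abs_mul, abs_of_pos (wt_pos hx)]
      exact mul_le_mul_of_nonneg_left (bU _ (br_mem hx) N) (wt_pos hx).le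
    have e1 : ∀ N, LL (U N) x = U N x - (φ x - c) + (ψ N x - c) := by
      intro N
      have hh : ∀ n, HasSum (fun a => wt a x * (ψ n (br a x) - c)) (ψ (n+1) x - c) := by
        intro n
        have := ((hL n).summable (hr n) hx).hasSum.sub ((wt_hasSum hx).mul_right c)
        rw [one_mul] at this
        simpa [mul_sub, hs, LL] using this
      have h1 : HasSum (fun a => wt a x * U N (br a x)) (∑ n ∈ Finset.range N, (ψ (n+1) x - c)) := by
        have := hasSum_sum (s := Finset.range N) (fun n _ => hh n)
        simp only [← Finset.mul_sum] at this
        rw [hU]; exact this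
      rw [LL, h1.tsum_eq]
      have := Finset.sum_range_succ' (fun n => ψ n x - c) N
      rw [Finset.sum_range_succ, h0] at this
      rw [hU]; simp only; linarith
    have t2 : Tendsto (fun N => U N x - (φ x - c) + (ψ N x - c)) atTop (𝓝 (u x - (φ x - c) + (c - c))) :=
      ((tU x hx).sub_const _).add ((hcx x hx).sub_const _)
    simp_rw [e1] at t1
    have := tendsto_nhds_unique t1 t2
    linarith
  · intro m hm
    have : ∀ n, ∀ x ∈ Ioo (0:ℝ) 1, m ≤ ψ n x := by
      intro n
      induction n with
      | zero => rwa [h0]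
      | succ n ih => rw [hs]; exact LL_ge (hL n) (hr n) ih
    exact ge_of_tendsto' hc (fun n => this n _ half)
end
end KN
namespace KN
open MeasureTheory Filter Set
open scoped Topology ENNReal
open Real (log exp sqrt)
noncomputable section
def dens (x : ℝ) : ℝ := 1 / ((1 + x) * log 2)
def gm : Measure ℝ := (volume.restrict (Ioo (0:ℝ) 1)).withDensity (fun x => ENNReal.ofReal (dens x))
lemma log2_pos : 0 < log 2 := Real.log_pos (by norm_num)
lemma dens_meas : Measurable dens := by unfold dens; fun_prop
lemma br_meas (a : ℕ) : Measurable (br a) := by unfold br; fun_prop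
lemma wt_meas (a : ℕ) : Measurable (wt a) := by unfold wt; fun_prop
lemma gaussMap_meas : Measurable gaussMap := by
  unfold gaussMap
  refine Measurable.ite (measurableSet_singleton 0) measurable_const ?_
  have : Measurable (fun x : ℝ => 1 / x) := by fun_prop
  exact this.sub (measurable_from_top.comp (Int.measurable_floor.comp this))
lemma dens_pos {x : ℝ} (hx : x ∈ Ioo (0:ℝ) 1) : 0 < dens x := by
  have := hx.1; have := log2_pos; unfold dens; positivity
lemma gm_ae : ∀ᵐ x ∂gm, x ∈ Ioo (0:ℝ) 1 := by
  apply (withDensity_absolutelyContinuous _ _).ae_le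
  exact ae_restrict_mem measurableSet_Ioo
lemma lintegral_gm {F : ℝ → ℝ≥0∞} (hF : Measurable F) :
    ∫⁻ x, F x ∂gm = ∫⁻ x in Ioo (0:ℝ) 1, ENNReal.ofReal (dens x) * F x := by
  unfold gm
  rw [lintegral_withDensity_eq_lintegral_mul _ dens_meas.ennreal_ofReal hF]
  rfl
lemma gauss_br {a : ℕ} {x : ℝ} (hx : x ∈ Ioo (0:ℝ) 1) : gaussMap (br a x) = x := by
  have h0 := hx.1
  have h1 := hx.2
  unfold gaussMap
  have hb : br a x ≠ 0 := (br_mem hx).1.ne'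
  rw [if_neg hb]
  have e : 1 / br a x = (a + 1 : ℤ) + x := by unfold br; push_cast; rw [one_div_one_div]
  have e2 : ⌊1 / br a x⌋ = (a + 1 : ℤ) := by
    rw [e, Int.floor_intCast_add, Int.floor_eq_zero_iff.2 ⟨h0.le, h1⟩, add_zero]
  rw [e2, e]; push_cast; ring
lemma br_gauss {x : ℝ} (hx : x ∈ Ioo (0:ℝ) 1) (h : gaussMap x ≠ 0) :
    ∃ a : ℕ, gaussMap x ∈ Ioo (0:ℝ) 1 ∧ br a (gaussMap x) = x ∧ ⌊1/x⌋ = (a:ℤ) + 1 := by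
  have h0 := hx.1
  have h1 := hx.2
  have hT : gaussMap x = 1/x - ⌊1/x⌋ := by unfold gaussMap; rw [if_neg h0.ne']
  have hfl : (1:ℤ) ≤ ⌊1/x⌋ := by
    rw [Int.le_floor]; push_cast; rw [le_div_iff₀ h0]; linarith
  refine ⟨(⌊1/x⌋ - 1).toNat, ⟨?_, ?_⟩, ?_, ?_⟩
  · rw [hT] at h ⊢
    exact lt_of_le_of_ne (sub_nonneg.2 (Int.floor_le _)) (Ne.symm h)
  · rw [hT]; linarith [Int.lt_floor_add_one (1/x)]
  · have : (((⌊1/x⌋ - 1).toNat : ℕ) : ℝ) = ⌊1/x⌋ - 1 := by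
      have h := Int.toNat_of_nonneg (sub_nonneg.2 hfl)
      exact_mod_cast congrArg (Int.cast (R := ℝ)) h
    unfold br
    rw [this, hT]
    rw [show ((⌊1/x⌋:ℝ) - 1 + 1 + (1/x - ⌊1/x⌋)) = 1/x by ring, one_div_one_div]
  · rw [Int.toNat_of_nonneg (sub_nonneg.2 hfl)]; ring
lemma br_inj (a : ℕ) : InjOn (br a) (Ioo 0 1) := by
  intro x hx y hy h
  rw [← gauss_br (a := a) hx, h, gauss_br hy]
lemma br_image_disj : Pairwise (Function.onFun Disjoint fun a => br a '' Ioo (0:ℝ) 1) := by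
  intro a b hab
  rw [Function.onFun, Set.disjoint_left]
  rintro _ ⟨x, hx, rfl⟩ ⟨y, hy, h⟩
  have hxy : x = y := by rw [← gauss_br (a := a) hx, ← h, gauss_br hy]
  subst hxy
  have h0 := hx.1
  apply hab
  unfold br at h
  have h3 := one_div_one_div ((a:ℝ)+1+x)
  rw [← h, one_div_one_div] at h3
  have : (b:ℝ) = a := by linarith
  exact (by exact_mod_cast this.symm)
lemma br_union : (⋃ a, br a '' Ioo (0:ℝ) 1) =ᵐ[volume] Ioo (0:ℝ) 1 := by
  have hsub : (⋃ a, br a '' Ioo (0:ℝ) 1) ⊆ Ioo (0:ℝ) 1 := by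
    refine iUnion_subset fun a => ?_
    rintro _ ⟨x, hx, rfl⟩
    exact br_mem hx
  refine (hsub.eventuallyLE).antisymm ?_
  rw [ae_le_set]
  refine measure_mono_null (t := range (fun n : ℤ => 1 / (n:ℝ))) ?_ ((countable_range _).measure_zero _)
  rintro x ⟨hx, hn⟩
  by_cases h : gaussMap x = 0
  · refine ⟨⌊1/x⌋, ?_⟩
    unfold gaussMap at h
    rw [if_neg hx.1.ne'] at h
    simp only
    rw [← sub_eq_zero.1 h, one_div_one_div]
  · obtain ⟨a, h1, h2, -⟩ := br_gauss hx h
    exact (hn (mem_iUnion.2 ⟨a, ⟨gaussMap x, h1, h2⟩⟩)).elim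
lemma br_deriv {a : ℕ} {x : ℝ} (hx : x ∈ Ioo (0:ℝ) 1) :
    HasDerivWithinAt (br a) (-1 / (a+1+x)^2) (Ioo 0 1) x := by
  have h0 := hx.1
  unfold br
  have := ((hasDerivAt_id x).const_add ((a:ℝ)+1)).inv (by simp; positivity)
  have h2 : HasDerivAt (fun x : ℝ => 1 / ((a:ℝ) + 1 + x)) (-1 / (a+1+x)^2) x := by
    have e : (fun x : ℝ => 1 / ((a:ℝ) + 1 + x)) = (fun x : ℝ => (a:ℝ) + 1 + id x)⁻¹ := by
      ext y; simp
    rw [e]; exact this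
  exact h2.hasDerivWithinAt
lemma dual_lintegral {F : ℝ → ℝ≥0∞} (hF : Measurable F) :
    ∫⁻ x, F x ∂gm = ∑' a, ∫⁻ x, ENNReal.ofReal (wt a x) * F (br a x) ∂gm := by
  rw [lintegral_gm hF, ← setLIntegral_congr br_union, lintegral_iUnion _ br_image_disj]
  · congr 1; ext a
    rw [lintegral_image_eq_lintegral_abs_deriv_mul measurableSet_Ioo (fun x hx => br_deriv hx) (br_inj a),
      lintegral_gm (F := fun x => ENNReal.ofReal (wt a x) * F (br a x)) ((wt_meas a).ennreal_ofReal.mul (hF.comp (br_meas a)))]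
    refine setLIntegral_congr_fun measurableSet_Ioo fun x hx => ?_
    have h0 := hx.1
    have := log2_pos
    rw [← mul_assoc, ← mul_assoc, ← ENNReal.ofReal_mul (by positivity),
      ← ENNReal.ofReal_mul (dens_pos hx).le]
    congr 2
    rw [abs_div, abs_neg, abs_one, abs_of_pos (by positivity)]
    unfold dens br wt
    field_simp
    ring
  · intro a
    exact measurableSet_Ioo.image_of_continuousOn_injOn
      (fun x hx => (br_deriv hx).continuousWithinAt) (br_inj a)
lemma integral_dens : ∫ x in Ioo (0:ℝ) 1, dens x = 1 := by
  have h2 := log2_pos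
  rw [← integral_Ioc_eq_integral_Ioo, ← intervalIntegral.integral_of_le zero_le_one]
  have : ∀ x, dens x = (log 2)⁻¹ * (1 + x)⁻¹ := fun x => by unfold dens; rw [one_div, mul_inv, mul_comm]
  simp_rw [this]
  rw [intervalIntegral.integral_const_mul, intervalIntegral.integral_comp_add_left (fun x => x⁻¹),
    integral_inv_of_pos (by norm_num) (by norm_num)]
  norm_num
lemma dens_integrable : IntegrableOn dens (Ioo (0:ℝ) 1) :=
  not_not.1 fun h => by simpa [integral_undef h] using integral_dens
instance gm_prob : IsProbabilityMeasure gm := ⟨by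
  unfold gm
  rw [withDensity_apply _ MeasurableSet.univ, Measure.restrict_univ,
    ← ofReal_integral_eq_lintegral_ofReal dens_integrable, integral_dens, ENNReal.ofReal_one]
  filter_upwards [ae_restrict_mem measurableSet_Ioo] with x hx using (dens_pos hx).le⟩
lemma gm_eq_sum : gm = Measure.sum
    (fun a => (gm.withDensity (fun x => ENNReal.ofReal (wt a x))).map (br a)) := by
  ext B hB
  rw [Measure.sum_apply _ hB, ← lintegral_indicator_one hB,
    dual_lintegral (measurable_one.indicator hB)]
  congr 1; ext a
  rw [Measure.map_apply (br_meas a) hB, withDensity_apply _ (br_meas a hB),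
    ← lintegral_indicator (br_meas a hB)]
  congr 1; ext x
  by_cases h : br a x ∈ B <;> simp [h, Set.indicator]
lemma dual_lintegral' {F : ℝ → ℝ≥0∞} (hF : Measurable F) :
    ∫⁻ x, F x ∂gm = ∫⁻ x, ∑' a, ENNReal.ofReal (wt a x) * F (br a x) ∂gm := by
  rw [dual_lintegral hF, lintegral_tsum]
  intro a
  exact ((wt_meas a).ennreal_ofReal.mul (hF.comp (br_meas a))).aemeasurable
lemma wt_meas' (a : ℕ) : Measurable (fun x => (wt a x).toNNReal) := (wt_meas a).real_toNNReal
lemma dual_integral {E : Type*} [NormedAddCommGroup E] [NormedSpace ℝ E] [CompleteSpace E]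
    [MeasurableSpace E] [BorelSpace E] [SecondCountableTopology E]
    {F : ℝ → E} (hm : Measurable F) (hF : Integrable F gm) :
    ∫ x, F x ∂gm = ∫ x, ∑' a, wt a x • F (br a x) ∂gm := by
  have hF' := hF
  rw [gm_eq_sum] at hF'
  conv_lhs => rw [gm_eq_sum]
  rw [integral_sum_measure hF', integral_tsum]
  · congr 1; ext a
    rw [integral_map (br_meas a).aemeasurable hm.aestronglyMeasurable]
    rw [show (fun x => ENNReal.ofReal (wt a x)) = fun x => (((wt a x).toNNReal : NNReal) : ℝ≥0∞) from rfl,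
      integral_withDensity_eq_integral_smul (wt_meas' a)]
    refine integral_congr_ae ?_
    filter_upwards [gm_ae] with x hx
    simp [NNReal.smul_def, (wt_pos hx).le]
  · intro a
    exact ((wt_meas a).smul (hm.comp (br_meas a))).aestronglyMeasurable
  · have h2 := hF.2
    unfold HasFiniteIntegral at h2
    rw [dual_lintegral hm.enorm] at h2
    refine ne_of_lt (lt_of_le_of_lt (le_of_eq ?_) h2)
    congr 1; ext a
    refine lintegral_congr_ae ?_
    filter_upwards [gm_ae] with x hx
    rw [enorm_smul, Real.enorm_eq_ofReal (wt_pos hx).le]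
lemma gauss_mp : MeasurePreserving gaussMap gm gm := by
  refine ⟨gaussMap_meas, ?_⟩
  ext B hB
  rw [Measure.map_apply gaussMap_meas hB, ← lintegral_indicator_one hB,
    ← lintegral_indicator_one (gaussMap_meas hB),
    dual_lintegral' (measurable_one.indicator (gaussMap_meas hB))]
  refine lintegral_congr_ae ?_
  filter_upwards [gm_ae] with x hx
  have : ∀ a, (gaussMap ⁻¹' B).indicator (1 : ℝ → ℝ≥0∞) (br a x) = B.indicator 1 x := by
    intro a
    have : br a x ∈ gaussMap ⁻¹' B ↔ x ∈ B := by rw [mem_preimage, gauss_br hx]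
    by_cases h : x ∈ B
    · rw [indicator_of_mem h, indicator_of_mem (this.2 h)]; rfl
    · rw [indicator_of_notMem h, indicator_of_notMem (fun h' => h (this.1 h'))]
  simp_rw [this, ENNReal.tsum_mul_right]
  rw [← ENNReal.ofReal_tsum_of_nonneg (fun a => (wt_pos hx).le) (wt_hasSum hx).summable,
    (wt_hasSum hx).tsum_eq]
  simp
/-- Lebesgue measure in terms of the Gauss measure -/
lemma vol_lintegral {F : ℝ → ℝ≥0∞} (hF : Measurable F) :
    ∫⁻ x in Ioo (0:ℝ) 1, F x = ∫⁻ x, ENNReal.ofReal ((1 + x) * log 2) * F x ∂gm := by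
  rw [lintegral_gm (by fun_prop)]
  refine setLIntegral_congr_fun measurableSet_Ioo fun x hx => ?_
  have h0 := hx.1
  have := log2_pos
  rw [← mul_assoc, ← ENNReal.ofReal_mul (dens_pos hx).le]
  have : dens x * ((1 + x) * log 2) = 1 := by unfold dens; field_simp
  rw [this]; simp
lemma vol_eq : volume.restrict (Ioo (0:ℝ) 1) =
    gm.withDensity (fun x => ENNReal.ofReal ((1 + x) * log 2)) := by
  ext B hB
  rw [withDensity_apply _ hB, ← lintegral_indicator hB, ← lintegral_indicator_one hB,
    vol_lintegral (measurable_one.indicator hB)]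
  congr 1; ext x
  by_cases h : x ∈ B <;> simp [h, Set.indicator]
lemma vol_ac : volume.restrict (Ioo (0:ℝ) 1) ≪ gm := by
  rw [vol_eq]; exact withDensity_absolutelyContinuous _ _
lemma vol_le (B : Set ℝ) (hB : MeasurableSet B) : volume (B ∩ Ioo (0:ℝ) 1) ≤ 2 * gm B := by
  rw [← Measure.restrict_apply hB, vol_eq, withDensity_apply _ hB]
  have hl : log 2 ≤ 1 := by have := Real.log_two_lt_d9; linarith
  calc _ ≤ ∫⁻ x in B, 2 ∂gm := by
        refine lintegral_mono_ae ?_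
        filter_upwards [ae_restrict_of_ae gm_ae] with x hx
        rw [show (2:ℝ≥0∞) = ENNReal.ofReal 2 by simp]
        apply ENNReal.ofReal_le_ofReal
        have := hx.1; have := hx.2; have := log2_pos
        nlinarith
    _ = _ := by simp
lemma gm_le (B : Set ℝ) (hB : MeasurableSet B) : gm B ≤ 2 * volume (B ∩ Ioo (0:ℝ) 1) := by
  rw [← Measure.restrict_apply hB]
  unfold gm
  rw [withDensity_apply _ hB]
  have hl : 1/2 ≤ log 2 := by have := Real.log_two_gt_d9; linarith
  calc _ ≤ ∫⁻ x in B, 2 ∂(volume.restrict (Ioo (0:ℝ) 1)) := by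
        refine lintegral_mono_ae ?_
        filter_upwards [ae_restrict_of_ae (ae_restrict_mem measurableSet_Ioo)] with x hx
        rw [show (2:ℝ≥0∞) = ENNReal.ofReal 2 by simp]
        apply ENNReal.ofReal_le_ofReal
        have := hx.1; have := hx.2; have := log2_pos
        unfold dens
        rw [div_le_iff₀ (by positivity)]
        nlinarith
    _ = _ := by simp
lemma int_pow_log (n : ℕ) : ∫ x in Ioo (0:ℝ) 1, x ^ n * (-log x) = 1 / ((n:ℝ)+1)^2 := by
  rw [← integral_Ioc_eq_integral_Ioo, ← intervalIntegral.integral_of_le zero_le_one]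
  have hn : (n:ℝ) + 1 ≠ 0 := by positivity
  rw [intervalIntegral.integral_eq_sub_of_hasDerivAt_of_le (a := 0) (b := 1)
    (f := fun x => x^n * Real.negMulLog x / (n+1) + x^(n+1) / ((n:ℝ)+1)^2) zero_le_one]
  · simp
  · have := Real.continuous_negMulLog
    fun_prop
  · intro x hx
    have h1 := ((hasDerivAt_pow (n+1) x).mul (Real.hasDerivAt_log hx.1.ne')).neg.div_const ((n:ℝ)+1)
    have h2 := (hasDerivAt_pow (n+1) x).div_const (((n:ℝ)+1)^2)
    have h3 := h1.add h2
    have e : (fun x => x^n * Real.negMulLog x / (n+1) + x^(n+1) / ((n:ℝ)+1)^2) =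
       ((fun x => (-((fun x : ℝ => x^(n+1)) * log) : ℝ → ℝ) x / ((n:ℝ)+1)) + fun x => x^(n+1) / ((n:ℝ)+1)^2) := by
      ext y; simp [Real.negMulLog]; ring
    rw [e]
    refine h3.congr_deriv ?_
    have := hx.1
    push_cast
    field_simp
    ring
  · exact (intervalIntegral.intervalIntegrable_log').neg.continuousOn_mul (by fun_prop)
lemma log_int : IntegrableOn (fun x => log x) (Ioo (0:ℝ) 1) := by
  have := (intervalIntegral.intervalIntegrable_log' (a := 0) (b := 1))
  rw [intervalIntegrable_iff_integrableOn_Ioo_of_le zero_le_one] at this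
  exact this
lemma alt_zeta : HasSum (fun n : ℕ => (-1:ℝ)^n * (1 / ((n:ℝ)+1)^2)) (Real.pi^2/12) := by
  have h0 : HasSum (fun n : ℕ => (1:ℝ) / ((n:ℝ)+1)^2) (Real.pi^2/6) := by
    have := (hasSum_nat_add_iff' 1).2 hasSum_zeta_two
    simpa using this
  have h1 : HasSum (fun n : ℕ => (1 - (-1:ℝ)^n) * (1 / ((n:ℝ)+1)^2)) (0 + Real.pi^2/12) := by
    apply HasSum.even_add_odd
    · have e : (fun k : ℕ => (1 - (-1:ℝ)^(2*k)) * (1 / (((2*k : ℕ):ℝ)+1)^2)) = fun _ => 0 := by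
        ext k; simp
      rw [e]; exact hasSum_zero
    · have e : (fun k : ℕ => (1 - (-1:ℝ)^(2*k+1)) * (1 / (((2*k+1 : ℕ):ℝ)+1)^2)) =
          fun k : ℕ => (1/2) * (1 / ((k:ℝ)+1)^2) := by
        ext k
        rw [pow_succ, pow_mul]; push_cast; norm_num; field_simp; ring
      rw [e, show Real.pi^2/12 = 1/2 * (Real.pi^2/6) by ring]
      exact h0.mul_left _
  have h2 := h0.sub h1
  rw [show Real.pi^2/6 - (0 + Real.pi^2/12) = Real.pi^2/12 by ring] at h2
  have e : (fun n : ℕ => (-1:ℝ)^n * (1 / ((n:ℝ)+1)^2)) =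
      fun n : ℕ => 1 / ((n:ℝ)+1)^2 - (1 - (-1:ℝ)^n) * (1 / ((n:ℝ)+1)^2) := by
    ext n; ring
  rw [e]; exact h2
lemma int_log_mean : ∫ x in Ioo (0:ℝ) 1, (-log x) / (1 + x) = Real.pi^2/12 := by
  have hi : ∀ n : ℕ, IntegrableOn (fun x : ℝ => x ^ n * (-log x)) (Ioo (0:ℝ) 1) := fun n =>
    not_not.1 fun h => by
      have h2 := int_pow_log n
      rw [integral_undef h] at h2
      have : (0:ℝ) < 1 / ((n:ℝ)+1)^2 := by positivity
      linarith
  have key := hasSum_integral_of_summable_integral_norm (μ := volume.restrict (Ioo (0:ℝ) 1))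
    (F := fun n : ℕ => fun x : ℝ => (-1:ℝ)^n * (x ^ n * (-log x))) (fun n => (hi n).const_mul _) ?_
  · simp_rw [integral_const_mul, int_pow_log] at key
    rw [← key.unique alt_zeta]
    refine setIntegral_congr_fun measurableSet_Ioo fun x hx => ?_
    have h := (hasSum_geometric_of_abs_lt_one (r := -x) (by rw [abs_neg, abs_of_pos hx.1]; exact hx.2)).mul_right (-log x)
    have h' : HasSum (fun n : ℕ => (-1:ℝ)^n * (x ^ n * (-log x))) ((1 - -x)⁻¹ * (-log x)) := by
      have e : (fun n : ℕ => (-1:ℝ)^n * (x ^ n * (-log x))) = fun n => (-x)^n * (-log x) := by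
        ext n; rw [neg_pow]; ring
      rw [e]; exact h
    rw [h'.tsum_eq, sub_neg_eq_add, div_eq_inv_mul]
  · have : ∀ n : ℕ, ∫ x in Ioo (0:ℝ) 1, ‖(-1:ℝ)^n * (x ^ n * (-log x))‖ = 1 / ((n:ℝ)+1)^2 := by
      intro n
      rw [← int_pow_log n]
      refine setIntegral_congr_fun measurableSet_Ioo fun x hx => ?_
      have h1 : log x ≤ 0 := Real.log_nonpos hx.1.le hx.2.le
      have h2 := pow_pos hx.1 n
      simp only [norm_mul, norm_pow, norm_neg, norm_one, one_pow, one_mul, Real.norm_eq_abs]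
      rw [abs_of_nonpos h1, abs_of_pos hx.1]
    simp_rw [this]
    have := (hasSum_nat_add_iff' 1).2 hasSum_zeta_two
    simpa using this.summable
def lam : ℝ := Real.pi^2 / (12 * log 2)
lemma lam_pos : 0 < lam := by have := log2_pos; unfold lam; positivity
lemma integral_gm (F : ℝ → ℝ) : ∫ x, F x ∂gm = ∫ x in Ioo (0:ℝ) 1, dens x * F x := by
  unfold gm
  rw [show (fun x => ENNReal.ofReal (dens x)) = fun x => (((dens x).toNNReal : NNReal) : ℝ≥0∞) from rfl,
      integral_withDensity_eq_integral_smul dens_meas.real_toNNReal]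
  refine setIntegral_congr_fun measurableSet_Ioo fun x hx => ?_
  simp [NNReal.smul_def, (dens_pos hx).le]
lemma gm_le_vol : gm ≤ (2:ℝ≥0∞) • volume.restrict (Ioo (0:ℝ) 1) := by
  refine Measure.le_iff.2 fun B hB => ?_
  rw [Measure.smul_apply, smul_eq_mul, Measure.restrict_apply hB]
  exact gm_le B hB
lemma log_int_gm : Integrable (fun x => -log x) gm :=
  (log_int.neg.smul_measure (c := 2) (by simp)).mono_measure gm_le_vol
lemma mean_log : ∫ x, -log x ∂gm = lam := by
  rw [integral_gm]
  have := log2_pos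
  have e : lam = (log 2)⁻¹ * (Real.pi^2/12) := by unfold lam; field_simp
  rw [e, ← int_log_mean, ← integral_const_mul]
  refine setIntegral_congr_fun measurableSet_Ioo fun x hx => ?_
  have := hx.1
  simp only [dens]
  field_simp
/-- mean identification -/
lemma mean_id {u φ f : ℝ → ℝ} {c K : ℝ} (hK0 : 0 ≤ K) (hu : Continuous u) (hK : Lp K u)
    (h : ∀ x ∈ Ioo (0:ℝ) 1, u x - LL u x = φ x - c)
    (hfm : Measurable f) (hf : Integrable f gm)
    (hs : ∀ x ∈ Ioo (0:ℝ) 1, Summable (fun a => wt a x * f (br a x)))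
    (hφ : ∀ x ∈ Ioo (0:ℝ) 1, φ x = LL f x) :
    c = ∫ x, f x ∂gm := by
  have hui : Integrable u gm := by
    refine Integrable.of_bound hu.aestronglyMeasurable (|u (1/2)| + K) ?_
    filter_upwards [gm_ae] with x hx using hK.bdd hK0 hx
  have huT : Integrable (fun x => u (gaussMap x)) gm := gauss_mp.integrable_comp_of_integrable hui
  have e1 : ∫ x, u (gaussMap x) ∂gm = ∫ x, u x ∂gm := by
    have := integral_map (μ := gm) gaussMap_meas.aemeasurable (f := u) hu.aestronglyMeasurable
    rw [gauss_mp.map_eq] at this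
    exact this.symm
  have hi : Integrable (fun x => f x + u x - u (gaussMap x) - c) gm :=
    ((hf.add hui).sub huT).sub (integrable_const c)
  have e2 : ∫ x, (f x + u x - u (gaussMap x) - c) ∂gm = (∫ x, f x ∂gm) - c := by
    rw [integral_sub, integral_sub, integral_add hf hui, e1]
    · simp
    · exact hf.add hui
    · exact huT
    · exact (hf.add hui).sub huT
    · exact integrable_const c
  have hm : Measurable (fun x => f x + u x - u (gaussMap x) - c) := by
    have := hu.measurable
    have := this.comp gaussMap_meas
    exact ((hfm.add hu.measurable).sub this).sub_const c
  rw [dual_integral hm hi] at e2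
  have e3 : ∫ x, ∑' a, wt a x • (f (br a x) + u (br a x) - u (gaussMap (br a x)) - c) ∂gm = 0 := by
    rw [← integral_zero ℝ ℝ (μ := gm)]
    refine integral_congr_ae ?_
    filter_upwards [gm_ae] with x hx
    have h1 := ((hs x hx).hasSum.add (hK.summable hK0 hx).hasSum).sub ((wt_hasSum hx).mul_right (u x + c))
    have e : (fun a => wt a x • (f (br a x) + u (br a x) - u (gaussMap (br a x)) - c)) =
       fun a => wt a x * f (br a x) + wt a x * u (br a x) - wt a x * (u x + c) := by
      ext a; rw [gauss_br hx, smul_eq_mul]; ring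
    rw [e, h1.tsum_eq]
    have h2 := h x hx
    rw [hφ x hx] at h2
    unfold LL at h2
    linarith
  linarith
end
end KN
namespace KN
open MeasureTheory Filter Set
open scoped Topology ENNReal
open Real (log exp sqrt)
noncomputable section
def ww (a : ℕ) : ℝ := 2 * sqrt (a+1) / ((a+1)*(a+2))
lemma ww_nonneg (a : ℕ) : 0 ≤ ww a := by unfold ww; positivity
lemma ww_sum_nonneg : 0 ≤ ∑' a, ww a := tsum_nonneg ww_nonneg
lemma hasSum_of_eq {f : ℕ → ℝ} {S S' : ℝ} (h : HasSum f S) (e : S = S') : HasSum f S' := e ▸ h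
lemma ww_summable : Summable ww := by
  have h : Summable (fun n : ℕ => 1 / ((n:ℝ) + 1) ^ (3/2 : ℝ)) := by
    have := (summable_nat_add_iff 1).2 (Real.summable_one_div_nat_rpow (p := 3/2)|>.2 (by norm_num))
    simpa using this
  refine Summable.of_nonneg_of_le ww_nonneg (fun a => ?_) (h.mul_left 2)
  unfold ww
  have h0 : (0:ℝ) < a + 1 := by positivity
  have e : ((a:ℝ)+1) ^ (3/2:ℝ) = (a+1) * sqrt (a+1) := by
    rw [Real.sqrt_eq_rpow, show (3/2:ℝ) = 1 + 1/2 by norm_num, Real.rpow_add h0, Real.rpow_one]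
  rw [e, mul_one_div, div_le_div_iff₀ (by positivity) (by positivity)]
  have h2 := Real.mul_self_sqrt h0.le
  have h3 := Real.sqrt_nonneg ((a:ℝ)+1)
  nlinarith
lemma wt_sqrt_le {a : ℕ} {x : ℝ} (hx : x ∈ Ioo (0:ℝ) 1) : wt a x * sqrt (a+1) ≤ ww a := by
  have := wt_le (a := a) hx
  have h3 := Real.sqrt_nonneg ((a:ℝ)+1)
  unfold ww
  calc _ ≤ 2/((a+1)*(a+2)) * sqrt ((a:ℝ)+1) := by gcongr
    _ = _ := by ring
lemma wt_lip {a : ℕ} {x y : ℝ} (hx : x ∈ Ioo (0:ℝ) 1) (hy : y ∈ Ioo (0:ℝ) 1) :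
    |wt a x - wt a y| * sqrt (a+1) ≤ 2 * ww a * |x - y| := by
  have hx0 := hx.1; have hx1 := hx.2; have hy0 := hy.1; have hy1 := hy.2
  have h3 := Real.sqrt_nonneg ((a:ℝ)+1)
  have ha : (0:ℝ) ≤ a := by positivity
  have key : |wt a x - wt a y| ≤ 4 / ((a+1)*(a+2)) * |x - y| := by
    have e : wt a x - wt a y = (x - y) * (((a:ℝ)+1)*(a+2) - (2*a+3) - (x+y) - x*y) /
        (((a+1+x)*(a+2+x)) * ((a+1+y)*(a+2+y))) := by
      unfold wt
      field_simp
      ring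
    rw [e, abs_div, abs_mul]
    have hd : ((a:ℝ)+1)*(a+2) * ((a+1)*(a+2)) ≤ ((a+1+x)*(a+2+x)) * ((a+1+y)*(a+2+y)) := by
      gcongr ?_ * ?_ * (?_ * ?_) <;> linarith
    have hd0 : 0 < ((a:ℝ)+1)*(a+2) * ((a+1)*(a+2)) := by positivity
    have hn : |((a:ℝ)+1)*(a+2) - (2*a+3) - (x+y) - x*y| ≤ 4 * (((a:ℝ)+1)*(a+2)) := by
      have : 0 ≤ x*y := by positivity
      have : x*y ≤ 1 := by nlinarith
      rw [abs_le]; constructor <;> nlinarith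
    rw [abs_of_pos (lt_of_lt_of_le hd0 hd)]
    calc _ ≤ |x-y| * (4 * (((a:ℝ)+1)*(a+2))) / (((a:ℝ)+1)*(a+2) * ((a+1)*(a+2))) := by gcongr
      _ = _ := by field_simp
  calc _ ≤ 4 / ((a+1)*(a+2)) * |x - y| * sqrt (a+1) := by gcongr
    _ = _ := by unfold ww; ring
lemma sum_bd {E : Type*} [NormedAddCommGroup E] [NormedSpace ℝ E] [CompleteSpace E]
    {h : ℕ → E} {A x : ℝ} (hx : x ∈ Ioo (0:ℝ) 1)
    (hb : ∀ a, ‖h a‖ ≤ A * sqrt (a+1)) :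
    Summable (fun a => wt a x • h a) ∧ ‖∑' a, wt a x • h a‖ ≤ A * ∑' a, ww a := by
  have hb' : ∀ a, ‖wt a x • h a‖ ≤ A * ww a := by
    intro a
    have hA : 0 ≤ A := by
      have h1 := (norm_nonneg _).trans (hb 0)
      simpa using h1
    rw [norm_smul, Real.norm_of_nonneg (wt_pos hx).le]
    calc _ ≤ wt a x * (A * sqrt (a+1)) := by gcongr; exact (wt_pos hx).le; exact hb a
      _ = A * (wt a x * sqrt (a+1)) := by ring
      _ ≤ _ := by gcongr; exact wt_sqrt_le hx
  refine ⟨Summable.of_norm_bounded (ww_summable.mul_left A) hb', ?_⟩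
  exact tsum_of_norm_bounded (ww_summable.hasSum.mul_left A) hb'
lemma Lp_sum {h : ℕ → ℝ → ℝ} {A : ℝ} (hA : 0 ≤ A)
    (hb : ∀ a, ∀ x ∈ Ioo (0:ℝ) 1, |h a x| ≤ A * sqrt (a+1))
    (hl : ∀ a, ∀ x ∈ Ioo (0:ℝ) 1, ∀ y ∈ Ioo (0:ℝ) 1, |h a x - h a y| ≤ A * sqrt (a+1) * |x-y|) :
    Lp (3 * A * ∑' a, ww a) (fun x => ∑' a, wt a x * h a x) := by
  intro x hx y hy
  have s1 := (sum_bd (h := fun a => h a x) hx (fun a => hb a x hx)).1.hasSum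
  have s2 := (sum_bd (h := fun a => h a y) hy (fun a => hb a y hy)).1.hasSum
  have s3 := s1.sub s2
  simp only [smul_eq_mul] at s3
  rw [← s3.tsum_eq, ← Real.norm_eq_abs]
  have : 3 * A * (∑' a, ww a) * |x - y| = (3 * A * |x-y|) * ∑' a, ww a := by ring
  rw [this]
  refine tsum_of_norm_bounded (ww_summable.hasSum.mul_left _) fun a => ?_
  rw [Real.norm_eq_abs]
  have e : wt a x * h a x - wt a y * h a y = (wt a x - wt a y) * h a x + wt a y * (h a x - h a y) := by ring
  rw [e]
  have t1 : |wt a x - wt a y| * |h a x| ≤ 2 * ww a * |x-y| * A := by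
    calc _ ≤ |wt a x - wt a y| * (A * sqrt (a+1)) := by gcongr; exact hb a x hx
      _ = (|wt a x - wt a y| * sqrt (a+1)) * A := by ring
      _ ≤ _ := mul_le_mul_of_nonneg_right (wt_lip hx hy) hA
  have t2 : |wt a y| * |h a x - h a y| ≤ ww a * |x-y| * A := by
    rw [abs_of_pos (wt_pos hy)]
    calc _ ≤ wt a y * (A * sqrt (a+1) * |x-y|) := by
          gcongr; exact (wt_pos hy).le; exact hl a x hx y hy
      _ = (wt a y * sqrt (a+1)) * (A * |x-y|) := by ring
      _ ≤ ww a * (A * |x-y|) := by gcongr; exact wt_sqrt_le hy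
      _ = _ := by ring
  calc _ ≤ |wt a x - wt a y| * |h a x| + |wt a y| * |h a x - h a y| := by
        rw [← abs_mul, ← abs_mul]; exact abs_add_le _ _
    _ ≤ _ := by linarith
def DD (u : ℝ → ℝ) (a : ℕ) (x : ℝ) : ℝ := log (a+1+x) - lam + u (br a x) - u x
lemma br_lip {a : ℕ} {x y : ℝ} (hx : x ∈ Ioo (0:ℝ) 1) (hy : y ∈ Ioo (0:ℝ) 1) :
    |br a x - br a y| ≤ |x - y| := by
  have hx0 := hx.1; have hy0 := hy.1
  have e : br a x - br a y = (y - x) / ((a+1+x)*(a+1+y)) := by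
    unfold br; field_simp; ring
  rw [e, abs_div, abs_sub_comm y x]
  apply div_le_self (abs_nonneg _)
  rw [abs_of_pos (by positivity)]
  have ha : (0:ℝ) ≤ a := by positivity
  nlinarith [mul_nonneg ha ha, mul_pos hx0 hy0, mul_nonneg ha hx0.le, mul_nonneg ha hy0.le]
lemma log_lip {a : ℕ} {x y : ℝ} (hx : x ∈ Ioo (0:ℝ) 1) (hy : y ∈ Ioo (0:ℝ) 1) :
    |log (a+1+x) - log (a+1+y)| ≤ |x - y| := by
  have key : ∀ x y : ℝ, 0 < x → 0 < y → log (a+1+x) - log (a+1+y) ≤ |x-y| := by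
    intro x y hx hy
    rw [← Real.log_div (by positivity) (by positivity)]
    have := Real.log_le_sub_one_of_pos (x := ((a:ℝ)+1+x)/(a+1+y)) (by positivity)
    have e : ((a:ℝ)+1+x)/(a+1+y) - 1 = (x-y)/(a+1+y) := by field_simp; ring
    rw [e] at this
    refine this.trans ((le_abs_self _).trans ?_)
    rw [abs_div]
    apply div_le_self (abs_nonneg _)
    rw [abs_of_pos (by positivity)]
    have ha : (0:ℝ) ≤ a := by positivity
    linarith
  rw [abs_le]
  have h1 := key x y hx.1 hy.1
  have h2 := key y x hy.1 hx.1
  rw [abs_sub_comm] at h2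
  constructor <;> linarith
lemma log_bd {a : ℕ} {x : ℝ} (hx : x ∈ Ioo (0:ℝ) 1) :
    0 ≤ log (a+1+x) ∧ exp (log (a+1+x) / 2) ≤ 2 * sqrt (a+1) := by
  have hx0 := hx.1; have hx1 := hx.2
  have ha : (0:ℝ) ≤ a := by positivity
  refine ⟨Real.log_nonneg (by linarith), ?_⟩
  rw [← Real.log_sqrt (by positivity), Real.exp_log (by positivity)]
  rw [show 2 * sqrt ((a:ℝ)+1) = sqrt (4 * (a+1)) by
    rw [Real.sqrt_mul (by norm_num), show (4:ℝ) = 2^2 by norm_num, Real.sqrt_sq (by norm_num)]]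
  apply Real.sqrt_le_sqrt
  linarith
/-- `E = e^{|D|/2}` bound -/
lemma DD_exp {u : ℝ → ℝ} {B : ℝ} (hB : ∀ x ∈ Ioo (0:ℝ) 1, |u x| ≤ B) {a : ℕ} {x : ℝ}
    (hx : x ∈ Ioo (0:ℝ) 1) :
    exp (|DD u a x| / 2) ≤ 2 * exp ((lam + 2 * B)/2) * sqrt (a+1) := by
  obtain ⟨h1, h2⟩ := log_bd (a := a) hx
  have h3 := hB x hx
  have h4 := hB _ (br_mem (a := a) hx)
  have hl := lam_pos
  have : |DD u a x| ≤ log (a+1+x) + (lam + 2*B) := by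
    unfold DD
    rw [abs_le] at *
    constructor <;> linarith
  calc _ ≤ exp (log (a+1+x)/2 + (lam+2*B)/2) := Real.exp_le_exp.2 (by linarith)
    _ = exp (log (a+1+x)/2) * exp ((lam+2*B)/2) := Real.exp_add _ _
    _ ≤ 2 * sqrt (a+1) * exp ((lam+2*B)/2) := by gcongr
    _ = _ := by ring
lemma pow_le_exp (t : ℝ) (ht : 0 ≤ t) : t ≤ 2 * exp (t/2) ∧ t^2 ≤ 8 * exp (t/2) ∧
    t^3 * exp (t/4) ≤ 384 * exp (t/2) ∧ t * exp (t/4) ≤ 384 * exp (t/2) ∧ t ^ 2 * exp (t/4) ≤ 384 * exp (t/2) := by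
  have h1 := Real.pow_div_factorial_le_exp (t/2) (by positivity) 1
  have h2 := Real.pow_div_factorial_le_exp (t/2) (by positivity) 2
  have g1 := Real.pow_div_factorial_le_exp (t/4) (by positivity) 1
  have g2 := Real.pow_div_factorial_le_exp (t/4) (by positivity) 2
  have g3 := Real.pow_div_factorial_le_exp (t/4) (by positivity) 3
  have e : exp (t/2) = exp (t/4) * exp (t/4) := by rw [← Real.exp_add]; ring_nf
  have e0 := Real.exp_pos (t/4)
  norm_num [Nat.factorial] at h1 h2 g1 g2 g3
  refine ⟨by linarith, by nlinarith, ?_, ?_, ?_⟩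
  all_goals rw [e, ← mul_assoc]; gcongr; nlinarith
lemma exists_u : ∃ (u : ℝ → ℝ) (K : ℝ), 0 ≤ K ∧ Continuous u ∧ Lp K u ∧
    ∀ x ∈ Ioo (0:ℝ) 1, HasSum (fun a => wt a x * DD u a x) 0 := by
  have hb : ∀ a : ℕ, ∀ x ∈ Ioo (0:ℝ) 1, |log (a+1+x)| ≤ 4 * sqrt (a+1) := by
    intro a x hx
    obtain ⟨h1, h2⟩ := log_bd (a := a) hx
    rw [abs_of_nonneg h1]
    have := (pow_le_exp _ h1).1
    linarith
  have hs1 : ∀ a : ℕ, 1 ≤ sqrt ((a:ℝ)+1) := by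
    intro a; rw [Real.one_le_sqrt]; have : (0:ℝ) ≤ a := by positivity
    linarith
  have hl := Lp_sum (h := fun a x => log (a+1+x)) (A := 4) (by norm_num) hb (by
    intro a x hx y hy
    refine (log_lip hx hy).trans ?_
    have := hs1 a
    exact le_mul_of_one_le_left (abs_nonneg _) (by linarith))
  have h0 : 0 ≤ 3 * 4 * ∑' a, ww a := by have := ww_sum_nonneg; positivity
  obtain ⟨c, u, K, hK, hu, hKu, he, -⟩ := poisson hl h0
  have hsum : ∀ x ∈ Ioo (0:ℝ) 1, Summable (fun a : ℕ => wt a x * log (a+1+x)) := fun x hx =>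
    (sum_bd (h := fun a : ℕ => log (a+1+x)) hx (fun a => hb a x hx)).1
  have hc : c = lam := by
    rw [← mean_log]
    have hbr : ∀ x (a : ℕ), -log (br a x) = log (a+1+x) := by
      intro x a; unfold br; rw [one_div, Real.log_inv, neg_neg]
    refine mean_id hK hu hKu he (Real.measurable_log.neg) log_int_gm ?_ ?_
    · intro x hx
      simp_rw [hbr]; exact hsum x hx
    · intro x hx; unfold LL; simp_rw [hbr]
  refine ⟨u, K, hK, hu, hKu, fun x hx => ?_⟩
  have h1 := ((hsum x hx).hasSum.add (hKu.summable hK hx).hasSum).sub ((wt_hasSum hx).mul_right (u x + lam))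
  have e : (fun a : ℕ => wt a x * DD u a x) =
    fun a : ℕ => wt a x * log (a+1+x) + wt a x * u (br a x) - wt a x * (u x + lam) := by
    ext a; unfold DD; ring
  have h2 := he x hx
  unfold LL at h2
  rw [hc] at h2
  rw [e]
  exact hasSum_of_eq h1 (by linarith)
lemma exists_v {u : ℝ → ℝ} {K : ℝ} (hK : 0 ≤ K) (hKu : Lp K u) :
    ∃ (v : ℝ → ℝ) (σ2 K' : ℝ), 0 < σ2 ∧ 0 ≤ K' ∧ Continuous v ∧ Lp K' v ∧
    ∀ x ∈ Ioo (0:ℝ) 1, v x - LL v x = ((∑' a, wt a x * DD u a x ^ 2) - σ2)/2 := by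
  have hB : ∀ x ∈ Ioo (0:ℝ) 1, |u x| ≤ |u (1/2)| + K := fun x hx => hKu.bdd hK hx
  obtain ⟨B, hBe⟩ : ∃ B, B = |u (1/2)| + K := ⟨_, rfl⟩
  rw [← hBe] at hB
  have hB0 : 0 ≤ B := by rw [hBe]; positivity
  obtain ⟨M, hM⟩ : ∃ M, M = 2 * exp ((lam + 2 * B)/2) := ⟨_, rfl⟩
  have hM0 : 0 ≤ M := by rw [hM]; positivity
  have hE : ∀ a : ℕ, ∀ x ∈ Ioo (0:ℝ) 1, exp (|DD u a x| / 2) ≤ M * sqrt (a+1) :=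
    fun a x hx => by rw [hM]; exact DD_exp hB hx
  have hlip : ∀ a : ℕ, ∀ x ∈ Ioo (0:ℝ) 1, ∀ y ∈ Ioo (0:ℝ) 1, |DD u a x - DD u a y| ≤ (1+2*K)*|x-y| := by
    intro a x hx y hy
    have h1 := log_lip (a := a) hx hy
    have h2 := hKu x hx y hy
    have h3 := (hKu _ (br_mem (a := a) hx) _ (br_mem (a := a) hy)).trans (mul_le_mul_of_nonneg_left (br_lip (a := a) hx hy) hK)
    unfold DD
    rw [abs_le] at *
    constructor <;> linarith
  have hA : 0 ≤ 8 * M + 4*M*(1+2*K) := by positivity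
  have hsq : ∀ a : ℕ, ∀ x ∈ Ioo (0:ℝ) 1, |DD u a x ^ 2| ≤ (8*M + 4*M*(1+2*K)) * sqrt (a+1) := by
    intro a x hx
    have h1 := (pow_le_exp _ (abs_nonneg (DD u a x))).2.1
    have h2 := hE a x hx
    rw [abs_pow]
    have h3 : 0 ≤ 4*M*(1+2*K) * sqrt (a+1) := by positivity
    nlinarith
  have hl := Lp_sum (h := fun a x => DD u a x ^ 2) hA hsq (by
    intro a x hx y hy
    have h1 := (pow_le_exp _ (abs_nonneg (DD u a x))).1
    have h2 := hE a x hx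
    have h1' := (pow_le_exp _ (abs_nonneg (DD u a y))).1
    have h2' := hE a y hy
    have h4 := hlip a x hx y hy
    rw [sq_sub_sq, abs_mul]
    have h5 : |DD u a x + DD u a y| ≤ 4 * M * sqrt (a+1) := by
      refine (abs_add_le _ _).trans ?_; linarith
    calc _ ≤ (4 * M * sqrt (a+1)) * ((1+2*K)*|x-y|) := by gcongr
      _ = (4*M*(1+2*K)) * sqrt (a+1) * |x-y| := by ring
      _ ≤ _ := by gcongr; linarith)
  have hS := ww_sum_nonneg
  obtain ⟨c, v, K', hK', hv, hKv, he, hc⟩ := poisson hl (by positivity)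
  obtain ⟨a0, ha0⟩ := exists_nat_ge (exp (lam + 2*B + 1))
  have hpos : (0:ℝ) < 1 / ((a0+2)*(a0+3)) := by positivity
  have hcp := hc (1 / ((a0+2)*(a0+3))) (by
    intro x hx
    have hx0 := hx.1; have hx1 := hx.2
    have h1 : 1 ≤ DD u a0 x := by
      have h3 := hB x hx
      have h4 := hB _ (br_mem (a := a0) hx)
      have h5 : lam + 2*B+1 ≤ log (a0+1+x) := by
        rw [Real.le_log_iff_exp_le (by positivity)]; linarith
      unfold DD
      rw [abs_le] at *
      linarith
    have h2 : wt a0 x * DD u a0 x^2 ≤ ∑' a, wt a x * DD u a x ^ 2 :=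
      (sum_bd (h := fun a => DD u a x ^2) hx (fun a => hsq a x hx)).1.le_tsum a0
        (fun a _ => mul_nonneg (wt_pos hx).le (sq_nonneg _))
    refine le_trans ?_ h2
    have h3 : 1 / (((a0:ℝ)+2)*(a0+3)) ≤ wt a0 x := by
      unfold wt
      rw [div_le_div_iff₀ (by positivity) (by positivity)]
      have ha : (0:ℝ) ≤ a0 := by positivity
      nlinarith [mul_nonneg ha hx0.le, mul_nonneg (mul_nonneg ha ha) hx0.le]
    have h4 := wt_pos (a := a0) hx
    exact h3.trans (le_mul_of_one_le_right h4.le (one_le_pow₀ h1)))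
  refine ⟨fun x => v x / 2, c, K'/2, lt_of_lt_of_le hpos hcp, by positivity, by fun_prop, ?_, ?_⟩
  · intro x hx y hy
    have := hKv x hx y hy
    rw [← sub_div, abs_div, abs_two]; linarith
  · intro x hx
    have h1 := he x hx
    have : LL (fun x => v x / 2) x = LL v x / 2 := by
      unfold LL; rw [← tsum_div_const]; congr 1; ext a; ring
    rw [this]; linarith
/-- The perturbed transfer operator, pointwise -/
lemma pert {u v : ℝ → ℝ} {B σ2 : ℝ} (hB0 : 0 ≤ B) (hσ : 0 < σ2) (hB : ∀ x ∈ Ioo (0:ℝ) 1, |u x| ≤ B)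
    (hBv : ∀ x ∈ Ioo (0:ℝ) 1, |v x| ≤ B)
    (h1 : ∀ x ∈ Ioo (0:ℝ) 1, HasSum (fun a => wt a x * DD u a x) 0)
    (h2 : ∀ x ∈ Ioo (0:ℝ) 1, v x - LL v x = ((∑' a, wt a x * DD u a x ^ 2) - σ2)/2) :
    ∃ C : ℝ, 0 ≤ C ∧ ∀ x ∈ Ioo (0:ℝ) 1, ∀ z : ℂ, ‖z‖ ≤ 1/4 →
      Summable (fun a => wt a x • (Complex.exp (z * DD u a x) * (1 + z^2 * v (br a x)))) ∧
      ‖(∑' a, wt a x • (Complex.exp (z * DD u a x) * (1 + z^2 * v (br a x)))) -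
        (1 + z^2 * v x) * Complex.exp (z^2 * σ2 / 2)‖ ≤ C * ‖z‖^3 := by
  obtain ⟨M, hM⟩ : ∃ M, M = 2 * exp ((lam + 2 * B)/2) := ⟨_, rfl⟩
  have hM0 : 0 ≤ M := by rw [hM]; positivity
  have hE : ∀ a : ℕ, ∀ x ∈ Ioo (0:ℝ) 1, exp (|DD u a x| / 2) ≤ M * sqrt (a+1) :=
    fun a x hx => by rw [hM]; exact DD_exp hB hx
  obtain ⟨A, hA⟩ : ∃ A, A = 384 * M * (1 + 3*B) := ⟨_, rfl⟩
  have hA0 : 0 ≤ A := by rw [hA]; positivity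
  obtain ⟨C2, hC2⟩ : ∃ C2, C2 = B * σ2 + (1+B)*(σ2^2 * exp σ2) := ⟨_, rfl⟩
  have hC20 : 0 ≤ C2 := by rw [hC2]; positivity
  have hS := ww_sum_nonneg
  refine ⟨A * (∑' a, ww a) + C2, by positivity, fun x hx z hz => ?_⟩
  have hz1 : ‖z‖ ≤ 1 := by linarith
  have hz0 := norm_nonneg z
  have hvx := hBv x hx
  obtain ⟨R, hR⟩ : ∃ R : ℕ → ℂ, R = fun a => Complex.exp (z * DD u a x) * (1 + z^2 * v (br a x)) -
    (1 + z * DD u a x + z^2 * DD u a x ^2/2 + z^2 * v (br a x)) := ⟨_, rfl⟩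
  have hRb : ∀ a, ‖R a‖ ≤ (A * ‖z‖^3) * sqrt (a+1) := by
    intro a
    have hv := hBv _ (br_mem (a := a) hx)
    obtain ⟨d, hd⟩ : ∃ d, d = DD u a x := ⟨_, rfl⟩
    have hEa := hE a x hx
    have hp := pow_le_exp _ (abs_nonneg d)
    rw [← hd] at hEa
    have t1 := Complex.norm_exp_sub_sum_le_norm_mul_exp (z * d) 3
    simp only [Finset.sum_range_succ, Finset.sum_range_zero, Nat.factorial] at t1
    norm_num at t1
    have hn : ‖z * (d:ℂ)‖ = ‖z‖ * |d| := by rw [norm_mul, Complex.norm_real, Real.norm_eq_abs]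
    have hexp : exp (‖z‖ * |d|) ≤ exp (|d|/4) := by
      apply Real.exp_le_exp.2
      have := abs_nonneg d
      nlinarith
    have t1' : ‖Complex.exp (z * d) - (1 + z * d + (z * d)^2/2)‖ ≤ ‖z‖^3 * (384 * exp (|d|/2)) := by
      refine t1.trans ?_
      calc _ ≤ (‖z‖ * |d|)^3 * exp (|d|/4) := by gcongr
        _ = ‖z‖^3 * (|d|^3 * exp (|d|/4)) := by ring
        _ ≤ _ := mul_le_mul_of_nonneg_left hp.2.2.1 (by positivity)
    have e : R a = (Complex.exp (z * d) - (1 + z * d + (z * d)^2/2)) * (1 + z^2 * v (br a x)) +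
        z^3 * v (br a x) * d + z^4 * v (br a x) * d^2/2 := by
      rw [hR]; simp only [← hd]; ring
    have f1 : ‖(1 + z^2 * v (br a x) : ℂ)‖ ≤ 1 + B := by
      refine (norm_add_le _ _).trans ?_
      rw [norm_mul, norm_pow, Complex.norm_real, norm_one, Real.norm_eq_abs]
      have : ‖z‖^2 ≤ 1 := pow_le_one₀ hz0 hz1
      have := mul_le_mul this hv (abs_nonneg _) zero_le_one
      linarith
    have f2 : ‖(z^3 * v (br a x) * d : ℂ)‖ ≤ ‖z‖^3 * (B * (384 * exp (|d|/2))) := by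
      rw [norm_mul, norm_mul, norm_pow, Complex.norm_real, Complex.norm_real, Real.norm_eq_abs, Real.norm_eq_abs, mul_assoc]
      have := hp.1
      have := Real.exp_pos (|d|/2)
      gcongr
      linarith
    have f3 : ‖(z^4 * v (br a x) * d^2/2 : ℂ)‖ ≤ ‖z‖^3 * (B * (384 * exp (|d|/2))) := by
      rw [norm_div, norm_mul, norm_mul, norm_pow, norm_pow, Complex.norm_real, Complex.norm_real, Real.norm_eq_abs, Real.norm_eq_abs, RCLike.norm_ofNat, mul_assoc, mul_div_assoc]
      have := hp.2.1
      have := Real.exp_pos (|d|/2)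
      have h43 : ‖z‖^4 ≤ ‖z‖^3 := pow_le_pow_of_le_one hz0 hz1 (by norm_num)
      have : |v (br a x)| * |d|^2 ≤ B * (384 * exp (|d|/2)) := by gcongr; linarith
      have h0 : 0 ≤ |v (br a x)| * |d|^2 := by positivity
      gcongr
      linarith
    have f0 : ‖(Complex.exp (z * d) - (1 + z * d + (z * d)^2/2)) * (1 + z^2 * v (br a x))‖ ≤
        ‖z‖^3 * (384 * exp (|d|/2)) * (1 + B) := by
      rw [norm_mul]; gcongr
    rw [e]
    calc _ ≤ _ + _ + _ := norm_add₃_le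
      _ ≤ ‖z‖^3 * (384 * exp (|d|/2)) * (1 + B) + ‖z‖^3 * (B * (384 * exp (|d|/2))) + ‖z‖^3 * (B * (384 * exp (|d|/2))) := by
          gcongr
      _ = 384 * (1 + 3 * B) * ‖z‖^3 * exp (|d|/2) := by ring
      _ ≤ 384 * (1 + 3 * B) * ‖z‖^3 * (M * sqrt (a+1)) := by gcongr
      _ = _ := by rw [hA]; ring
  obtain ⟨s1, s2⟩ := sum_bd hx hRb
  have g0 := wt_hasSum hx
  have g1 := h1 x hx
  have g2 : Summable (fun a => wt a x * DD u a x ^ 2) := by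
    refine (sum_bd (h := fun a => DD u a x ^2) (A := 8 * M) hx (fun a => ?_)).1
    have t1 := (pow_le_exp _ (abs_nonneg (DD u a x))).2.1
    have t2 := hE a x hx
    rw [Real.norm_eq_abs, abs_pow]; linarith
  have g3 : Summable (fun a => wt a x * v (br a x)) :=
    smul_summable hx (fun a => hBv _ (br_mem hx))
  have c0 := Complex.hasSum_ofReal.2 g0
  have c1 := (Complex.hasSum_ofReal.2 g1).mul_left z
  have c2 := (Complex.hasSum_ofReal.2 g2.hasSum).mul_left (z^2/2)
  have c3 := (Complex.hasSum_ofReal.2 g3.hasSum).mul_left (z^2)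
  have call := (((c0.add c1).add c2).add c3).add s1.hasSum
  have efun : (fun a => wt a x • (Complex.exp (z * DD u a x) * (1 + z^2 * v (br a x)))) =
    fun a => (((wt a x : ℝ) : ℂ) + z * ((wt a x * DD u a x : ℝ) : ℂ) + z^2/2 * ((wt a x * DD u a x ^ 2 : ℝ) : ℂ)
      + z^2 * ((wt a x * v (br a x) : ℝ) : ℂ)) + wt a x • R a := by
    ext a
    rw [hR]
    simp only [Complex.real_smul]
    push_cast
    ring
  rw [efun]
  refine ⟨call.summable, ?_⟩
  rw [call.tsum_eq]
  have h2x := h2 x hx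
  unfold LL at h2x
  obtain ⟨V, hV⟩ : ∃ V, V = ∑' a, wt a x * DD u a x ^ 2 := ⟨_, rfl⟩
  obtain ⟨W, hW⟩ : ∃ W, W = ∑' a, wt a x * v (br a x) := ⟨_, rfl⟩
  rw [← hV, ← hW] at h2x ⊢
  have hW2 : W = v x - (V - σ2)/2 := by linarith
  obtain ⟨w, hw⟩ : ∃ w : ℂ, w = z^2 * σ2/2 := ⟨_, rfl⟩
  have hwn : ‖w‖ = ‖z‖^2 * σ2/2 := by
    rw [hw, norm_div, norm_mul, norm_pow, Complex.norm_real, Real.norm_of_nonneg hσ.le, RCLike.norm_ofNat]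
  have e : (((1:ℝ):ℂ) + z * ((0:ℝ):ℂ) + z^2/2 * (V:ℂ) + z^2 * (W:ℂ) + ∑' a, wt a x • R a) -
      (1 + z^2 * v x) * Complex.exp (z^2 * σ2 / 2) = (∑' a, wt a x • R a) +
      (- (z^2 * v x * w) - (1 + z^2 * v x) * (Complex.exp w - (1 + w))) := by
    rw [hW2, ← hw]
    push_cast
    rw [hw]
    ring
  rw [e]
  have t2 := Complex.norm_exp_sub_sum_le_norm_mul_exp w 2
  simp only [Finset.sum_range_succ, Finset.sum_range_zero, Nat.factorial] at t2
  norm_num at t2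
  have hz2 : ‖z‖^2 ≤ 1 := pow_le_one₀ hz0 hz1
  have h43 : ‖z‖^4 ≤ ‖z‖^3 := pow_le_pow_of_le_one hz0 hz1 (by norm_num)
  have t2' : ‖Complex.exp w - (1 + w)‖ ≤ ‖z‖^3 * (σ2^2 * exp σ2) := by
    refine t2.trans ?_
    have : exp ‖w‖ ≤ exp σ2 := by
      apply Real.exp_le_exp.2; rw [hwn]; nlinarith
    calc _ ≤ ‖w‖^2 * exp σ2 := by gcongr
      _ = ‖z‖^4 * (σ2^2/4 * exp σ2) := by rw [hwn]; ring
      _ ≤ ‖z‖^3 * (σ2^2 * exp σ2) := by gcongr; nlinarith [sq_nonneg σ2]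
  have f1 : ‖(1 + z^2 * v x : ℂ)‖ ≤ 1 + B := by
    refine (norm_add_le _ _).trans ?_
    rw [norm_mul, norm_pow, Complex.norm_real, norm_one, Real.norm_eq_abs]
    have := mul_le_mul hz2 hvx (abs_nonneg _) zero_le_one
    linarith
  have f2 : ‖(z^2 * v x * w : ℂ)‖ ≤ ‖z‖^3 * (B * σ2) := by
    rw [norm_mul, norm_mul, norm_pow, Complex.norm_real, Real.norm_eq_abs, hwn]
    calc _ = ‖z‖^4 * (|v x| * (σ2/2)) := by ring
      _ ≤ ‖z‖^3 * (B * σ2) := by gcongr; linarith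
  calc _ ≤ ‖∑' a, wt a x • R a‖ + (‖z^2 * v x * w‖ + ‖(1 + z^2 * v x)‖ * ‖(Complex.exp w - (1 + w))‖) := by
        refine (norm_add_le _ _).trans ?_
        gcongr
        refine (norm_sub_le _ _).trans ?_
        rw [norm_neg, norm_mul (1 + z^2 * (v x : ℂ))]
    _ ≤ A * ‖z‖^3 * (∑' a, ww a) + (‖z‖^3 * (B * σ2) + (1+B) * (‖z‖^3 * (σ2^2 * exp σ2))) := by gcongr
    _ = _ := by rw [hC2]; ring
end
end KN
namespace KN
open MeasureTheory Filter Set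
open scoped Topology ENNReal
open Real (log exp sqrt)
noncomputable section
def gg (u : ℝ → ℝ) (x : ℝ) : ℝ := -log x - lam + u x - u (gaussMap x)
lemma gg_br {u : ℝ → ℝ} {a : ℕ} {x : ℝ} (hx : x ∈ Ioo (0:ℝ) 1) : gg u (br a x) = DD u a x := by
  unfold gg DD
  rw [gauss_br hx]; unfold br; rw [one_div, Real.log_inv, neg_neg]
lemma gg_meas {u : ℝ → ℝ} (hu : Continuous u) : Measurable (gg u) := by
  have := hu.measurable
  have := this.comp gaussMap_meas
  exact ((Real.measurable_log.neg.sub_const lam).add hu.measurable).sub this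
lemma bs_meas {g : ℝ → ℝ} (hg : Measurable g) (n : ℕ) : Measurable (birkhoffSum gaussMap g n) := by
  unfold birkhoffSum
  exact Finset.measurable_sum _ fun i _ => hg.comp (gaussMap_meas.iterate i)
lemma pert_real {u v : ℝ → ℝ} {B σ2 : ℝ} (hB0 : 0 ≤ B) (hσ : 0 < σ2) (hB : ∀ x ∈ Ioo (0:ℝ) 1, |u x| ≤ B)
    (hBv : ∀ x ∈ Ioo (0:ℝ) 1, |v x| ≤ B)
    (h1 : ∀ x ∈ Ioo (0:ℝ) 1, HasSum (fun a => wt a x * DD u a x) 0)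
    (h2 : ∀ x ∈ Ioo (0:ℝ) 1, v x - LL v x = ((∑' a, wt a x * DD u a x ^ 2) - σ2)/2) :
    ∃ C s0 : ℝ, 0 ≤ C ∧ 0 < s0 ∧ ∀ s : ℝ, |s| ≤ s0 →
      (∀ x ∈ Ioo (0:ℝ) 1, 1/2 ≤ 1 + s^2 * v x ∧ 1 + s^2 * v x ≤ 2) ∧
      (∀ x ∈ Ioo (0:ℝ) 1, Summable (fun a => wt a x * (exp (s * DD u a x) * (1 + s^2 * v (br a x)))) ∧
        exp (s^2*σ2/2 - C*|s|^3) * (1 + s^2 * v x) ≤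
          (∑' a, wt a x * (exp (s * DD u a x) * (1 + s^2 * v (br a x)))) ∧
        (∑' a, wt a x * (exp (s * DD u a x) * (1 + s^2 * v (br a x)))) ≤
          exp (s^2*σ2/2 + C*|s|^3) * (1 + s^2 * v x)) := by
  obtain ⟨C, hC, hp⟩ := pert hB0 hσ hB hBv h1 h2
  refine ⟨4*C, min (1/4) (min (1/(4*C+1)) (1/(B+1))), by positivity, by positivity, fun s hs => ?_⟩
  have hs1 : |s| ≤ 1/4 := hs.trans (min_le_left _ _)
  have hs2 : |s| ≤ 1/(4*C+1) := hs.trans ((min_le_right _ _).trans (min_le_left _ _))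
  have hs3 : |s| ≤ 1/(B+1) := hs.trans ((min_le_right _ _).trans (min_le_right _ _))
  rw [le_div_iff₀ (by positivity)] at hs2 hs3
  have hs0 := abs_nonneg s
  have hh : ∀ x ∈ Ioo (0:ℝ) 1, 1/2 ≤ 1 + s^2 * v x ∧ 1 + s^2 * v x ≤ 2 := by
    intro x hx
    have h3 := hBv x hx
    have : |s^2 * v x| ≤ 1/4 := by
      rw [abs_mul, abs_pow]
      calc |s|^2 * |v x| ≤ |s|^2 * B := by gcongr
        _ = |s| * (|s| * B) := by ring
        _ ≤ 1/4 * 1 := by gcongr; linarith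
        _ = _ := by norm_num
    rw [abs_le] at this
    constructor <;> linarith
  refine ⟨hh, fun x hx => ?_⟩
  obtain ⟨p1, p2⟩ := hp x hx s (by rw [Complex.norm_real]; exact hs1)
  have e : (fun a => wt a x • (Complex.exp ((s:ℂ) * DD u a x) * (1 + (s:ℂ)^2 * v (br a x)))) =
    fun a => ((wt a x * (exp (s * DD u a x) * (1 + s^2 * v (br a x))) : ℝ) : ℂ) := by
    ext a; rw [Complex.real_smul]; push_cast; rfl
  rw [e] at p1 p2
  have e2 : (1 + (s:ℂ)^2 * v x) * Complex.exp ((s:ℂ)^2 * σ2/2) = (((1 + s^2 * v x) * exp (s^2*σ2/2) : ℝ) : ℂ) := by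
    push_cast; rfl
  rw [e2, ← Complex.ofReal_tsum, ← Complex.ofReal_sub, Complex.norm_real, Complex.norm_real, Real.norm_eq_abs, Real.norm_eq_abs] at p2
  refine ⟨Complex.summable_ofReal.1 p1, ?_⟩
  obtain ⟨X, hX⟩ : ∃ X, X = ∑' a, wt a x * (exp (s * DD u a x) * (1 + s^2 * v (br a x))) := ⟨_, rfl⟩
  obtain ⟨H, hH⟩ : ∃ H, H = 1 + s^2 * v x := ⟨_, rfl⟩
  obtain ⟨y, hy⟩ : ∃ y, y = 2 * (C * |s|^3) := ⟨_, rfl⟩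
  obtain ⟨κ, hκ⟩ : ∃ κ, κ = exp (s^2*σ2/2) := ⟨_, rfl⟩
  have hy0 : 0 ≤ y := by rw [hy]; positivity
  have hy1 : y ≤ 1/2 := by
    have h3 : |s|^2 ≤ 1 := pow_le_one₀ hs0 (by linarith)
    have h4 : C * |s| ≤ 1/4 := by nlinarith
    have : y = 2 * ((C*|s|) * |s|^2) := by rw [hy]; ring
    rw [this]
    have := mul_le_mul h4 h3 (by positivity) (by norm_num)
    linarith
  have hκ1 : 1 ≤ κ := by rw [hκ]; apply Real.one_le_exp; positivity
  have hx2 := (hh x hx).1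
  rw [← hX, ← hH, ← hκ] at p2
  rw [← hX, ← hH]
  rw [← hH] at hx2
  have hle : C*|s|^3 ≤ H * κ * y := by
    have : 1/2 ≤ H * κ := by nlinarith
    have h5 : y = 2 * (C * |s|^3) := hy
    nlinarith
  have e3 : 4 * C * |s|^3 = 2*y := by rw [hy]; ring
  have hHκ : 0 ≤ H * κ := by positivity
  rw [abs_le] at p2
  rw [e3, Real.exp_sub, Real.exp_add, ← hκ]
  have l1 := Real.add_one_le_exp (2*y)
  constructor
  · rw [div_mul_eq_mul_div, div_le_iff₀ (Real.exp_pos _)]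
    have l2 : H*κ*(1-y) ≤ X := by linarith
    have l3 : 1 ≤ (1-y) * exp (2*y) := by nlinarith
    calc κ * H = H*κ*1 := by ring
      _ ≤ H*κ*((1-y) * exp (2*y)) := by gcongr
      _ = (H*κ*(1-y)) * exp (2*y) := by ring
      _ ≤ _ := by gcongr
  · calc X ≤ H*κ*(1+y) := by linarith
      _ ≤ H*κ*exp (2*y) := by gcongr; linarith
      _ = _ := by ring
/-- transfer step for exponentials -/
lemma mgf_step {u v : ℝ → ℝ} (hu : Continuous u) (hv : Continuous v) {s : ℝ}
    (hh : ∀ x ∈ Ioo (0:ℝ) 1, 0 ≤ 1 + s^2 * v x)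
    (hsum : ∀ x ∈ Ioo (0:ℝ) 1, Summable (fun a => wt a x * (exp (s * DD u a x) * (1 + s^2 * v (br a x)))))
    {Q : Set ℝ} (hQ : MeasurableSet Q) (n : ℕ) :
    ∫⁻ x, (gaussMap^[n+1] ⁻¹' Q).indicator
      (fun x => ENNReal.ofReal (exp (s * birkhoffSum gaussMap (gg u) (n+1) x) * (1 + s^2 * v x))) x ∂gm =
    ∫⁻ x, (gaussMap^[n] ⁻¹' Q).indicator
      (fun x => ENNReal.ofReal (exp (s * birkhoffSum gaussMap (gg u) n x) *
        ∑' a, wt a x * (exp (s * DD u a x) * (1 + s^2 * v (br a x))))) x ∂gm := by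
  have hm1 := bs_meas (gg_meas hu) (n+1)
  have hvm := hv.measurable
  rw [dual_lintegral' (Measurable.indicator (by fun_prop) ((gaussMap_meas.iterate (n+1)) hQ))]
  refine lintegral_congr_ae ?_
  filter_upwards [gm_ae] with x hx
  have hb : ∀ a, (br a x ∈ gaussMap^[n+1] ⁻¹' Q) ↔ (x ∈ gaussMap^[n] ⁻¹' Q) := by
    intro a
    rw [mem_preimage, mem_preimage, Function.iterate_succ_apply, gauss_br hx]
  by_cases hq : x ∈ gaussMap^[n] ⁻¹' Q
  · rw [indicator_of_mem hq]
    have e : ∀ a, ENNReal.ofReal (wt a x) * (gaussMap^[n+1] ⁻¹' Q).indicator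
      (fun x => ENNReal.ofReal (exp (s * birkhoffSum gaussMap (gg u) (n+1) x) * (1 + s^2 * v x))) (br a x)
      = ENNReal.ofReal (exp (s * birkhoffSum gaussMap (gg u) n x)) * ENNReal.ofReal (wt a x * (exp (s * DD u a x) * (1 + s^2 * v (br a x)))) := by
      intro a
      rw [indicator_of_mem ((hb a).2 hq), ← ENNReal.ofReal_mul (wt_pos hx).le, ← ENNReal.ofReal_mul (Real.exp_pos _).le,
        birkhoffSum_succ', gauss_br hx, gg_br hx, mul_add s, Real.exp_add]
      congr 1; ring
    simp_rw [e]
    rw [ENNReal.tsum_mul_left, ← ENNReal.ofReal_tsum_of_nonneg _ (hsum x hx), ← ENNReal.ofReal_mul (Real.exp_pos _).le]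
    intro a
    exact mul_nonneg (wt_pos hx).le (mul_nonneg (Real.exp_pos _).le (hh _ (br_mem hx)))
  · rw [indicator_of_notMem hq]
    have e : ∀ a, ENNReal.ofReal (wt a x) * (gaussMap^[n+1] ⁻¹' Q).indicator
      (fun x => ENNReal.ofReal (exp (s * birkhoffSum gaussMap (gg u) (n+1) x) * (1 + s^2 * v x))) (br a x) = 0 := by
      intro a
      rw [indicator_of_notMem (fun h => hq ((hb a).1 h)), mul_zero]
    simp_rw [e]; simp
/-- two-sided mgf bounds -/
def MgfBd (g : ℝ → ℝ) (σ2 C s0 : ℝ) : Prop := ∀ s : ℝ, |s| ≤ s0 → ∀ n : ℕ, ∀ Q : Set ℝ, MeasurableSet Q →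
  (∫⁻ x in (gaussMap^[n] ⁻¹' Q), ENNReal.ofReal (exp (s * birkhoffSum gaussMap g n x)) ∂gm ≤
    4 * ENNReal.ofReal (exp (n * (s^2*σ2/2 + C*|s|^3))) * gm Q) ∧
  (ENNReal.ofReal (exp (n * (s^2*σ2/2 - C*|s|^3))) * gm Q ≤
    4 * ∫⁻ x in (gaussMap^[n] ⁻¹' Q), ENNReal.ofReal (exp (s * birkhoffSum gaussMap g n x)) ∂gm)
lemma mgf {u v : ℝ → ℝ} (hu : Continuous u) (hv : Continuous v) {B σ2 : ℝ} (hB0 : 0 ≤ B) (hσ : 0 < σ2) (hB : ∀ x ∈ Ioo (0:ℝ) 1, |u x| ≤ B)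
    (hBv : ∀ x ∈ Ioo (0:ℝ) 1, |v x| ≤ B)
    (h1 : ∀ x ∈ Ioo (0:ℝ) 1, HasSum (fun a => wt a x * DD u a x) 0)
    (h2 : ∀ x ∈ Ioo (0:ℝ) 1, v x - LL v x = ((∑' a, wt a x * DD u a x ^ 2) - σ2)/2) :
    ∃ C s0 : ℝ, 0 ≤ C ∧ 0 < s0 ∧ MgfBd (gg u) σ2 C s0 := by
  obtain ⟨C, s0, hC, hs0, hp⟩ := pert_real hB0 hσ hB hBv h1 h2
  refine ⟨C, s0, hC, hs0, fun s hs n Q hQ => ?_⟩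
  obtain ⟨hh, hp⟩ := hp s hs
  have hh0 : ∀ x ∈ Ioo (0:ℝ) 1, 0 ≤ 1 + s^2 * v x := fun x hx => by have := (hh x hx).1; linarith
  have hvm := hv.measurable
  obtain ⟨M, hM⟩ : ∃ M : ℕ → ℝ≥0∞, M = fun n => ∫⁻ x, (gaussMap^[n] ⁻¹' Q).indicator
      (fun x => ENNReal.ofReal (exp (s * birkhoffSum gaussMap (gg u) n x) * (1 + s^2 * v x))) x ∂gm := ⟨_, rfl⟩
  have hMe : ∀ n, M n = ∫⁻ x in gaussMap^[n] ⁻¹' Q,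
      ENNReal.ofReal (exp (s * birkhoffSum gaussMap (gg u) n x) * (1 + s^2 * v x)) ∂gm := by
    intro n; rw [hM]; simp only; rw [lintegral_indicator (gaussMap_meas.iterate n hQ)]
  have up : ∀ n : ℕ, M n ≤ ENNReal.ofReal (exp (n * (s^2*σ2/2 + C*|s|^3))) * (2 * gm Q) := by
    intro n
    induction n with
    | zero =>
      rw [hMe]
      simp only [Function.iterate_zero, preimage_id, birkhoffSum_zero', Nat.cast_zero, zero_mul, Real.exp_zero, ENNReal.ofReal_one, one_mul]
      calc _ ≤ ∫⁻ x in Q, 2 ∂gm := by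
            refine lintegral_mono_ae ?_
            filter_upwards [ae_restrict_of_ae gm_ae] with x hx
            rw [show (2:ℝ≥0∞) = ENNReal.ofReal 2 by simp]
            apply ENNReal.ofReal_le_ofReal
            have := (hh x hx).2
            simpa using this
        _ = _ := by simp
    | succ n ih =>
      have e : M (n+1) ≤ ENNReal.ofReal (exp (s^2*σ2/2 + C*|s|^3)) * M n := by
        rw [hM]; simp only
        rw [mgf_step hu hv hh0 (fun x hx => (hp x hx).1) hQ n, ← lintegral_const_mul' _ _ (by simp)]
        refine lintegral_mono_ae ?_
        filter_upwards [gm_ae] with x hx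
        by_cases hq : x ∈ gaussMap^[n] ⁻¹' Q
        · rw [indicator_of_mem hq, indicator_of_mem hq, ← ENNReal.ofReal_mul (Real.exp_pos _).le]
          apply ENNReal.ofReal_le_ofReal
          calc _ ≤ _ * _ := mul_le_mul_of_nonneg_left (hp x hx).2.2 (Real.exp_pos _).le
            _ = _ := by ring
        · rw [indicator_of_notMem hq, indicator_of_notMem hq, mul_zero]
      refine e.trans ?_
      calc _ ≤ ENNReal.ofReal (exp (s^2*σ2/2 + C*|s|^3)) * _ := mul_le_mul_right ih _
        _ = _ := by
          rw [← mul_assoc, ← ENNReal.ofReal_mul (Real.exp_pos _).le, ← Real.exp_add]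
          push_cast; ring_nf
  have lo : ∀ n : ℕ, ENNReal.ofReal (exp (n * (s^2*σ2/2 - C*|s|^3))) * gm Q ≤ 2 * M n := by
    intro n
    induction n with
    | zero =>
      rw [hMe]
      simp only [Function.iterate_zero, preimage_id, birkhoffSum_zero', Nat.cast_zero, zero_mul, Real.exp_zero, ENNReal.ofReal_one, one_mul]
      rw [← lintegral_const_mul' _ _ (by simp)]
      calc _ = ∫⁻ x in Q, 1 ∂gm := by simp
        _ ≤ _ := by
            refine lintegral_mono_ae ?_
            filter_upwards [ae_restrict_of_ae gm_ae] with x hx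
            rw [show (2:ℝ≥0∞) = ENNReal.ofReal 2 by simp, ← ENNReal.ofReal_mul (by norm_num), ← ENNReal.ofReal_one]
            apply ENNReal.ofReal_le_ofReal
            have := (hh x hx).1
            simp
            linarith
    | succ n ih =>
      have e : ENNReal.ofReal (exp (s^2*σ2/2 - C*|s|^3)) * M n ≤ M (n+1) := by
        rw [hM]; simp only
        rw [mgf_step hu hv hh0 (fun x hx => (hp x hx).1) hQ n, ← lintegral_const_mul' _ _ (by simp)]
        refine lintegral_mono_ae ?_
        filter_upwards [gm_ae] with x hx
        by_cases hq : x ∈ gaussMap^[n] ⁻¹' Q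
        · rw [indicator_of_mem hq, indicator_of_mem hq, ← ENNReal.ofReal_mul (Real.exp_pos _).le]
          apply ENNReal.ofReal_le_ofReal
          calc _ = exp (s * birkhoffSum gaussMap (gg u) n x) * (exp (s^2*σ2/2 - C*|s|^3) * (1 + s^2 * v x)) := by ring
            _ ≤ _ := mul_le_mul_of_nonneg_left (hp x hx).2.1 (Real.exp_pos _).le
        · rw [indicator_of_notMem hq, indicator_of_notMem hq, mul_zero]
      calc _ = ENNReal.ofReal (exp (s^2*σ2/2 - C*|s|^3)) * (ENNReal.ofReal (exp (n * (s^2*σ2/2 - C*|s|^3))) * gm Q) := by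
            rw [← mul_assoc, ← ENNReal.ofReal_mul (Real.exp_pos _).le, ← Real.exp_add]
            push_cast; ring_nf
        _ ≤ ENNReal.ofReal (exp (s^2*σ2/2 - C*|s|^3)) * (2 * M n) := mul_le_mul_right ih _
        _ = 2 * (ENNReal.ofReal (exp (s^2*σ2/2 - C*|s|^3)) * M n) := by ring
        _ ≤ _ := mul_le_mul_right e _
  have cmp1 : ∫⁻ x in (gaussMap^[n] ⁻¹' Q), ENNReal.ofReal (exp (s * birkhoffSum gaussMap (gg u) n x)) ∂gm ≤ 2 * M n := by
    rw [hMe, ← lintegral_const_mul' _ _ (by simp)]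
    refine lintegral_mono_ae ?_
    filter_upwards [ae_restrict_of_ae gm_ae] with x hx
    rw [show (2:ℝ≥0∞) = ENNReal.ofReal 2 by simp, ← ENNReal.ofReal_mul (by norm_num)]
    apply ENNReal.ofReal_le_ofReal
    have := (hh x hx).1
    have := Real.exp_pos (s * birkhoffSum gaussMap (gg u) n x)
    nlinarith
  have cmp2 : M n ≤ 2 * ∫⁻ x in (gaussMap^[n] ⁻¹' Q), ENNReal.ofReal (exp (s * birkhoffSum gaussMap (gg u) n x)) ∂gm := by
    rw [hMe, ← lintegral_const_mul' _ _ (by simp)]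
    refine lintegral_mono_ae ?_
    filter_upwards [ae_restrict_of_ae gm_ae] with x hx
    rw [show (2:ℝ≥0∞) = ENNReal.ofReal 2 by simp, ← ENNReal.ofReal_mul (by norm_num)]
    apply ENNReal.ofReal_le_ofReal
    have := (hh x hx).2
    have := Real.exp_pos (s * birkhoffSum gaussMap (gg u) n x)
    nlinarith
  constructor
  · refine cmp1.trans ?_
    calc _ ≤ 2 * (ENNReal.ofReal (exp (n * (s^2*σ2/2 + C*|s|^3))) * (2 * gm Q)) := mul_le_mul_right (up n) _
      _ = _ := by rw [show (4:ℝ≥0∞) = 2 * 2 by norm_num]; ring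
  · refine (lo n).trans ?_
    calc _ ≤ 2 * (2 * _) := mul_le_mul_right cmp2 _
      _ = _ := by rw [← mul_assoc, show (2:ℝ≥0∞) * 2 = 4 by norm_num]
end
end KN
namespace KN
open MeasureTheory Filter Set
open scoped Topology ENNReal
open Real (log exp sqrt)
noncomputable section
lemma dual_bound {F : ℝ → ℂ} (hm : Measurable F) (hF : Integrable F gm) {c : ℝ}
    (h : ∀ x ∈ Ioo (0:ℝ) 1, ‖∑' a, wt a x • F (br a x)‖ ≤ c) : ‖∫ x, F x ∂gm‖ ≤ c := by
  rw [dual_integral hm hF]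
  have := norm_integral_le_of_norm_le_const (μ := gm) (C := c)
    (f := fun x => ∑' a, wt a x • F (br a x)) (by filter_upwards [gm_ae] with x hx using h x hx)
  simpa using this
lemma int_comp {F : ℝ → ℂ} (hm : Measurable F) : ∫ x, F (gaussMap x) ∂gm = ∫ x, F x ∂gm := by
  have := integral_map (μ := gm) gaussMap_meas.aemeasurable (f := F) hm.aestronglyMeasurable
  rw [gauss_mp.map_eq] at this
  exact this.symm
def ee (g : ℝ → ℝ) (t : ℝ) (n : ℕ) (x : ℝ) : ℂ := Complex.exp (Complex.I * t * (birkhoffSum gaussMap g n x : ℝ))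
lemma ee_meas {g : ℝ → ℝ} (hg : Measurable g) (t : ℝ) (n : ℕ) : Measurable (ee g t n) := by
  have := bs_meas hg n
  unfold ee; fun_prop
lemma norm_exp_I (w : ℝ) : ‖Complex.exp (Complex.I * w)‖ = 1 := by
  rw [mul_comm]; exact Complex.norm_exp_ofReal_mul_I w
lemma ee_norm (g : ℝ → ℝ) (t : ℝ) (n : ℕ) (x : ℝ) : ‖ee g t n x‖ = 1 := by
  unfold ee
  rw [mul_assoc, ← Complex.ofReal_mul]; exact norm_exp_I _
lemma exp_sub_le (a b : ℝ) : ‖Complex.exp (Complex.I * a) - Complex.exp (Complex.I * b)‖ ≤ |a - b| := by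
  have e : Complex.exp (Complex.I * a) - Complex.exp (Complex.I * b) =
      Complex.exp (Complex.I * b) * (Complex.exp (Complex.I * ((a - b : ℝ) : ℂ)) - 1) := by
    rw [mul_sub, ← Complex.exp_add]; push_cast; ring_nf
  rw [e, norm_mul, norm_exp_I, one_mul]
  exact Real.norm_exp_I_mul_ofReal_sub_one_le
lemma gg_int {u : ℝ → ℝ} {B : ℝ} (hu : Continuous u) (hB : ∀ x ∈ Ioo (0:ℝ) 1, |u x| ≤ B) :
    Integrable (gg u) gm := by
  have hui : Integrable u gm := by
    refine Integrable.of_bound hu.aestronglyMeasurable B ?_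
    filter_upwards [gm_ae] with x hx using hB x hx
  have huT : Integrable (fun x => u (gaussMap x)) gm := gauss_mp.integrable_comp_of_integrable hui
  exact ((log_int_gm.sub (integrable_const lam)).add hui).sub huT
section
variable {u v : ℝ → ℝ} {B σ2 : ℝ}
lemma char_gm (hu : Continuous u) (hv : Continuous v) (hB0 : 0 ≤ B) (hσ : 0 < σ2) (hB : ∀ x ∈ Ioo (0:ℝ) 1, |u x| ≤ B)
    (hBv : ∀ x ∈ Ioo (0:ℝ) 1, |v x| ≤ B)
    (h1 : ∀ x ∈ Ioo (0:ℝ) 1, HasSum (fun a => wt a x * DD u a x) 0)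
    (h2 : ∀ x ∈ Ioo (0:ℝ) 1, v x - LL v x = ((∑' a, wt a x * DD u a x ^ 2) - σ2)/2) :
    ∃ C : ℝ, 0 ≤ C ∧ ∀ t : ℝ, |t| ≤ 1/4 → ∀ n : ℕ,
      ‖(∫ x, ee (gg u) t n x ∂gm) - Complex.exp (((-(t^2*σ2/2) * n : ℝ)) : ℂ)‖ ≤ n * (C * |t|^3) + 2 * B * t^2 := by
  obtain ⟨C, hC, hp⟩ := pert hB0 hσ hB hBv h1 h2
  refine ⟨C, hC, fun t ht n => ?_⟩
  obtain ⟨z, hz⟩ : ∃ z : ℂ, z = Complex.I * t := ⟨_, rfl⟩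
  have hzn : ‖z‖ = |t| := by rw [hz, norm_mul, Complex.norm_I, one_mul, Complex.norm_real, Real.norm_eq_abs]
  have hz2 : z^2 = ((-t^2 : ℝ) : ℂ) := by rw [hz, mul_pow, Complex.I_sq]; push_cast; ring
  have hgm := gg_meas hu
  have hvm := hv.measurable
  have hee := fun n => ee_meas hgm t n
  obtain ⟨h, hh⟩ : ∃ h : ℝ → ℂ, h = fun x => 1 + z^2 * v x := ⟨_, rfl⟩
  obtain ⟨κ, hκ⟩ : ∃ κ : ℂ, κ = Complex.exp (z^2 * σ2 / 2) := ⟨_, rfl⟩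
  have hκe : κ = Complex.exp ((-(t^2*σ2/2) : ℝ) : ℂ) := by rw [hκ, hz2]; push_cast; ring_nf
  have hκn : ‖κ‖ ≤ 1 := by
    rw [hκe, ← Complex.ofReal_exp, Complex.norm_real, Real.norm_of_nonneg (Real.exp_pos _).le, Real.exp_le_one_iff]
    have : 0 ≤ t^2*σ2/2 := by positivity
    linarith
  have hhm : Measurable h := by rw [hh]; fun_prop
  have hhb : ∀ x ∈ Ioo (0:ℝ) 1, ‖h x - 1‖ ≤ t^2 * B := by
    intro x hx
    rw [hh]
    simp only [add_sub_cancel_left]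
    rw [norm_mul, norm_pow, hzn, sq_abs, Complex.norm_real, Real.norm_eq_abs]
    have := hBv x hx
    gcongr
  have hhb2 : ∀ x ∈ Ioo (0:ℝ) 1, ‖h x‖ ≤ 1 + t^2 * B := by
    intro x hx
    have := norm_add_le (h x - 1) 1
    rw [sub_add_cancel, norm_one] at this
    have := hhb x hx
    linarith
  have hint : ∀ n, Integrable (fun x => ee (gg u) t n x * h x) gm := by
    intro n
    refine Integrable.of_bound ((hee n).mul hhm).aestronglyMeasurable (1 + t^2 * B) ?_
    filter_upwards [gm_ae] with x hx
    rw [norm_mul, ee_norm, one_mul]; exact hhb2 x hx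
  have eeint : ∀ n, Integrable (fun x => ee (gg u) t n x) gm := by
    intro n
    refine Integrable.of_bound (hee n).aestronglyMeasurable 1 ?_
    filter_upwards with x
    rw [ee_norm]
  obtain ⟨A, hA⟩ : ∃ A : ℕ → ℂ, A = fun n => ∫ x, ee (gg u) t n x * h x ∂gm := ⟨_, rfl⟩
  have step : ∀ n, ‖A (n+1) - κ * A n‖ ≤ C * |t|^3 := by
    intro n
    have hT : Integrable (fun x => κ * (ee (gg u) t n (gaussMap x) * h (gaussMap x))) gm :=
      (gauss_mp.integrable_comp_of_integrable (hint n)).const_mul κ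
    have hTm : Measurable (fun x => κ * (ee (gg u) t n (gaussMap x) * h (gaussMap x))) :=
      (((hee n).mul hhm).comp gaussMap_meas).const_mul κ
    have e : A (n+1) - κ * A n = ∫ x, (ee (gg u) t (n+1) x * h x - κ * (ee (gg u) t n (gaussMap x) * h (gaussMap x))) ∂gm := by
      rw [integral_sub (hint _) hT, integral_const_mul, int_comp (F := fun x => ee (gg u) t n x * h x) ((hee n).mul hhm), hA]
    rw [e]
    refine dual_bound (F := fun x => ee (gg u) t (n+1) x * h x - κ * (ee (gg u) t n (gaussMap x) * h (gaussMap x))) (((hee (n+1)).mul hhm).sub hTm) ((hint _).sub hT) fun x hx => ?_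
    obtain ⟨p1, p2⟩ := hp x hx z (by rw [hzn]; exact ht)
    have e2 : (fun a => wt a x • (ee (gg u) t (n+1) (br a x) * h (br a x) - κ * (ee (gg u) t n (gaussMap (br a x)) * h (gaussMap (br a x))))) =
      fun a => ee (gg u) t n x * (wt a x • (Complex.exp (z * DD u a x) * (1 + z^2 * v (br a x)))) - ee (gg u) t n x * (h x * κ) * (wt a x : ℝ) := by
      ext a
      have : ee (gg u) t (n+1) (br a x) = Complex.exp (z * DD u a x) * ee (gg u) t n x := by
        unfold ee
        rw [birkhoffSum_succ', gauss_br hx, gg_br hx, ← Complex.exp_add, hz]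
        push_cast; ring_nf
      rw [this, gauss_br hx, hh]
      simp only [Complex.real_smul]
      ring
    rw [e2]
    have g := (p1.hasSum.mul_left (ee (gg u) t n x)).sub ((Complex.hasSum_ofReal.2 (wt_hasSum hx)).mul_left (ee (gg u) t n x * (h x * κ)))
    rw [g.tsum_eq, Complex.ofReal_one, mul_one, ← mul_sub, norm_mul, ee_norm, one_mul, hκ, hh, ← hzn]
    exact p2
  have ind : ∀ n : ℕ, ‖A n - κ^n * A 0‖ ≤ n * (C * |t|^3) := by
    intro n
    induction n with
    | zero => simp
    | succ n ih =>
      have e : A (n+1) - κ^(n+1) * A 0 = (A (n+1) - κ * A n) + κ * (A n - κ^n * A 0) := by ring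
      rw [e]
      refine (norm_add_le _ _).trans ?_
      rw [norm_mul]
      have := step n
      have : ‖κ‖ * ‖A n - κ^n * A 0‖ ≤ 1 * (n * (C * |t|^3)) := by gcongr
      push_cast
      linarith
  have dif : ∀ n, ‖(∫ x, ee (gg u) t n x ∂gm) - A n‖ ≤ t^2 * B := by
    intro n
    rw [hA]; simp only
    rw [← integral_sub (eeint n) (hint n)]
    have := norm_integral_le_of_norm_le_const (μ := gm) (C := t^2 * B)
      (f := fun x => ee (gg u) t n x - ee (gg u) t n x * h x) (by
        filter_upwards [gm_ae] with x hx
        rw [← mul_one_sub, norm_mul, ee_norm, one_mul, norm_sub_rev]; exact hhb x hx)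
    simpa using this
  have e0 : (∫ x, ee (gg u) t 0 x ∂gm) = 1 := by
    have : ∀ x, ee (gg u) t 0 x = 1 := fun x => by unfold ee; simp
    simp_rw [this]; simp
  have d0 := dif 0
  rw [e0] at d0
  have hκn' : Complex.exp (((-(t^2*σ2/2) * n : ℝ)) : ℂ) = κ^n := by
    rw [hκe, ← Complex.exp_nat_mul]; push_cast; ring_nf
  rw [hκn']
  have e : (∫ x, ee (gg u) t n x ∂gm) - κ^n = ((∫ x, ee (gg u) t n x ∂gm) - A n) + (A n - κ^n * A 0) + - (κ^n * (1 - A 0)) := by ring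
  rw [e]
  have k1 : ‖κ^n * (1 - A 0)‖ ≤ t^2 * B := by
    rw [norm_mul, norm_pow]
    have : ‖κ‖^n ≤ 1 := pow_le_one₀ (norm_nonneg _) hκn
    have := norm_nonneg (1 - A 0)
    nlinarith
  calc _ ≤ _ + _ + _ := norm_add₃_le
    _ ≤ t^2 * B + n * (C * |t|^3) + t^2 * B := by rw [norm_neg]; exact add_le_add (add_le_add (dif n) (ind n)) k1
    _ = _ := by ring
lemma bd_int {F : ℝ → ℂ} {w : ℝ → ℝ} {W : ℝ} (hF : Measurable F) (hw : Measurable w) (hF1 : ∀ x, ‖F x‖ = 1)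
    (hW : ∀ x ∈ Ioo (0:ℝ) 1, |w x| ≤ W) : Integrable (fun x => F x * (w x : ℂ)) gm := by
  refine Integrable.of_bound (by fun_prop) W ?_
  filter_upwards [gm_ae] with x hx
  rw [norm_mul, hF1, one_mul, Complex.norm_real]; exact hW x hx
lemma key_id {E : ℝ → ℂ} {w r : ℝ → ℝ} {R W : ℝ} (hE : Measurable E) (hE1 : ∀ x, ‖E x‖ = 1) (hr : Measurable r) (hw : Measurable w)
    (hR : ∀ x ∈ Ioo (0:ℝ) 1, |r x| ≤ R) (hW : ∀ x ∈ Ioo (0:ℝ) 1, |w x| ≤ W)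
    (he : ∀ x ∈ Ioo (0:ℝ) 1, HasSum (fun a => wt a x * r (br a x)) (r x - w x)) :
    ∫ x, E x * (w x : ℂ) ∂gm = ∫ x, E x * (r x : ℂ) ∂gm - ∫ x, E (gaussMap x) * (r x : ℂ) ∂gm := by
  obtain ⟨G, hG⟩ : ∃ G : ℝ → ℂ, G = fun x => E x * ((r x - w x : ℝ) : ℂ) := ⟨_, rfl⟩
  obtain ⟨H, hH⟩ : ∃ H : ℝ → ℂ, H = fun x => E (gaussMap x) * (r x : ℂ) := ⟨_, rfl⟩
  have ir := bd_int hE hr hE1 hR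
  have iw := bd_int hE hw hE1 hW
  have hG' : G = fun x => E x * (r x : ℂ) - E x * (w x : ℂ) := by rw [hG]; ext x; push_cast; ring
  have mG : Measurable G := by rw [hG]; fun_prop
  have iG : Integrable G gm := by rw [hG']; exact ir.sub iw
  have mT : Measurable (fun x => E (gaussMap x)) := hE.comp gaussMap_meas
  have iH : Integrable H gm := by rw [hH]; exact bd_int mT hr (fun x => hE1 _) hR
  have mH : Measurable H := by rw [hH]; exact mT.mul (Complex.measurable_ofReal.comp hr)
  have iGT : Integrable (fun x => G (gaussMap x)) gm := gauss_mp.integrable_comp_of_integrable iG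
  have mGT : Measurable (fun x => G (gaussMap x)) := mG.comp gaussMap_meas
  have z0 : ‖∫ x, (H x - G (gaussMap x)) ∂gm‖ ≤ 0 := by
    refine dual_bound (F := fun x => H x - G (gaussMap x)) (mH.sub mGT) (iH.sub iGT) fun x hx => ?_
    have g := ((Complex.hasSum_ofReal.2 (he x hx)).sub (Complex.hasSum_ofReal.2 ((wt_hasSum hx).mul_right (r x - w x)))).mul_left (E x)
    have e2 : (fun a => wt a x • (H (br a x) - G (gaussMap (br a x)))) =
        fun a => E x * (((wt a x * r (br a x) : ℝ) : ℂ) - ((wt a x * (r x - w x) : ℝ) : ℂ)) := by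
      ext a
      rw [hH, hG]
      simp only [gauss_br hx, Complex.real_smul]
      push_cast; ring
    rw [e2, g.tsum_eq]
    simp
  rw [integral_sub iH iGT, int_comp mG, norm_le_zero_iff, hG', integral_sub ir iw, hH] at z0
  linear_combination z0
lemma char_vol (hu : Continuous u) (hB : ∀ x ∈ Ioo (0:ℝ) 1, |u x| ≤ B) :
    ∃ C : ℝ, ∀ t : ℝ, ∀ n : ℕ,
      ‖(∫ x in Ioo (0:ℝ) 1, ee (gg u) t n x) - (∫ x, ee (gg u) t n x ∂gm)‖ ≤ |t| * C := by
  have hgm := gg_meas hu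
  have hl2 := log2_pos
  obtain ⟨ρ, hρ⟩ : ∃ ρ : ℝ → ℝ, ρ = fun x => (1+x) * log 2 := ⟨_, rfl⟩
  have hLρ : Lp (log 2) ρ := by
    intro x hx y hy
    rw [hρ]; simp only
    rw [← sub_mul, abs_mul, abs_of_pos hl2, mul_comm, show 1 + x - (1+y) = x - y by ring]
  have hρm : Measurable ρ := by rw [hρ]; fun_prop
  obtain ⟨c, r, K, hK, hr, hKr, he, -⟩ := poisson hLρ hl2.le
  obtain ⟨R, hR⟩ : ∃ R, R = |r (1/2)| + K := ⟨_, rfl⟩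
  have hR0 : 0 ≤ R := by rw [hR]; positivity
  have hrb : ∀ x ∈ Ioo (0:ℝ) 1, |r x| ≤ R := fun x hx => by rw [hR]; exact hKr.bdd hK hx
  have hρb : ∀ x ∈ Ioo (0:ℝ) 1, |ρ x| ≤ |ρ (1/2)| + log 2 := fun x hx => hLρ.bdd hl2.le hx
  have hg1 := gg_int hu hB
  obtain ⟨G, hG⟩ : ∃ G, G = ∫ x, |gg u x| ∂gm := ⟨_, rfl⟩
  have hG0 : 0 ≤ G := by rw [hG]; exact integral_nonneg fun x => abs_nonneg _
  have hvol : ∀ F : ℝ → ℂ, ∫ x in Ioo (0:ℝ) 1, F x = ∫ x, (ρ x : ℂ) * F x ∂gm := by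
    intro F
    rw [vol_eq, show (fun x : ℝ => ENNReal.ofReal ((1 + x) * log 2)) = fun x => (((ρ x).toNNReal : NNReal) : ℝ≥0∞) by rw [hρ]; rfl,
      integral_withDensity_eq_integral_smul hρm.real_toNNReal]
    refine integral_congr_ae ?_
    filter_upwards [gm_ae] with x hx
    have : 0 ≤ ρ x := by rw [hρ]; have := hx.1; simp only; positivity
    rw [NNReal.smul_def, Real.coe_toNNReal _ this, Complex.real_smul]
  have key : ∀ t : ℝ, ∀ n : ℕ, ‖(∫ x in Ioo (0:ℝ) 1, ee (gg u) t n x) - c * (∫ x, ee (gg u) t n x ∂gm)‖ ≤ |t| * (2 * R * G) := by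
    intro t n
    have hem := ee_meas hgm t n
    have hemT := hem.comp gaussMap_meas
    have bd : ∀ (F : ℝ → ℂ) (w : ℝ → ℝ) (W : ℝ), Measurable F → Measurable w → (∀ x, ‖F x‖ = 1) → (∀ x ∈ Ioo (0:ℝ) 1, |w x| ≤ W) →
        Integrable (fun x => F x * (w x : ℂ)) gm := by
      intro F w W hF hw hF1 hW
      refine Integrable.of_bound (by fun_prop) W ?_
      filter_upwards [gm_ae] with x hx
      rw [norm_mul, hF1, one_mul, Complex.norm_real]; exact hW x hx
    have i1 := bd _ r R hem hr.measurable (ee_norm _ t n) hrb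
    have i2 : Integrable (fun x => ee (gg u) t n (gaussMap x) * (r x : ℂ)) gm :=
      bd (fun x => ee (gg u) t n (gaussMap x)) r R hemT hr.measurable (fun x => ee_norm _ t n _) hrb
    have i3 := bd _ (fun x => ρ x - c) (|ρ (1/2)| + log 2 + |c|) hem (hρm.sub_const c) (ee_norm _ t n)
      (fun x hx => (abs_sub _ _).trans (by have := hρb x hx; linarith))
    have i4 := bd _ ρ _ hem hρm (ee_norm _ t n) hρb
    have i5 := bd _ (fun _ => c) |c| hem measurable_const (ee_norm _ t n) (fun x hx => le_rfl)
    have z0 := key_id hem (ee_norm (gg u) t n) hr.measurable (hρm.sub_const c) hrb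
      (fun x hx => (abs_sub _ _).trans (by have := hρb x hx; linarith) : ∀ x ∈ Ioo (0:ℝ) 1, |ρ x - c| ≤ |ρ (1/2)| + log 2 + |c|)
      (fun x hx => by
        have h0 := he x hx
        unfold LL at h0
        exact hasSum_of_eq (hKr.summable hK hx).hasSum (by linarith))
    have e3 : (∫ x in Ioo (0:ℝ) 1, ee (gg u) t n x) - c * (∫ x, ee (gg u) t n x ∂gm) = ∫ x, ee (gg u) t n x * ((ρ x - c : ℝ) : ℂ) ∂gm := by
      rw [hvol, ← integral_const_mul, ← integral_sub]
      · congr 1; ext x; push_cast; ring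
      · simpa [mul_comm] using i4
      · simpa [mul_comm] using i5
    rw [e3]
    have e4 : ∫ x, ee (gg u) t n x * ((ρ x - c : ℝ) : ℂ) ∂gm = ∫ x, (ee (gg u) t n x * (r x : ℂ) - ee (gg u) t n (gaussMap x) * (r x : ℂ)) ∂gm := by
      rw [integral_sub i1 i2]
      exact z0
    rw [e4]
    have hgT : Integrable (fun x => |gg u (gaussMap^[n] x)|) gm :=
      ((gauss_mp.iterate n).integrable_comp_of_integrable hg1).abs
    have eT : ∫ x, |gg u (gaussMap^[n] x)| ∂gm = G := by
      have := integral_map (μ := gm) (gaussMap_meas.iterate n).aemeasurable (f := fun x => |gg u x|) (by fun_prop)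
      rw [(gauss_mp.iterate n).map_eq] at this
      rw [hG]; exact this.symm
    have hb := norm_integral_le_of_norm_le (μ := gm) (g := fun x => |t| * R * (|gg u x| + |gg u (gaussMap^[n] x)|))
      (f := fun x => (ee (gg u) t n x * (r x : ℂ) - ee (gg u) t n (gaussMap x) * (r x : ℂ)))
      ((hg1.abs.add hgT).const_mul _) (by
        filter_upwards [gm_ae] with x hx
        rw [← sub_mul, norm_mul, Complex.norm_real, Real.norm_eq_abs]
        have q1 : ‖ee (gg u) t n x - ee (gg u) t n (gaussMap x)‖ ≤ |t| * (|gg u x| + |gg u (gaussMap^[n] x)|) := by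
          unfold ee
          rw [mul_assoc, mul_assoc, ← Complex.ofReal_mul, ← Complex.ofReal_mul]
          refine (exp_sub_le _ _).trans ?_
          have e1 := birkhoffSum_succ gaussMap (gg u) n x
          have e2 := birkhoffSum_succ' gaussMap (gg u) n x
          rw [← mul_sub, abs_mul, show birkhoffSum gaussMap (gg u) n x - birkhoffSum gaussMap (gg u) n (gaussMap x) = gg u x - gg u (gaussMap^[n] x) by linarith]
          gcongr
          exact abs_sub _ _
        calc _ ≤ (|t| * (|gg u x| + |gg u (gaussMap^[n] x)|)) * R := mul_le_mul q1 (hrb x hx) (abs_nonneg _) (by positivity)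
          _ = _ := by ring)
    refine hb.trans (le_of_eq ?_)
    rw [integral_const_mul, integral_add hg1.abs hgT, eT, ← hG]; ring
  have hc : c = 1 := by
    have := key 0 0
    have h0 : ∀ x, ee (gg u) 0 0 x = 1 := fun x => by unfold ee; simp
    simp_rw [h0] at this
    simp at this
    have h3 : ((1:ℂ)) = c := sub_eq_zero.1 this
    exact_mod_cast h3.symm
  refine ⟨2 * R * G, fun t n => ?_⟩
  have := key t n
  rw [hc] at this
  simpa using this
lemma char_conv (hu : Continuous u) (hv : Continuous v) (hB0 : 0 ≤ B) (hσ : 0 < σ2) (hB : ∀ x ∈ Ioo (0:ℝ) 1, |u x| ≤ B)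
    (hBv : ∀ x ∈ Ioo (0:ℝ) 1, |v x| ≤ B)
    (h1 : ∀ x ∈ Ioo (0:ℝ) 1, HasSum (fun a => wt a x * DD u a x) 0)
    (h2 : ∀ x ∈ Ioo (0:ℝ) 1, v x - LL v x = ((∑' a, wt a x * DD u a x ^ 2) - σ2)/2) (t : ℝ) :
    Tendsto (fun n : ℕ => ∫ x in Ioo (0:ℝ) 1, ee (gg u) (t / √n) n x) atTop (𝓝 (Complex.exp ((-(t^2*σ2/2) : ℝ) : ℂ))) := by
  obtain ⟨C, hC, h3⟩ := char_gm hu hv hB0 hσ hB hBv h1 h2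
  obtain ⟨D, h4⟩ := char_vol hu hB
  have hs : Tendsto (fun n : ℕ => 1 / √(n:ℝ)) atTop (𝓝 0) := by
    have := (Real.tendsto_sqrt_atTop.comp tendsto_natCast_atTop_atTop).inv_tendsto_atTop (𝕜 := ℝ)
    refine this.congr fun n => ?_
    simp
  rw [tendsto_iff_norm_sub_tendsto_zero]
  have hb : Tendsto (fun n : ℕ => (C * |t|^3) * (1 / √(n:ℝ)) + 2 * B * t^2 * (1 / √(n:ℝ))^2 + |t| * D * (1 / √(n:ℝ))) atTop (𝓝 0) := by
    have := ((hs.const_mul (C * |t|^3)).add ((hs.pow 2).const_mul (2 * B * t^2))).add (hs.const_mul (|t| * D))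
    simpa using this
  refine tendsto_of_tendsto_of_tendsto_of_le_of_le' tendsto_const_nhds hb (Eventually.of_forall fun n => norm_nonneg _) ?_
  have hsm : ∀ᶠ n : ℕ in atTop, |t| * (1 / √(n:ℝ)) < 1/4 := by
    have := hs.const_mul |t|
    rw [mul_zero] at this
    exact this.eventually_lt_const (by norm_num)
  filter_upwards [hsm, eventually_gt_atTop 0] with n hn hn0
  have hn1 : (0:ℝ) < n := by exact_mod_cast hn0
  have hsn : 0 < √(n:ℝ) := Real.sqrt_pos.2 hn1
  obtain ⟨s, hs⟩ : ∃ s, s = 1 / √(n:ℝ) := ⟨_, rfl⟩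
  have hs0 : 0 < s := by rw [hs]; positivity
  have hs2 : n * s^2 = 1 := by rw [hs, div_pow, Real.sq_sqrt hn1.le]; field_simp
  have et : t / √(n:ℝ) = t * s := by rw [hs]; ring
  rw [et, ← hs]
  rw [← hs] at hn
  have ea : |t * s| = |t| * s := by rw [abs_mul, abs_of_pos hs0]
  have k1 := h3 (t*s) (by rw [ea]; exact hn.le) n
  have k2 := h4 (t*s) n
  rw [show -((t*s)^2*σ2/2) * n = -(t^2*σ2/2) by linear_combination (-(t^2*σ2/2)) * hs2] at k1
  rw [ea] at k1 k2
  have e5 : (n:ℝ) * (C * (|t| * s)^3) = C * |t|^3 * s := by linear_combination (C * |t|^3 * s) * hs2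
  rw [e5] at k1
  calc _ ≤ _ := norm_sub_le_norm_sub_add_norm_sub _ (∫ x, ee (gg u) (t*s) n x ∂gm) _
    _ ≤ |t| * s * D + (C * |t|^3 * s + 2 * B * (t*s)^2) := add_le_add k2 k1
    _ = _ := by ring
end
end
end KN
namespace KN
open MeasureTheory Filter Set
open scoped Topology ENNReal
open Real (log exp sqrt)
noncomputable section
def Phi (y : ℝ) : ℝ := (1 / sqrt (2 * Real.pi)) * ∫ t in Set.Iic y, exp (-t ^ 2 / 2)
lemma Phi_eq (y : ℝ) : (ProbabilityTheory.gaussianReal 0 1).real (Iio y) = Phi y := by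
  have := ProbabilityTheory.noAtoms_gaussianReal (μ := 0) (v := 1) one_ne_zero
  rw [measureReal_congr (Iio_ae_eq_Iic), Measure.real, ProbabilityTheory.gaussianReal_apply_eq_integral _ one_ne_zero,
    ENNReal.toReal_ofReal (integral_nonneg fun x => ProbabilityTheory.gaussianPDFReal_nonneg _ _ _), Phi, ← integral_const_mul]
  refine integral_congr_ae (Eventually.of_forall fun x => ?_)
  simp [ProbabilityTheory.gaussianPDFReal_def]
lemma Phi_lip (x y : ℝ) : |Phi y - Phi x| ≤ |y - x| := by
  have hi : Integrable (fun t : ℝ => exp (-t ^ 2 / 2)) := by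
    have := integrable_exp_neg_mul_sq (b := 1/2) (by norm_num)
    refine this.congr (Eventually.of_forall fun t => ?_)
    simp only; congr 1; ring
  unfold Phi
  rw [← mul_sub, intervalIntegral.integral_Iic_sub_Iic hi.integrableOn hi.integrableOn, abs_mul]
  have h1 : |∫ t in x..y, exp (-t ^ 2 / 2)| ≤ 1 * |y - x| := by
    rw [← Real.norm_eq_abs]
    refine intervalIntegral.norm_integral_le_of_norm_le_const fun t _ => ?_
    rw [Real.norm_of_nonneg (Real.exp_pos _).le, Real.exp_le_one_iff]
    nlinarith [sq_nonneg t]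
  have h2 : |1 / sqrt (2 * Real.pi)| ≤ 1 := by
    rw [abs_of_nonneg (by positivity)]
    have : 1 ≤ sqrt (2 * Real.pi) := by
      rw [Real.one_le_sqrt]; nlinarith [Real.pi_gt_three]
    rw [div_le_one (by linarith)]; exact this
  calc _ ≤ 1 * (1 * |y - x|) := by gcongr
    _ = _ := by ring
section
variable {u v : ℝ → ℝ} {B σ2 : ℝ}
lemma clt (hu : Continuous u) (hv : Continuous v) (hB0 : 0 ≤ B) (hσ : 0 < σ2) (hB : ∀ x ∈ Ioo (0:ℝ) 1, |u x| ≤ B)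
    (hBv : ∀ x ∈ Ioo (0:ℝ) 1, |v x| ≤ B)
    (h1 : ∀ x ∈ Ioo (0:ℝ) 1, HasSum (fun a => wt a x * DD u a x) 0)
    (h2 : ∀ x ∈ Ioo (0:ℝ) 1, v x - LL v x = ((∑' a, wt a x * DD u a x ^ 2) - σ2)/2) (y : ℝ) :
    Tendsto (fun n : ℕ => volume.real ({x | - birkhoffSum gaussMap (gg u) n x < y * (√σ2 * √n)} ∩ Ioo (0:ℝ) 1)) atTop (𝓝 (Phi y)) := by
  have hs : 0 < √σ2 := Real.sqrt_pos.2 hσ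
  obtain ⟨Z, hZ⟩ : ∃ Z : ℕ → ℝ → ℝ, Z = fun n x => - birkhoffSum gaussMap (gg u) n x / (√σ2 * √n) := ⟨_, rfl⟩
  have hbm := fun n => bs_meas (gg_meas hu) n
  have hZm : ∀ n, Measurable (Z n) := by
    intro n; rw [hZ]; exact (hbm n).neg.div_const _
  have hP : IsProbabilityMeasure (volume.restrict (Ioo (0:ℝ) 1)) := ⟨by simp⟩
  have hQ : ∀ n, IsProbabilityMeasure ((volume.restrict (Ioo (0:ℝ) 1)).map (Z n)) := fun n =>
    Measure.isProbabilityMeasure_map (hZm n).aemeasurable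
  have hconv : Tendsto (β := ProbabilityMeasure ℝ) (fun n => ⟨(volume.restrict (Ioo (0:ℝ) 1)).map (Z n), hQ n⟩) atTop
      (𝓝 ⟨ProbabilityTheory.gaussianReal 0 1, inferInstance⟩) := by
    refine ProbabilityMeasure.tendsto_iff_tendsto_charFun.2 fun t => ?_
    have := char_conv hu hv hB0 hσ hB hBv h1 h2 (-t/√σ2)
    simp only [ProbabilityMeasure.coe_mk]
    have e1 : charFun (ProbabilityTheory.gaussianReal 0 1) t = Complex.exp ((-((-t/√σ2)^2*σ2/2) : ℝ) : ℂ) := by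
      rw [ProbabilityTheory.charFun_gaussianReal, div_pow, Real.sq_sqrt hσ.le]
      congr 1
      have : (σ2:ℂ) ≠ 0 := by exact_mod_cast hσ.ne'
      push_cast
      field_simp
      ring
    rw [e1]
    refine this.congr fun n => ?_
    rw [charFun_apply_real, integral_map (hZm n).aemeasurable (by fun_prop)]
    refine integral_congr_ae (Eventually.of_forall fun x => ?_)
    simp only [ee, hZ]
    congr 1
    push_cast
    ring
  have h3 := ProbabilityMeasure.tendsto_measure_of_null_frontier_of_tendsto' hconv (E := Iio y) (by
    rw [frontier_Iio]; have := ProbabilityTheory.noAtoms_gaussianReal (μ := 0) (v := 1) one_ne_zero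
    exact measure_singleton (μ := ProbabilityTheory.gaussianReal 0 1) y)
  have h4 := (ENNReal.tendsto_toReal (measure_ne_top (ProbabilityTheory.gaussianReal 0 1) _)).comp h3
  rw [← Phi_eq]
  refine Tendsto.congr' ?_ h4
  filter_upwards [eventually_gt_atTop 0] with n hn
  have hn' : (0:ℝ) < n := by exact_mod_cast hn
  have : 0 < √σ2 * √n := by positivity
  simp only [Function.comp, ProbabilityMeasure.coe_mk]
  rw [Measure.map_apply (hZm n) measurableSet_Iio, Measure.restrict_apply (hZm n measurableSet_Iio), Measure.real]
  congr 3
  ext x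
  simp only [hZ, mem_preimage, mem_Iio, mem_ofPred_eq, div_lt_iff₀ this]
lemma clt_moving (hu : Continuous u) (hv : Continuous v) (hB0 : 0 ≤ B) (hσ : 0 < σ2) (hB : ∀ x ∈ Ioo (0:ℝ) 1, |u x| ≤ B)
    (hBv : ∀ x ∈ Ioo (0:ℝ) 1, |v x| ≤ B)
    (h1 : ∀ x ∈ Ioo (0:ℝ) 1, HasSum (fun a => wt a x * DD u a x) 0)
    (h2 : ∀ x ∈ Ioo (0:ℝ) 1, v x - LL v x = ((∑' a, wt a x * DD u a x ^ 2) - σ2)/2) (y : ℝ) {m : ℕ → ℕ} {c : ℕ → ℝ}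
    (hm : Tendsto m atTop atTop) (hc : Tendsto (fun n => c n / (√σ2 * √(m n))) atTop (𝓝 y)) :
    Tendsto (fun n : ℕ => volume.real ({x | - birkhoffSum gaussMap (gg u) (m n) x < c n} ∩ Ioo (0:ℝ) 1)) atTop (𝓝 (Phi y)) := by
  have hs : 0 < √σ2 := Real.sqrt_pos.2 hσ
  have key : ∀ z, Tendsto (fun n : ℕ => volume.real ({x | - birkhoffSum gaussMap (gg u) (m n) x < z * (√σ2 * √(m n))} ∩ Ioo (0:ℝ) 1)) atTop (𝓝 (Phi z)) :=
    fun z => (clt hu hv hB0 hσ hB hBv h1 h2 z).comp hm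
  have mono : ∀ (n : ℕ) (a b : ℝ), a ≤ b → volume.real ({x | - birkhoffSum gaussMap (gg u) n x < a} ∩ Ioo (0:ℝ) 1) ≤
      volume.real ({x | - birkhoffSum gaussMap (gg u) n x < b} ∩ Ioo (0:ℝ) 1) := by
    intro n a b hab
    refine measureReal_mono ?_ ((measure_mono inter_subset_right).trans_lt (by simp)).ne
    exact inter_subset_inter_left _ fun x hx => lt_of_lt_of_le hx hab
  rw [Metric.tendsto_nhds]
  intro ε hε
  have k1 := (Metric.tendsto_nhds.1 (key (y - ε/2))) (ε/2) (by linarith)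
  have k2 := (Metric.tendsto_nhds.1 (key (y + ε/2))) (ε/2) (by linarith)
  have k3 := (Metric.tendsto_nhds.1 hc) (ε/2) (by linarith)
  filter_upwards [k1, k2, k3, hm.eventually_gt_atTop 0] with n a1 a2 a3 a4
  have : (0:ℝ) < √σ2 * √(m n) := by
    have : (0:ℝ) < m n := by exact_mod_cast a4
    positivity
  rw [Real.dist_eq, abs_lt] at a1 a2 a3 ⊢
  have b1 : (y - ε/2) * (√σ2 * √(m n)) ≤ c n := by rw [← le_div_iff₀ this]; linarith
  have b2 : c n ≤ (y + ε/2) * (√σ2 * √(m n)) := by rw [← div_le_iff₀ this]; linarith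
  have m1 := mono (m n) _ _ b1
  have m2 := mono (m n) _ _ b2
  have p1 := abs_le.1 (Phi_lip y (y - ε/2))
  have p2 := abs_le.1 (Phi_lip y (y + ε/2))
  rw [show |y - ε/2 - y| = ε/2 by rw [sub_sub_cancel_left, abs_neg, abs_of_pos]; linarith] at p1
  rw [show |y + ε/2 - y| = ε/2 by rw [add_sub_cancel_left, abs_of_pos]; linarith] at p2
  constructor <;> linarith
end
end
end KN
namespace KN
open MeasureTheory Filter Set
open scoped Topology ENNReal
open Real (log exp sqrt)
noncomputable section
lemma cheb {A B : Set ℝ} (hA : MeasurableSet A) (hAB : A ⊆ B) {f : ℝ → ℝ} {c : ℝ} (h : ∀ x ∈ A, c ≤ f x) :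
    ENNReal.ofReal (exp c) * gm A ≤ ∫⁻ x in B, ENNReal.ofReal (exp (f x)) ∂gm := by
  calc ENNReal.ofReal (exp c) * gm A = ∫⁻ x in A, ENNReal.ofReal (exp c) ∂gm := by rw [setLIntegral_const]
    _ ≤ ∫⁻ x in A, ENNReal.ofReal (exp (f x)) ∂gm :=
        setLIntegral_mono' hA fun x hx => ENNReal.ofReal_le_ofReal (Real.exp_le_exp.2 (h x hx))
    _ ≤ _ := lintegral_mono_set hAB
lemma ofReal_exp_mul (a b : ℝ) (X : ℝ≥0∞) : ENNReal.ofReal (exp a) * (ENNReal.ofReal (exp b) * X) =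
    ENNReal.ofReal (exp (a + b)) * X := by
  rw [← mul_assoc, ← ENNReal.ofReal_mul (Real.exp_pos _).le, Real.exp_add]
lemma MgfBd.neg {g : ℝ → ℝ} {σ2 C s0 : ℝ} (h : MgfBd g σ2 C s0) : MgfBd (fun x => - g x) σ2 C s0 := by
  intro s hs n Q hQ
  have := h (-s) (by rwa [abs_neg]) n Q hQ
  have e : ∀ x, s * birkhoffSum gaussMap (fun x => - g x) n x = -s * birkhoffSum gaussMap g n x := by
    intro x; simp [birkhoffSum]
  simp_rw [e]
  simpa using this
section
variable {g : ℝ → ℝ} {σ2 C s0 : ℝ}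
lemma tail_gen (hg : Measurable g) (h : MgfBd g σ2 C s0) {s c : ℝ} (hs : |s| ≤ s0) (n : ℕ) {Q : Set ℝ} (hQ : MeasurableSet Q) :
    gm (gaussMap^[n] ⁻¹' Q ∩ {x | c ≤ s * birkhoffSum gaussMap g n x}) ≤
      ENNReal.ofReal (4 * exp (-c + n * (s^2*σ2/2 + C*|s|^3))) * gm Q := by
  have hb := bs_meas hg n
  have hA : MeasurableSet (gaussMap^[n] ⁻¹' Q ∩ {x | c ≤ s * birkhoffSum gaussMap g n x}) :=
    ((gaussMap_meas.iterate n) hQ).inter (measurableSet_le measurable_const (hb.const_mul s))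
  have h1 := (cheb hA inter_subset_left (f := fun x => s * birkhoffSum gaussMap g n x) (c := c) (fun x hx => hx.2)).trans (h s hs n Q hQ).1
  have h2 := mul_le_mul_right h1 (ENNReal.ofReal (exp (-c)))
  rw [ofReal_exp_mul, neg_add_cancel, Real.exp_zero, ENNReal.ofReal_one, one_mul] at h2
  refine h2.trans (le_of_eq ?_)
  rw [ENNReal.ofReal_mul (by norm_num), Real.exp_add, ENNReal.ofReal_mul (Real.exp_pos _).le]
  simp only [ENNReal.ofReal_ofNat]
  ring
lemma tail (hg : Measurable g) (h : MgfBd g σ2 C s0) (hσ : 0 < σ2) {n : ℕ} (hn : 0 < n) {t : ℝ} (ht : 0 ≤ t)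
    (h1 : t / (n * σ2) ≤ s0) (h2 : n * (C * (t / (n * σ2))^3) ≤ 1) :
    gm {x | t ≤ birkhoffSum gaussMap g n x} ≤ ENNReal.ofReal (12 * exp (-(t^2 / (2 * n * σ2)))) := by
  have hn' : (0:ℝ) < n := by exact_mod_cast hn
  obtain ⟨s, hs⟩ : ∃ s, s = t / (n * σ2) := ⟨_, rfl⟩
  have hs0 : 0 ≤ s := by rw [hs]; positivity
  rw [← hs] at h1 h2
  have h3 := tail_gen hg h (s := s) (c := s * t) (by rwa [abs_of_nonneg hs0]) n MeasurableSet.univ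
  rw [measure_univ, mul_one, abs_of_nonneg hs0] at h3
  refine (measure_mono ?_).trans (h3.trans (ENNReal.ofReal_le_ofReal ?_))
  · intro x hx
    exact ⟨trivial, mul_le_mul_of_nonneg_left hx hs0⟩
  · have e : -(s*t) + n * (s^2*σ2/2 + C * s^3) ≤ -(t^2 / (2 * n * σ2)) + 1 := by
      have : -(s*t) + n * (s^2*σ2/2) = -(t^2 / (2 * n * σ2)) := by
        rw [hs]; field_simp; ring
      linarith
    have e2 := Real.exp_le_exp.2 e
    rw [Real.exp_add (-(t^2 / (2 * n * σ2)))] at e2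
    have e3 := Real.exp_one_lt_d9
    have := Real.exp_pos (-(t^2 / (2 * n * σ2)))
    nlinarith
lemma half (hg : Measurable g) (h : MgfBd g σ2 C s0) (hC : 0 ≤ C) (hσ : 0 < σ2) (hs : 0 < s0) :
    ∃ K : ℝ, 0 ≤ K ∧ ∀ N m : ℕ, 0 < N → m ≤ N → ∀ Q, MeasurableSet Q →
      gm Q ≤ 2 * gm (gaussMap^[m] ⁻¹' Q ∩ {x | - (K * √N) ≤ birkhoffSum gaussMap g m x}) := by
  obtain ⟨E, hE⟩ : ∃ E, E = s0^2*σ2/2 + C*s0^3 := ⟨_, rfl⟩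
  have hE0 : 0 ≤ E := by rw [hE]; positivity
  refine ⟨(E + 3) / s0, by positivity, fun N m hN hm Q hQ => ?_⟩
  have hN' : (1:ℝ) ≤ N := by exact_mod_cast hN
  have hsN : 1 ≤ √(N:ℝ) := Real.one_le_sqrt.2 hN'
  have hsq : √(N:ℝ)^2 = N := Real.sq_sqrt (by linarith)
  obtain ⟨s, hss⟩ : ∃ s, s = s0 / √(N:ℝ) := ⟨_, rfl⟩
  have hsp : 0 < s := by rw [hss]; positivity
  have hs1 : s ≤ s0 := by rw [hss]; exact div_le_self hs.le hsN
  have h3 := tail_gen hg h (s := -s) (c := E + 3) (by rw [abs_neg, abs_of_pos hsp]; exact hs1) m hQ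
  have hm' : (m:ℝ) ≤ N := by exact_mod_cast hm
  have hms : (m:ℝ) * s^2 ≤ s0^2 := by
    have : (N:ℝ) * s^2 = s0^2 := by rw [hss, div_pow, hsq]; field_simp
    have := mul_le_mul_of_nonneg_right hm' (sq_nonneg s)
    linarith
  have hex : -(E+3) + m * ((-s)^2*σ2/2 + C*|(-s)|^3) ≤ -3 := by
    rw [abs_neg, abs_of_pos hsp, hE]
    have a1 : m * s^2 * σ2 ≤ s0^2 * σ2 := mul_le_mul_of_nonneg_right hms hσ.le
    have a2 : (m * s^2) * s * C ≤ s0^2 * s0 * C := by gcongr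
    nlinarith
  have h4 : 4 * exp (-(E+3) + m * ((-s)^2*σ2/2 + C*|(-s)|^3)) ≤ 1/2 := by
    have := Real.exp_le_exp.2 hex
    have h5 : exp (-3) ≤ 1/8 := by
      rw [Real.exp_neg, show (3:ℝ) = (3:ℕ) * 1 by norm_num, Real.exp_nat_mul, ← one_div]
      apply one_div_le_one_div_of_le (by norm_num)
      have := Real.exp_one_gt_d9
      calc (8:ℝ) = 2^3 := by norm_num
        _ ≤ _ := by gcongr; linarith
    linarith
  have hmQ : MeasurableSet (gaussMap^[m] ⁻¹' Q) := (gaussMap_meas.iterate m) hQ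
  have hpm : gm (gaussMap^[m] ⁻¹' Q) = gm Q := (gauss_mp.iterate m).measure_preimage hQ.nullMeasurableSet
  have h6 : gm (gaussMap^[m] ⁻¹' Q ∩ {x | E + 3 ≤ -s * birkhoffSum gaussMap g m x}) ≤ 2⁻¹ * gm Q := by
    refine h3.trans (mul_le_mul_left ?_ _)
    calc _ ≤ ENNReal.ofReal (1/2) := ENNReal.ofReal_le_ofReal h4
      _ = _ := by rw [one_div, ENNReal.ofReal_inv_of_pos (by norm_num)]; simp
  have h7 : gm Q ≤ gm (gaussMap^[m] ⁻¹' Q ∩ {x | - ((E+3)/s0 * √N) ≤ birkhoffSum gaussMap g m x}) + 2⁻¹ * gm Q := by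
    refine le_trans ?_ (add_le_add_right h6 _)
    rw [← hpm]
    refine (measure_mono ?_).trans (measure_union_le _ _)
    intro x hx
    by_cases hh : - ((E+3)/s0 * √N) ≤ birkhoffSum gaussMap g m x
    · exact Or.inl ⟨hx, hh⟩
    · refine Or.inr ⟨hx, ?_⟩
      push Not at hh
      have : s * ((E+3)/s0 * √N) = E + 3 := by rw [hss]; field_simp
      have := mul_lt_mul_of_pos_left hh hsp
      show E + 3 ≤ _
      linarith
  have hfin : gm Q ≠ ∞ := measure_ne_top _ _
  have h8 : gm Q = 2⁻¹ * gm Q + 2⁻¹ * gm Q := by rw [← add_mul, ENNReal.inv_two_add_inv_two, one_mul]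
  have h9 : 2⁻¹ * gm Q ≤ gm (gaussMap^[m] ⁻¹' Q ∩ {x | - ((E+3)/s0 * √N) ≤ birkhoffSum gaussMap g m x}) := by
    exact (ENNReal.add_le_add_iff_right (ENNReal.mul_ne_top (by simp) hfin)).1 (h8.symm.le.trans h7)
  calc gm Q = 2 * (2⁻¹ * gm Q) := by rw [← mul_assoc, ENNReal.mul_inv_cancel (by simp) (by simp), one_mul]
    _ ≤ _ := by gcongr
lemma ottaviani (hg : Measurable g) {N : ℕ} {t c : ℝ}
    (h : ∀ m ≤ N, ∀ Q, MeasurableSet Q → gm Q ≤ 2 * gm (gaussMap^[m] ⁻¹' Q ∩ {x | - c ≤ birkhoffSum gaussMap g m x})) :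
    gm {x | ∃ m ≤ N, t ≤ birkhoffSum gaussMap g (N - m) (gaussMap^[m] x)} ≤ 2 * gm {x | t - c ≤ birkhoffSum gaussMap g N x} := by
  have hb := fun n => bs_meas hg n
  have hi := fun n => gaussMap_meas.iterate n
  obtain ⟨D, hD⟩ : ∃ D : ℕ → Set ℝ, D = fun m => {y | t ≤ birkhoffSum gaussMap g (N - m) y} ∩
      ⋂ j ∈ Finset.Icc 1 (N - m), {y | birkhoffSum gaussMap g (N - m - j) (gaussMap^[j] y) < t} := ⟨_, rfl⟩
  have hDm : ∀ m, MeasurableSet (D m) := by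
    intro m; rw [hD]
    refine (measurableSet_le measurable_const (hb _)).inter (Finset.measurableSet_biInter _ fun j _ => ?_)
    exact measurableSet_lt ((hb _).comp (hi j)) measurable_const
  obtain ⟨F, hF⟩ : ∃ F : ℕ → Set ℝ, F = fun m => gaussMap^[m] ⁻¹' D m ∩ {x | - c ≤ birkhoffSum gaussMap g m x} := ⟨_, rfl⟩
  have hFm : ∀ m, MeasurableSet (F m) := by
    intro m; rw [hF]
    exact ((hi m) (hDm m)).inter (measurableSet_le measurable_const (hb _))
  have hdisj : ∀ a b, a < b → b ≤ N → Disjoint (gaussMap^[a] ⁻¹' D a) (gaussMap^[b] ⁻¹' D b) := by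
    intro a b hab hbN
    rw [Set.disjoint_left]
    intro x hx hy
    rw [hD] at hx hy
    have h1 := hy.1
    have h2 := hx.2
    simp only [mem_iInter] at h2
    have h3 := h2 (b - a) (Finset.mem_Icc.2 ⟨by omega, by omega⟩)
    simp only [mem_ofPred_eq] at h1 h3
    rw [← Function.iterate_add_apply, show b - a + a = b by omega, show N - a - (b - a) = N - b by omega] at h3
    linarith
  have cover : {x | ∃ m ≤ N, t ≤ birkhoffSum gaussMap g (N - m) (gaussMap^[m] x)} ⊆ ⋃ m ∈ Finset.range (N+1), gaussMap^[m] ⁻¹' D m := by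
    classical
    rintro x ⟨m, hm, hx⟩
    obtain ⟨M, hM⟩ : ∃ M, M = Nat.findGreatest (fun m => t ≤ birkhoffSum gaussMap g (N - m) (gaussMap^[m] x)) N := ⟨_, rfl⟩
    have hM1 : M ≤ N := by rw [hM]; exact Nat.findGreatest_le N
    have hM2 : t ≤ birkhoffSum gaussMap g (N - M) (gaussMap^[M] x) := by
      rw [hM]; exact Nat.findGreatest_spec (P := fun m => t ≤ birkhoffSum gaussMap g (N - m) (gaussMap^[m] x)) hm hx
    simp only [mem_iUnion]
    refine ⟨M, Finset.mem_range.2 (by omega), ?_⟩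
    rw [hD]
    refine ⟨hM2, ?_⟩
    simp only [mem_iInter]
    intro j hj
    rw [Finset.mem_Icc] at hj
    have := Nat.findGreatest_is_greatest (P := fun m => t ≤ birkhoffSum gaussMap g (N - m) (gaussMap^[m] x)) (n := N) (k := M + j)
      (by rw [← hM]; omega) (by omega)
    simp only [not_le] at this
    show _ < t
    rw [← Function.iterate_add_apply, show N - M - j = N - (M + j) by omega, add_comm j M]
    exact this
  calc _ ≤ gm (⋃ m ∈ Finset.range (N+1), gaussMap^[m] ⁻¹' D m) := measure_mono cover
    _ ≤ ∑ m ∈ Finset.range (N+1), gm (gaussMap^[m] ⁻¹' D m) := measure_biUnion_finset_le _ _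
    _ ≤ ∑ m ∈ Finset.range (N+1), 2 * gm (F m) := by
        refine Finset.sum_le_sum fun m hm => ?_
        rw [(gauss_mp.iterate m).measure_preimage (hDm m).nullMeasurableSet, hF]
        exact h m (by have := Finset.mem_range.1 hm; omega) _ (hDm m)
    _ = 2 * gm (⋃ m ∈ Finset.range (N+1), F m) := by
        rw [← Finset.mul_sum, measure_biUnion_finset ?_ (fun m _ => hFm m)]
        intro a ha b hb' hab
        have ha' : a ≤ N := by have := Finset.mem_range.1 (Finset.mem_coe.1 ha); omega
        have hb2 : b ≤ N := by have := Finset.mem_range.1 (Finset.mem_coe.1 hb'); omega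
        simp only [Function.onFun, hF]
        rcases lt_or_gt_of_ne hab with hlt | hlt
        · exact (hdisj a b hlt hb2).mono inter_subset_left inter_subset_left
        · exact (hdisj b a hlt ha').symm.mono inter_subset_left inter_subset_left
    _ ≤ _ := by
        gcongr
        intro x hx
        simp only [mem_iUnion] at hx
        obtain ⟨m, hm, hx⟩ := hx
        have hm' : m ≤ N := by have := Finset.mem_range.1 hm; omega
        rw [hF] at hx
        obtain ⟨h1, h2⟩ := hx
        rw [hD] at h1
        have h3 := h1.1
        simp only [mem_ofPred_eq] at h2 h3 ⊢
        have e := birkhoffSum_add gaussMap g m (N - m) x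
        rw [show m + (N - m) = N by omega] at e
        linarith
end
end
end KN
namespace KN
open MeasureTheory Filter Set
open scoped Topology ENNReal
open Real (log exp sqrt)
noncomputable section
def lk (k : ℕ) : ℝ := log (k * log 2)
lemma bs_neg (g : ℝ → ℝ) (n : ℕ) (x : ℝ) : birkhoffSum gaussMap (fun x => - g x) n x = - birkhoffSum gaussMap g n x := by
  simp [birkhoffSum]
lemma small_lim {r : ℝ} (hr : 1 < r) (d : ℕ) : Tendsto (fun k : ℕ => √(k:ℝ)^d / √(r^k)) atTop (𝓝 0) := by
  have h := (tendsto_pow_const_div_const_pow_of_one_lt d hr).sqrt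
  rw [Real.sqrt_zero] at h
  refine h.congr fun k => ?_
  rw [Real.sqrt_div (by positivity)]
  congr 1
  rw [Real.sqrt_eq_iff_mul_self_eq (by positivity) (by positivity), ← mul_pow, Real.mul_self_sqrt (by positivity)]
lemma lk_le (k : ℕ) : lk k ≤ k := by
  unfold lk
  rcases Nat.eq_zero_or_pos k with h | h
  · simp [h]
  have hk : (0:ℝ) < k := by exact_mod_cast h
  have := log2_pos
  have h2 : log 2 < 1 := by have := Real.log_two_lt_d9; linarith
  have := Real.log_le_sub_one_of_pos (show 0 < k * log 2 by positivity)
  nlinarith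
lemma lk_tendsto : Tendsto lk atTop atTop := by
  unfold lk
  exact Real.tendsto_log_atTop.comp (tendsto_natCast_atTop_atTop.atTop_mul_const log2_pos)
lemma lk_summable {ρ : ℝ} (hρ : 1 < ρ) : Summable (fun k : ℕ => 12 * exp (-(ρ * lk k))) := by
  refine Summable.mul_left _ ?_
  have := (Real.summable_nat_rpow.2 (show -ρ < -1 by linarith)).mul_left ((log 2)^(-ρ))
  refine (summable_congr_atTop ?_).1 this
  filter_upwards [eventually_gt_atTop 0] with k hk
  have hk : (0:ℝ) < k := by exact_mod_cast hk
  have h2 := log2_pos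
  rw [← Real.mul_rpow h2.le hk.le, Real.rpow_def_of_pos (by positivity)]
  unfold lk
  congr 1
  rw [mul_comm (log 2)]; ring
lemma BC {A : ℕ → Set ℝ} {f : ℕ → ℝ} (hf : Summable f) (h : ∀ᶠ k in atTop, gm (A k) ≤ ENNReal.ofReal (f k)) :
    ∀ᵐ x ∂gm, ∀ᶠ k in atTop, x ∉ A k := by
  obtain ⟨k0, hk0⟩ := eventually_atTop.1 h
  have h1 : ∑' k, gm (A (k + k0)) ≠ ∞ := by
    have h2 : ∑' k, ENNReal.ofReal (f (k + k0)) ≠ ∞ := ((summable_nat_add_iff k0).2 hf).tsum_ofReal_ne_top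
    exact ne_top_of_le_ne_top h2 (ENNReal.tsum_le_tsum fun k => hk0 _ (by omega))
  filter_upwards [ae_eventually_notMem h1] with x hx
  obtain ⟨k1, hk1⟩ := eventually_atTop.1 hx
  refine eventually_atTop.2 ⟨k1 + k0, fun k hk => ?_⟩
  have := hk1 (k - k0) (by omega)
  rwa [show k - k0 + k0 = k by omega] at this
section
variable {g : ℝ → ℝ} {σ2 C s0 : ℝ}
lemma tail_ev (hg : Measurable g) (h : MgfBd g σ2 C s0) (hC : 0 ≤ C) (hσ : 0 < σ2) (hs : 0 < s0) {q : ℕ} (hq : 0 < q) {c : ℝ} (hc : 0 < c) :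
    ∀ᶠ k : ℕ in atTop, gm {x | c * √(2^k * lk k) ≤ birkhoffSum gaussMap g (2^k*q) x} ≤
      ENNReal.ofReal (12 * exp (-(c^2 / (2 * q * σ2) * lk k))) := by
  have hq' : (0:ℝ) < q := by exact_mod_cast hq
  have l1 := (small_lim (r := 2) (by norm_num) 1).const_mul (c / (q * σ2))
  have l3 := (small_lim (r := 2) (by norm_num) 3).const_mul (C * c^3 / (q^2 * σ2^3))
  rw [mul_zero] at l1 l3
  filter_upwards [l1.eventually_lt_const hs, l3.eventually_lt_const one_pos, lk_tendsto.eventually_ge_atTop 0] with k a1 a3 a0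
  obtain ⟨w, hw⟩ : ∃ w, w = √(lk k) := ⟨_, rfl⟩
  obtain ⟨z, hz⟩ : ∃ z, z = √((2:ℝ)^k) := ⟨_, rfl⟩
  have hz0 : 0 < z := by rw [hz]; positivity
  have hw0 : 0 ≤ w := by rw [hw]; positivity
  have hz2 : z^2 = 2^k := by rw [hz]; exact Real.sq_sqrt (by positivity)
  have hw2 : w^2 = lk k := by rw [hw]; exact Real.sq_sqrt a0
  have hwk : w ≤ √(k:ℝ) := by rw [hw]; exact Real.sqrt_le_sqrt (lk_le k)
  have e : √(2^k * lk k) = z * w := by rw [Real.sqrt_mul (by positivity), hz, hw]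
  have hn : ((2^k*q : ℕ) : ℝ) = z^2 * q := by rw [hz2]; push_cast; ring
  rw [← hz] at a1 a3
  have es : c * (z * w) / (z^2 * q * σ2) = c / (q * σ2) * (w / z) := by field_simp
  have := tail hg h hσ (n := 2^k*q) (by positivity) (t := c * (z * w)) (by positivity) (by
    rw [hn, es]
    refine le_trans ?_ a1.le
    rw [pow_one]
    gcongr) (by
    rw [hn, es]
    refine le_trans ?_ a3.le
    calc _ = C * c^3 / (q^2 * σ2^3) * (w^3 / z) := by field_simp
      _ ≤ _ := by gcongr)
  rw [e]
  refine this.trans (le_of_eq ?_)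
  rw [hn, ← hw2]
  congr 4
  field_simp
lemma upper (hg : Measurable g) (h : MgfBd g σ2 C s0) (hC : 0 ≤ C) (hσ : 0 < σ2) (hs : 0 < s0) {ε : ℝ} (hε : 0 < ε) :
    ∀ᵐ x ∂gm, ∀ᶠ n : ℕ in atTop, birkhoffSum gaussMap g n x ≤ (1 + ε) * (√σ2 * √(2 * n * log (log n))) := by
  have hsσ : 0 < √σ2 := Real.sqrt_pos.2 hσ
  have hs2 : √σ2^2 = σ2 := Real.sq_sqrt hσ.le
  obtain ⟨Q, hQ⟩ := exists_nat_gt (max (1/ε) (16/ε^2))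
  have hQ1 : 1 < ε * Q := by
    have := (le_max_left _ _).trans_lt hQ
    rwa [div_lt_iff₀' hε] at this
  have hQ2 : 16 < ε^2 * Q := by
    have := (le_max_right _ _).trans_lt hQ
    rwa [div_lt_iff₀' (by positivity)] at this
  have hQ0 : 0 < Q := by
    rcases Nat.eq_zero_or_pos Q with h0 | h0
    · rw [h0] at hQ1; norm_num at hQ1
    · exact h0
  have hgn := hg.neg
  have hn := h.neg
  obtain ⟨K, hK, hhalf⟩ := half hgn hn hC hσ hs
  have ev1 : ∀ p : ℕ, Q ≤ p → ∀ᵐ x ∂gm, ∀ᶠ k : ℕ in atTop,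
      birkhoffSum gaussMap g (2^k*(p+1)) x < (1 + ε/2) * (√σ2 * √(2*p)) * √(2^k * lk k) := by
    intro p hp
    have hp' : (Q:ℝ) ≤ p := by exact_mod_cast hp
    have hp0 : (0:ℝ) < p := lt_of_lt_of_le (by exact_mod_cast hQ0) hp'
    have := BC (lk_summable ?_) (tail_ev hg h hC hσ hs (q := p+1) (by omega) (c := (1 + ε/2) * (√σ2 * √(2*p))) (by positivity))
    · filter_upwards [this] with x hx
      filter_upwards [hx] with k hk
      simpa using hk
    · rw [lt_div_iff₀ (by positivity), mul_pow, mul_pow, hs2, Real.sq_sqrt (by positivity)]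
      push_cast
      have : (p:ℝ) + 1 < (1 + ε/2)^2 * p := by nlinarith [mul_le_mul_of_nonneg_left hp' hε.le, mul_pos (pow_pos hε 2) hp0]
      nlinarith
  have ev2 : ∀ p : ℕ, Q ≤ p → ∀ᵐ x ∂gm, ∀ᶠ k : ℕ in atTop, ∀ m ≤ 2^k,
      birkhoffSum gaussMap (fun x => - g x) (2^k - m) (gaussMap^[m] (gaussMap^[2^k*p] x)) < (ε/2) * (√σ2 * √(2*p)) * √(2^k * lk k) := by
    intro p hp
    have hp' : (Q:ℝ) ≤ p := by exact_mod_cast hp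
    have hp0 : (0:ℝ) < p := lt_of_lt_of_le (by exact_mod_cast hQ0) hp'
    have := BC (A := fun k => gaussMap^[2^k*p] ⁻¹' {x | ∃ m ≤ 2^k, (ε/2) * (√σ2 * √(2*p)) * √(2^k * lk k) ≤
        birkhoffSum gaussMap (fun x => - g x) (2^k - m) (gaussMap^[m] x)})
      ((lk_summable (ρ := ((ε/4) * (√σ2 * √(2*p)))^2/(2 * (1:ℕ) * σ2)) ?_).mul_left 2) ?_
    · filter_upwards [this] with x hx
      filter_upwards [hx] with k hk
      simpa using hk
    · rw [lt_div_iff₀ (by positivity), mul_pow, mul_pow, hs2, Real.sq_sqrt (by positivity)]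
      push_cast
      have : 16 < ε^2 * p := by nlinarith [mul_le_mul_of_nonneg_left hp' (sq_nonneg ε)]
      nlinarith
    · have hc0 : 0 < (ε/4) * (√σ2 * √(2*p)) := by positivity
      have t1 := tail_ev hgn hn hC hσ hs (q := 1) one_pos hc0
      have t2 := (lk_tendsto.eventually_ge_atTop ((K / ((ε/4) * (√σ2 * √(2*p))))^2))
      filter_upwards [t1, t2] with k a1 a2
      have hms : MeasurableSet {x | ∃ m ≤ 2^k, (ε/2) * (√σ2 * √(2*p)) * √(2^k * lk k) ≤
          birkhoffSum gaussMap (fun x => - g x) (2^k - m) (gaussMap^[m] x)} := by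
        have : {x | ∃ m ≤ 2^k, (ε/2) * (√σ2 * √(2*p)) * √(2^k * lk k) ≤
          birkhoffSum gaussMap (fun x => - g x) (2^k - m) (gaussMap^[m] x)} = ⋃ m ∈ Finset.range (2^k+1), {x | (ε/2) * (√σ2 * √(2*p)) * √(2^k * lk k) ≤
          birkhoffSum gaussMap (fun x => - g x) (2^k - m) (gaussMap^[m] x)} := by
          ext x; simp [Nat.lt_succ_iff]
        rw [this]
        exact Finset.measurableSet_biUnion _ fun m _ => measurableSet_le measurable_const ((bs_meas hgn _).comp (gaussMap_meas.iterate m))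
      rw [(gauss_mp.iterate _).measure_preimage hms.nullMeasurableSet]
      refine (ottaviani hgn (c := K * √((2^k:ℕ):ℝ)) (fun m hm Q hQ => hhalf (2^k) m (by positivity) hm Q hQ)).trans ?_
      rw [ENNReal.ofReal_mul (by norm_num), ENNReal.ofReal_ofNat]
      gcongr
      refine (measure_mono ?_).trans a1
      intro x hx
      simp only [mem_ofPred_eq, mul_one] at hx ⊢
      refine le_trans ?_ hx
      have b1 : K ≤ (ε/4) * (√σ2 * √(2*p)) * √(lk k) := by
        have := Real.le_sqrt_of_sq_le a2
        rwa [div_le_iff₀' hc0] at this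
      push_cast
      rw [Real.sqrt_mul (show (0:ℝ) ≤ 2^k by positivity)]
      have := mul_le_mul_of_nonneg_right b1 (Real.sqrt_nonneg ((2:ℝ)^k))
      linarith
  have ev3 : ∀ᵐ x ∂gm, ∀ p ∈ Finset.Icc Q (2*Q), (∀ᶠ k : ℕ in atTop,
      birkhoffSum gaussMap g (2^k*(p+1)) x < (1 + ε/2) * (√σ2 * √(2*p)) * √(2^k * lk k)) ∧
      (∀ᶠ k : ℕ in atTop, ∀ m ≤ 2^k,
      birkhoffSum gaussMap (fun x => - g x) (2^k - m) (gaussMap^[m] (gaussMap^[2^k*p] x)) < (ε/2) * (√σ2 * √(2*p)) * √(2^k * lk k)) := by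
    rw [Filter.eventually_all_finset]
    intro p hp
    have hp := (Finset.mem_Icc.1 hp).1
    filter_upwards [ev1 p hp, ev2 p hp] with x a b using ⟨a, b⟩
  filter_upwards [ev3] with x hx
  have hx2 : ∀ᶠ k : ℕ in atTop, ∀ p ∈ Finset.Icc Q (2*Q),
      birkhoffSum gaussMap g (2^k*(p+1)) x < (1 + ε/2) * (√σ2 * √(2*p)) * √(2^k * lk k) ∧
      (∀ m ≤ 2^k,
      birkhoffSum gaussMap (fun x => - g x) (2^k - m) (gaussMap^[m] (gaussMap^[2^k*p] x)) < (ε/2) * (√σ2 * √(2*p)) * √(2^k * lk k)) := by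
    rw [Filter.eventually_all_finset]
    intro p hp
    exact (hx p hp).1.and (hx p hp).2
  obtain ⟨k0, hk0⟩ := eventually_atTop.1 (hx2.and (lk_tendsto.eventually_ge_atTop 0))
  refine eventually_atTop.2 ⟨2^(k0+1)*Q, fun n hn => ?_⟩
  obtain ⟨k, hk⟩ : ∃ k, k = Nat.log 2 (n / Q) := ⟨_, rfl⟩
  have hnQ : n / Q ≠ 0 := by
    have : 1 ≤ n / Q := by
      rw [Nat.le_div_iff_mul_le hQ0]
      have : 1 ≤ 2^(k0+1) := Nat.one_le_two_pow
      nlinarith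
    omega
  have k1 : 2^k ≤ n / Q := by rw [hk]; exact Nat.pow_log_le_self 2 hnQ
  have k2 : n / Q < 2^(k+1) := by rw [hk]; exact Nat.lt_pow_succ_log_self (by norm_num) _
  have k3 : k0 + 1 ≤ k := by
    rw [hk]; apply Nat.le_log_of_pow_le (by norm_num)
    rw [Nat.le_div_iff_mul_le hQ0]; exact hn
  rw [Nat.le_div_iff_mul_le hQ0] at k1
  rw [Nat.div_lt_iff_lt_mul hQ0] at k2
  have hpos : 0 < 2^k := by positivity
  obtain ⟨p, hp⟩ : ∃ p, p = n / 2^k := ⟨_, rfl⟩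
  have p1 : Q ≤ p := by rw [hp, Nat.le_div_iff_mul_le hpos]; linarith
  have p2 : p ≤ 2*Q := by
    rw [hp]; apply Nat.le_of_lt
    rw [Nat.div_lt_iff_lt_mul hpos]; rw [pow_succ] at k2; linarith
  obtain ⟨m, hm⟩ : ∃ m, m = n % 2^k := ⟨_, rfl⟩
  have m1 : m < 2^k := by rw [hm]; exact Nat.mod_lt _ hpos
  have hnm : n = 2^k*p + m := by rw [hp, hm]; exact (Nat.div_add_mod n (2^k)).symm
  obtain ⟨a1, a2⟩ := (hk0 k (by omega)).1 p (Finset.mem_Icc.2 ⟨p1, p2⟩)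
  have a2 := a2 m m1.le
  rw [← Function.iterate_add_apply, show m + 2^k*p = n by omega, bs_neg] at a2
  have e := birkhoffSum_add gaussMap g n (2^k - m) x
  rw [show n + (2^k - m) = 2^k*(p+1) by rw [hnm, mul_add]; omega] at e
  have f1 : birkhoffSum gaussMap g n x ≤ (1 + ε) * (√σ2 * (√(2*p) * √(2^k * lk k))) := by linarith
  refine f1.trans ?_
  have h0 := (hk0 k (by omega)).2
  rw [← Real.sqrt_mul (by positivity)]
  have hk1 : (1:ℝ) ≤ k := by exact_mod_cast (show 1 ≤ k by omega)
  have hl2 := log2_pos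
  have hn2k : (2:ℝ)^k * p ≤ n := by rw [hnm]; push_cast; linarith [Nat.cast_nonneg (α := ℝ) m]
  have hp1 : (1:ℝ) ≤ p := by exact_mod_cast (show 1 ≤ p by omega)
  have hlog : k * log 2 ≤ log n := by
    rw [← Real.log_pow]
    apply Real.log_le_log (by positivity)
    nlinarith [pow_pos (show (0:ℝ) < 2 by norm_num) k]
  have hlk : lk k ≤ log (log n) := Real.log_le_log (by positivity) hlog
  refine mul_le_mul_of_nonneg_left (mul_le_mul_of_nonneg_left (Real.sqrt_le_sqrt ?_) hsσ.le) (by positivity)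
  calc (2*p*(2^k * lk k) : ℝ) = 2 * (2^k*p) * lk k := by ring
    _ ≤ _ := by gcongr
end
end
end KN
namespace KN
open MeasureTheory Filter Set
open scoped Topology ENNReal
open Real (log exp sqrt)
noncomputable section
section
variable {g : ℝ → ℝ} {σ2 C s0 : ℝ}
lemma part_le (h : MgfBd g σ2 C s0) {s' s ℓ c e : ℝ} (hs : |s'| ≤ s0) {n : ℕ} {Q A : Set ℝ} (hQ : MeasurableSet Q)
    (hA : MeasurableSet A) (hAQ : A ⊆ gaussMap^[n] ⁻¹' Q)
    (hx : ∀ x ∈ A, s * birkhoffSum gaussMap g n x ≤ c + s' * birkhoffSum gaussMap g n x)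
    (he : c + n * (s'^2*σ2/2 + C*|s'|^3) ≤ e) :
    ∫⁻ x in A, ENNReal.ofReal (exp (s * birkhoffSum gaussMap g n x)) ∂gm ≤ ENNReal.ofReal (4 * exp e) * gm Q := by
  have h1 := (h s' hs n Q hQ).1
  calc _ ≤ ∫⁻ x in A, ENNReal.ofReal (exp c) * ENNReal.ofReal (exp (s' * birkhoffSum gaussMap g n x)) ∂gm := by
        refine setLIntegral_mono' hA fun x hxA => ?_
        rw [← ENNReal.ofReal_mul (Real.exp_pos _).le, ← Real.exp_add]
        exact ENNReal.ofReal_le_ofReal (Real.exp_le_exp.2 (hx x hxA))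
    _ ≤ ∫⁻ x in gaussMap^[n] ⁻¹' Q, ENNReal.ofReal (exp c) * ENNReal.ofReal (exp (s' * birkhoffSum gaussMap g n x)) ∂gm :=
        lintegral_mono_set hAQ
    _ = ENNReal.ofReal (exp c) * ∫⁻ x in gaussMap^[n] ⁻¹' Q, ENNReal.ofReal (exp (s' * birkhoffSum gaussMap g n x)) ∂gm :=
        lintegral_const_mul' _ _ ENNReal.ofReal_ne_top
    _ ≤ ENNReal.ofReal (exp c) * (4 * ENNReal.ofReal (exp (n * (s'^2*σ2/2 + C*|s'|^3))) * gm Q) := by gcongr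
    _ = ENNReal.ofReal (4 * exp (c + n * (s'^2*σ2/2 + C*|s'|^3))) * gm Q := by
        rw [ENNReal.ofReal_mul (by norm_num), Real.exp_add, ENNReal.ofReal_mul (Real.exp_pos _).le]
        simp only [ENNReal.ofReal_ofNat]
        ring
    _ ≤ _ := by gcongr
lemma tilt (hg : Measurable g) (h : MgfBd g σ2 C s0) (hC : 0 ≤ C) {α δ r τ ℓ : ℝ} {n : ℕ}
    (hα : 0 < α) (hδ : 0 < δ) (hδα : δ < α) (hr : 0 ≤ r)
    (e1 : r * τ = 2 * ℓ) (e2 : n * r^2 * σ2 = 2 * ℓ) (hr1 : (α + δ) * r ≤ s0) (hr2 : n * (C * ((α + δ) * r)^3) ≤ 1)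
    (hl : exp (-(δ^2*ℓ)) ≤ 1/576) {Q : Set ℝ} (hQ : MeasurableSet Q) :
    gm.real Q ≤ 24 * exp ((α^2 + 2*α*δ)*ℓ) * gm.real (gaussMap^[n] ⁻¹' Q ∩ {x | (α - δ) * τ ≤ birkhoffSum gaussMap g n x}) := by
  have hb := bs_meas hg n
  have hTQ : MeasurableSet (gaussMap^[n] ⁻¹' Q) := (gaussMap_meas.iterate n) hQ
  obtain ⟨S, hS⟩ : ∃ S : ℝ → ℝ, S = birkhoffSum gaussMap g n := ⟨_, rfl⟩
  rw [← hS] at hb ⊢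
  have hn0 : (0:ℝ) ≤ n := Nat.cast_nonneg n
  have cub : ∀ a, 0 ≤ a → a ≤ α + δ → n * (C * |a * r|^3) ≤ 1 := by
    intro a ha0 ha
    rw [abs_of_nonneg (by positivity)]
    refine le_trans ?_ hr2
    gcongr
  have ab : ∀ a, 0 ≤ a → a ≤ α + δ → |a * r| ≤ s0 := by
    intro a ha0 ha
    rw [abs_of_nonneg (by positivity)]
    exact le_trans (by gcongr) hr1
  obtain ⟨Lo, hLo⟩ : ∃ Lo, Lo = gaussMap^[n] ⁻¹' Q ∩ {x | S x < (α - δ) * τ} := ⟨_, rfl⟩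
  obtain ⟨Hi, hHi⟩ : ∃ Hi, Hi = gaussMap^[n] ⁻¹' Q ∩ {x | (α + δ) * τ < S x} := ⟨_, rfl⟩
  obtain ⟨Mi, hMi⟩ : ∃ Mi, Mi = gaussMap^[n] ⁻¹' Q ∩ {x | (α - δ) * τ ≤ S x ∧ S x ≤ (α + δ) * τ} := ⟨_, rfl⟩
  have mLo : MeasurableSet Lo := by rw [hLo]; exact hTQ.inter (measurableSet_lt hb measurable_const)
  have mHi : MeasurableSet Hi := by rw [hHi]; exact hTQ.inter (measurableSet_lt measurable_const hb)
  have mMi : MeasurableSet Mi := by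
    rw [hMi]; exact hTQ.inter ((measurableSet_le measurable_const hb).inter (measurableSet_le hb measurable_const))
  have h1 := (h (α * r) (ab α hα.le (by linarith)) n Q hQ).2
  rw [← hS] at h1
  have hcov : gaussMap^[n] ⁻¹' Q ⊆ (Lo ∪ Mi) ∪ Hi := by
    intro x hx
    rw [hLo, hMi, hHi]
    by_cases c1 : S x < (α - δ) * τ
    · exact Or.inl (Or.inl ⟨hx, c1⟩)
    by_cases c2 : (α + δ) * τ < S x
    · exact Or.inr ⟨hx, c2⟩
    · exact Or.inl (Or.inr ⟨hx, not_lt.1 c1, not_lt.1 c2⟩)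
  have iLo : ∫⁻ x in Lo, ENNReal.ofReal (exp (α * r * S x)) ∂gm ≤ ENNReal.ofReal (4 * exp ((α^2 - δ^2)*ℓ + 1)) * gm Q := by
    rw [hS]
    refine part_le h (s' := (α - δ) * r) (c := δ * (α - δ) * (r * τ)) (ℓ := ℓ) (ab _ (by linarith) (by linarith)) hQ mLo (by rw [hLo]; exact inter_subset_left) ?_ ?_
    · intro x hx
      rw [hLo] at hx
      have := hx.2
      simp only [mem_ofPred_eq] at this
      rw [hS] at this
      have := mul_le_mul_of_nonneg_left this.le (show 0 ≤ δ * r by positivity)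
      nlinarith
    · have := cub (α - δ) (by linarith) (by linarith)
      rw [e1]
      calc _ = δ * (α - δ) * (2 * ℓ) + (α - δ)^2/2 * (n * r^2 * σ2) + n * (C * |(α - δ) * r|^3) := by ring
        _ ≤ δ * (α - δ) * (2 * ℓ) + (α - δ)^2/2 * (n * r^2 * σ2) + 1 := by linarith
        _ = _ := by rw [e2]; ring
  have iHi : ∫⁻ x in Hi, ENNReal.ofReal (exp (α * r * S x)) ∂gm ≤ ENNReal.ofReal (4 * exp ((α^2 - δ^2)*ℓ + 1)) * gm Q := by
    rw [hS]
    refine part_le h (s' := (α + δ) * r) (c := -(δ * (α + δ) * (r * τ))) (ℓ := ℓ) (ab _ (by linarith) (by linarith)) hQ mHi (by rw [hHi]; exact inter_subset_left) ?_ ?_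
    · intro x hx
      rw [hHi] at hx
      have := hx.2
      simp only [mem_ofPred_eq] at this
      rw [hS] at this
      have := mul_le_mul_of_nonneg_left this.le (show 0 ≤ δ * r by positivity)
      nlinarith
    · have := cub (α + δ) (by linarith) (by linarith)
      rw [e1]
      calc _ = -(δ * (α + δ) * (2 * ℓ)) + (α + δ)^2/2 * (n * r^2 * σ2) + n * (C * |(α + δ) * r|^3) := by ring
        _ ≤ -(δ * (α + δ) * (2 * ℓ)) + (α + δ)^2/2 * (n * r^2 * σ2) + 1 := by linarith
        _ = _ := by rw [e2]; ring
  have iMi : ∫⁻ x in Mi, ENNReal.ofReal (exp (α * r * S x)) ∂gm ≤ ENNReal.ofReal (exp (2*α*(α+δ)*ℓ)) * gm Mi := by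
    calc _ ≤ ∫⁻ x in Mi, ENNReal.ofReal (exp (2*α*(α+δ)*ℓ)) ∂gm := by
          refine setLIntegral_mono' mMi fun x hx => ENNReal.ofReal_le_ofReal (Real.exp_le_exp.2 ?_)
          rw [hMi] at hx
          have := mul_le_mul_of_nonneg_left hx.2.2 (show 0 ≤ α * r by positivity)
          calc _ ≤ _ := this
            _ = α * (α + δ) * (r * τ) := by ring
            _ = _ := by rw [e1]; ring
      _ = _ := by rw [setLIntegral_const]
  have tot : ∫⁻ x in gaussMap^[n] ⁻¹' Q, ENNReal.ofReal (exp (α * r * S x)) ∂gm ≤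
      (ENNReal.ofReal (4 * exp ((α^2 - δ^2)*ℓ + 1)) * gm Q + ENNReal.ofReal (exp (2*α*(α+δ)*ℓ)) * gm Mi) +
       ENNReal.ofReal (4 * exp ((α^2 - δ^2)*ℓ + 1)) * gm Q := by
    refine (lintegral_mono_set hcov).trans ((lintegral_union_le _ _ _).trans (add_le_add ?_ iHi))
    exact (lintegral_union_le _ _ _).trans (add_le_add iLo iMi)
  have h2 : ENNReal.ofReal (exp (α^2*ℓ - 1)) * gm Q ≤ 4 * ((ENNReal.ofReal (4 * exp ((α^2 - δ^2)*ℓ + 1)) * gm Q + ENNReal.ofReal (exp (2*α*(α+δ)*ℓ)) * gm Mi) +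
       ENNReal.ofReal (4 * exp ((α^2 - δ^2)*ℓ + 1)) * gm Q) := by
    refine le_trans ?_ (h1.trans (mul_le_mul_right tot 4))
    refine mul_le_mul_left (ENNReal.ofReal_le_ofReal (Real.exp_le_exp.2 ?_)) _
    have := cub α hα.le (by linarith)
    calc α^2*ℓ - 1 = α^2/2 * (n * r^2 * σ2) - 1 := by rw [e2]; ring
      _ ≤ α^2/2 * (n * r^2 * σ2) - n * (C * |α * r|^3) := by linarith
      _ = _ := by ring
  have eQ : gm Q = ENNReal.ofReal (gm.real Q) := (ofReal_measureReal).symm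
  have eM : gm Mi = ENNReal.ofReal (gm.real Mi) := (ofReal_measureReal).symm
  rw [eQ, eM, ← ENNReal.ofReal_mul (by positivity), ← ENNReal.ofReal_mul (by positivity), ← ENNReal.ofReal_mul (by positivity),
    ← ENNReal.ofReal_add (by positivity) (by positivity), ← ENNReal.ofReal_add (by positivity) (by positivity),
    show (4:ℝ≥0∞) = ENNReal.ofReal 4 by simp, ← ENNReal.ofReal_mul (by positivity), ENNReal.ofReal_le_ofReal_iff (by positivity)] at h2
  have hmono : gm.real Mi ≤ gm.real (gaussMap^[n] ⁻¹' Q ∩ {x | (α - δ) * τ ≤ S x}) := by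
    refine measureReal_mono ?_
    rw [hMi]
    exact fun x hx => ⟨hx.1, hx.2.1⟩
  have q0 : 0 ≤ gm.real Q := measureReal_nonneg
  have x1 : exp ((α^2 - δ^2)*ℓ + 1) ≤ exp (α^2*ℓ) * (3/576) := by
    rw [show (α^2 - δ^2)*ℓ + 1 = α^2*ℓ + -(δ^2*ℓ) + 1 by ring, Real.exp_add, Real.exp_add, mul_assoc]
    have := Real.exp_one_lt_d9
    have := Real.exp_pos 1
    have := Real.exp_pos (-(δ^2*ℓ))
    gcongr
    nlinarith
  have x2 : exp (α^2*ℓ) / 3 ≤ exp (α^2*ℓ - 1) := by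
    rw [Real.exp_sub]
    have := Real.exp_one_lt_d9
    gcongr
    linarith
  have x3 : exp (2*α*(α+δ)*ℓ) = exp ((α^2 + 2*α*δ)*ℓ) * exp (α^2*ℓ) := by
    rw [← Real.exp_add]; ring_nf
  rw [x3] at h2
  have ep := Real.exp_pos (α^2*ℓ)
  have ep2 := Real.exp_pos ((α^2 + 2*α*δ)*ℓ)
  refine le_trans ?_ (mul_le_mul_of_nonneg_left hmono (by positivity))
  have y1 := mul_le_mul_of_nonneg_right x1 q0
  have y2 := mul_le_mul_of_nonneg_right x2 q0
  have : exp (α^2*ℓ) * gm.real Q ≤ exp (α^2*ℓ) * (24 * exp ((α^2 + 2*α*δ)*ℓ) * gm.real Mi) := by nlinarith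
  exact le_of_mul_le_mul_left this ep
lemma block_io (hg : Measurable g) {n : ℕ → ℕ} (hn : Monotone n) {thr p : ℕ → ℝ} {j0 : ℕ}
    (hp : ∀ j ≥ j0, ∀ Q, MeasurableSet Q → gm.real (gaussMap^[n (j+1) - n j] ⁻¹' Q ∩ {x | birkhoffSum gaussMap g (n (j+1) - n j) x < thr j}) ≤
      exp (-p j) * gm.real Q)
    (hdiv : ∀ i, Tendsto (fun d => ∑ j ∈ Finset.range d, p (i + j)) atTop atTop) :
    ∀ᵐ x ∂gm, ∃ᶠ j in atTop, thr j ≤ birkhoffSum gaussMap g (n (j+1) - n j) (gaussMap^[n j] x) := by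
  obtain ⟨A, hA⟩ : ∃ A : ℕ → ℕ → Set ℝ, A = fun i d => ⋂ j ∈ Finset.range d, {y | birkhoffSum gaussMap g (n (i+j+1) - n (i+j)) (gaussMap^[n (i+j) - n i] y) < thr (i+j)} := ⟨_, rfl⟩
  have mA : ∀ i d, MeasurableSet (A i d) := by
    intro i d; rw [hA]
    exact Finset.measurableSet_biInter _ fun j _ => measurableSet_lt ((bs_meas hg _).comp (gaussMap_meas.iterate _)) measurable_const
  have key : ∀ d i, j0 ≤ i → gm.real (A i d) ≤ exp (-∑ j ∈ Finset.range d, p (i + j)) := by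
    intro d
    induction d with
    | zero => intro i hi; simp only [Finset.range_zero, Finset.sum_empty, neg_zero, Real.exp_zero]; exact measureReal_le_one
    | succ d ih =>
      intro i hi
      have hsub : A i (d+1) ⊆ gaussMap^[n (i+1) - n i] ⁻¹' (A (i+1) d) ∩ {x | birkhoffSum gaussMap g (n (i+1) - n i) x < thr i} := by
        intro x hx
        rw [hA] at hx
        simp only [mem_iInter] at hx
        constructor
        · rw [hA]
          simp only [mem_preimage, mem_iInter]
          intro j hj
          have h1 := hx (j+1) (by have := Finset.mem_range.1 hj; exact Finset.mem_range.2 (by omega))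
          simp only [mem_ofPred_eq] at h1 ⊢
          rw [← Function.iterate_add_apply, show n (i+1+j) - n (i+1) + (n (i+1) - n i) = n (i+1+j) - n i by
            have := hn (show i ≤ i+1 by omega); have := hn (show i+1 ≤ i+1+j by omega); omega]
          rw [show i + (j+1) = i+1+j by omega] at h1
          exact h1
        · have := hx 0 (Finset.mem_range.2 (by omega))
          simpa using this
      calc _ ≤ _ := measureReal_mono hsub
        _ ≤ _ := hp i hi _ (mA _ _)
        _ ≤ exp (-p i) * exp (-∑ j ∈ Finset.range d, p (i + 1 + j)) := by gcongr; exact ih (i+1) (by omega)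
        _ = _ := by
          rw [← Real.exp_add, Finset.sum_range_succ']
          congr 1
          have e : ∀ j, p (i + (j + 1)) = p (i + 1 + j) := fun j => by rw [show i+(j+1)=i+1+j by omega]
          rw [Finset.sum_congr rfl fun j _ => e j, add_zero]
          ring
  have h0 : ∀ i ≥ j0, gm {x | ∀ j ≥ i, birkhoffSum gaussMap g (n (j+1) - n j) (gaussMap^[n j] x) < thr j} = 0 := by
    intro i hi
    have hle : ∀ d, gm.real {x | ∀ j ≥ i, birkhoffSum gaussMap g (n (j+1) - n j) (gaussMap^[n j] x) < thr j} ≤ exp (-∑ j ∈ Finset.range d, p (i + j)) := by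
      intro d
      refine le_trans ?_ (key d i hi)
      have : gm.real (A i d) = gm.real (gaussMap^[n i] ⁻¹' A i d) := by
        simp only [Measure.real, (gauss_mp.iterate (n i)).measure_preimage (mA i d).nullMeasurableSet]
      rw [this]
      refine measureReal_mono fun x hx => ?_
      rw [hA]
      simp only [mem_preimage, mem_iInter]
      intro j _
      have := hx (i+j) (by omega)
      simp only [mem_ofPred_eq]
      rwa [← Function.iterate_add_apply, show n (i+j) - n i + n i = n (i+j) by have := hn (show i ≤ i+j by omega); omega]
    have hlim : Tendsto (fun d => exp (-∑ j ∈ Finset.range d, p (i + j))) atTop (𝓝 0) :=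
      Real.tendsto_exp_neg_atTop_nhds_zero.comp (hdiv i)
    have := ge_of_tendsto' hlim hle
    have h3 : gm.real {x | ∀ j ≥ i, birkhoffSum gaussMap g (n (j+1) - n j) (gaussMap^[n j] x) < thr j} = 0 := le_antisymm this measureReal_nonneg
    rwa [measureReal_eq_zero_iff] at h3
  have h1 : ∀ᵐ x ∂gm, ∀ i, j0 ≤ i → ¬ ∀ j ≥ i, birkhoffSum gaussMap g (n (j+1) - n j) (gaussMap^[n j] x) < thr j := by
    rw [ae_all_iff]
    intro i
    by_cases hi : j0 ≤ i
    · have := h0 i hi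
      rw [measure_eq_zero_iff_ae_notMem] at this
      filter_upwards [this] with x hx _ using hx
    · filter_upwards with x h using absurd h hi
  filter_upwards [h1] with x hx
  rw [frequently_atTop]
  intro a
  have := hx (max a j0) (le_max_right _ _)
  push Not at this
  obtain ⟨j, hj, h⟩ := this
  exact ⟨j, (le_max_left _ _).trans hj, h⟩
end
end
end KN
namespace KN
open MeasureTheory Filter Set
open scoped Topology ENNReal
open Real (log exp sqrt)
noncomputable section
variable {g : ℝ → ℝ} {σ2 C s0 : ℝ}
lemma block_est (hg : Measurable g) (h : MgfBd g σ2 C s0) (hC : 0 ≤ C) (hσ : 0 < σ2) (hs : 0 < s0) {ε : ℝ} (hε : 0 < ε) (hε2 : ε < 1/2)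
    {b : ℕ} (hb : 2 ≤ b) :
    ∀ᶠ j : ℕ in atTop, ∀ Q, MeasurableSet Q → gm.real (gaussMap^[b^(j+1) - b^j] ⁻¹' Q ∩ {x | birkhoffSum gaussMap g (b^(j+1) - b^j) x <
      (1 - 3/2*ε) * (√σ2 * √(2 * (b^(j+1) - b^j : ℕ) * log j))}) ≤ exp (-(1/(24*(j:ℝ)))) * gm.real Q := by
  have hb1 : (1:ℝ) < b := by exact_mod_cast (by omega : 1 < b)
  have l1 := (small_lim hb1 1).const_mul (√(2/σ2))
  have l3 := (small_lim hb1 3).const_mul (C * (2/σ2) * √(2/σ2))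
  rw [mul_zero] at l1 l3
  have ll : Tendsto (fun j : ℕ => log (j:ℝ)) atTop atTop := Real.tendsto_log_atTop.comp tendsto_natCast_atTop_atTop
  have le : Tendsto (fun j : ℕ => exp (-((ε/2)^2 * log (j:ℝ)))) atTop (𝓝 0) :=
    Real.tendsto_exp_neg_atTop_nhds_zero.comp (ll.const_mul_atTop (by positivity))
  filter_upwards [l1.eventually_lt_const hs, l3.eventually_lt_const one_pos, le.eventually_lt_const (show (0:ℝ) < 1/576 by norm_num), eventually_ge_atTop 1]
    with j a1 a3 ae hj Q hQ
  have hj0 : (1:ℝ) ≤ j := by exact_mod_cast hj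
  obtain ⟨ℓ, hℓ⟩ : ∃ ℓ, ℓ = log (j:ℝ) := ⟨_, rfl⟩
  have hℓ0 : 0 ≤ ℓ := by rw [hℓ]; exact Real.log_nonneg hj0
  have hℓj : ℓ ≤ j := by rw [hℓ]; have := Real.log_le_sub_one_of_pos (show (0:ℝ) < j by linarith); linarith
  obtain ⟨N, hN⟩ : ∃ N, N = b^(j+1) - b^j := ⟨_, rfl⟩
  have hNb : b^j ≤ N := by
    rw [hN, pow_succ]; have : b^j*2 ≤ b^j*b := Nat.mul_le_mul_left _ hb
    omega
  have hNr : ((b:ℝ)^j) ≤ N := by exact_mod_cast hNb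
  have hbj : (0:ℝ) < (b:ℝ)^j := by positivity
  have hN0 : (0:ℝ) < N := by linarith
  rw [← hN, ← hℓ]
  obtain ⟨r, hr⟩ : ∃ r, r = √(2*ℓ/(N*σ2)) := ⟨_, rfl⟩
  have hr0 : 0 ≤ r := by rw [hr]; positivity
  have hr2 : r^2 = 2*ℓ/(N*σ2) := by rw [hr]; exact Real.sq_sqrt (by positivity)
  have hrle : r ≤ √(2/σ2) * (√(j:ℝ)/√((b:ℝ)^j)) := by
    rw [hr, ← Real.sqrt_div (by positivity), ← Real.sqrt_mul (by positivity)]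
    apply Real.sqrt_le_sqrt
    rw [div_mul_div_comm, mul_comm (N:ℝ)]
    gcongr
  have e2 : N * r^2 * σ2 = 2*ℓ := by rw [hr2]; field_simp
  have e1 : r * (√σ2 * √(2*N*ℓ)) = 2*ℓ := by
    rw [hr, ← Real.sqrt_mul (by positivity), ← Real.sqrt_mul (by positivity), Real.sqrt_eq_iff_mul_self_eq (by positivity) (by positivity)]
    field_simp
  have hsj : √(j:ℝ)^2 = j := Real.sq_sqrt (by positivity)
  have t := tilt (n := N) hg h hC (α := 1 - ε) (δ := ε/2) (r := r) (ℓ := ℓ) (τ := √σ2 * √(2*N*ℓ)) (by linarith) (by linarith) (by linarith) hr0 e1 e2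
    (by
      have : √(2/σ2) * (√(j:ℝ)^1/√((b:ℝ)^j)) < s0 := a1
      rw [pow_one] at this
      exact (mul_le_of_le_one_left hr0 (by linarith)).trans (hrle.trans this.le))
    (by
      have hq : (1 - ε + ε/2) * r ≤ r := mul_le_of_le_one_left hr0 (by linarith)
      have hq0 : 0 ≤ (1 - ε + ε/2) * r := mul_nonneg (by linarith) hr0
      have hx : N * (C * ((1 - ε + ε/2) * r)^3) ≤ N * (C * r^3) := by gcongr
      have hy : N * (C * r^3) = C * (2/σ2) * (ℓ * r) := by
        have : r^3 = r^2*r := by ring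
        rw [this, hr2]; field_simp
      refine hx.trans (hy.le.trans (le_trans ?_ a3.le))
      rw [mul_assoc (C * (2/σ2))]
      refine mul_le_mul_of_nonneg_left ?_ (by positivity)
      calc ℓ * r ≤ j * (√(2/σ2) * (√(j:ℝ)/√((b:ℝ)^j))) := by gcongr
        _ = √(j:ℝ)^2 * (√(2/σ2) * (√(j:ℝ)/√((b:ℝ)^j))) := by rw [hsj]
        _ = _ := by ring)
    (by rw [hℓ]; exact ae.le) hQ
  rw [show 1 - ε - ε/2 = 1 - 3/2*ε by ring] at t
  obtain ⟨thr, hthr⟩ : ∃ thr, thr = (1 - 3/2*ε) * (√σ2 * √(2*N*ℓ)) := ⟨_, rfl⟩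
  rw [← hthr] at t ⊢
  have hex : exp (((1-ε)^2 + 2*(1-ε)*(ε/2))*ℓ) ≤ j := by
    calc _ ≤ exp ℓ := Real.exp_le_exp.2 (mul_le_of_le_one_left hℓ0 (by nlinarith only [hε, hε2]))
      _ = j := by rw [hℓ, Real.exp_log (by linarith)]
  have hm : MeasurableSet {x | thr ≤ birkhoffSum gaussMap g N x} := measurableSet_le measurable_const (bs_meas hg N)
  have hpre : gm.real (gaussMap^[N] ⁻¹' Q) = gm.real Q := by
    simp only [Measure.real, (gauss_mp.iterate N).measure_preimage hQ.nullMeasurableSet]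
  have hsp := measureReal_inter_add_sdiff (μ := gm) (s := gaussMap^[N] ⁻¹' Q) hm
  have hd : gaussMap^[N] ⁻¹' Q \ {x | thr ≤ birkhoffSum gaussMap g N x} = gaussMap^[N] ⁻¹' Q ∩ {x | birkhoffSum gaussMap g N x < thr} := by
    ext x; simp
  rw [hd, hpre] at hsp
  obtain ⟨Z, hZ⟩ : ∃ Z, Z = gm.real (gaussMap^[N] ⁻¹' Q ∩ {x | thr ≤ birkhoffSum gaussMap g N x}) := ⟨_, rfl⟩
  rw [← hZ] at t hsp
  have hZ0 : 0 ≤ Z := by rw [hZ]; exact measureReal_nonneg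
  have t2 : gm.real Q ≤ 24 * j * Z := t.trans (by gcongr)
  have t3 : 1/(24*(j:ℝ)) * gm.real Q ≤ Z := by
    rw [div_mul_eq_mul_div, one_mul, div_le_iff₀ (by positivity)]; linarith
  have t4 := Real.add_one_le_exp (-(1/(24*(j:ℝ))))
  have t5 : 0 ≤ gm.real Q := measureReal_nonneg
  have t6 := mul_le_mul_of_nonneg_right t4 t5
  linarith only [t6, t3, hsp]
lemma low_calc {ε s b j B X Y : ℝ} (hε : 0 < ε) (hε2 : ε < 1/2) (hs : 0 < s) (hbε : 1 ≤ ε^2 * b) (hb3 : 3 ≤ b) (hlb : 1 ≤ log b) (hj1 : 1 ≤ j)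
    (hbj : 0 < B) (hl : log (2 * log b) ≤ log j * ε)
    (h1 : (1 - 3/2*ε) * (s * √(2 * (B*b - B) * log j)) ≤ Y)
    (h2 : -X ≤ (1+1) * (s * √(2 * B * log (j * log b)))) :
    (1 - 5*ε) * (s * √(2 * (B*b) * log ((j+1) * log b))) ≤ X + Y := by
  obtain ⟨L, hL⟩ : ∃ L, L = log (j * log b) := ⟨_, rfl⟩
  obtain ⟨L1, hL1⟩ : ∃ L, L = log ((j+1) * log b) := ⟨_, rfl⟩
  rw [← hL] at h2
  rw [← hL1]
  have hL0 : 0 ≤ L := by rw [hL]; exact Real.log_nonneg (one_le_mul_of_one_le_of_one_le hj1 hlb)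
  have hLL : L ≤ L1 := by rw [hL, hL1]; exact Real.log_le_log (by positivity) (by gcongr; linarith)
  have hL10 := hL0.trans hLL
  have hlog : (1-ε) * L1 ≤ log j := by
    have h3 : L1 ≤ log (2 * log b) + log j := by
      rw [hL1, ← Real.log_mul (by positivity) (by positivity)]
      refine Real.log_le_log (by positivity) ?_
      rw [mul_assoc, mul_comm (log b), ← mul_assoc]
      gcongr
      linarith
    have h0 : 0 ≤ log (2 * log b) := Real.log_nonneg (by linarith)
    clear h1 h2 hbε hb3 hL hL1 hLL
    nlinarith
  obtain ⟨Z, hZ⟩ : ∃ Y, Y = √(2 * (B*b) * L1) := ⟨_, rfl⟩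
  have hZ0 : 0 ≤ Z := by rw [hZ]; positivity
  have hZ2 : Z^2 = 2 * (B*b) * L1 := by rw [hZ]; exact Real.sq_sqrt (by positivity)
  rw [← hZ]
  have hA : √(2 * B * L) ≤ ε * Z := by
    rw [Real.sqrt_le_left (by positivity), mul_pow, hZ2]
    have h1 : L ≤ ε^2 * b * L1 := hLL.trans (le_mul_of_one_le_left hL10 hbε)
    calc 2 * B * L ≤ 2 * B * (ε^2 * b * L1) := by gcongr
      _ = _ := by ring
  have hB : (1-ε) * Z ≤ √(2 * (B*b - B) * log j) := by
    apply Real.le_sqrt_of_sq_le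
    rw [mul_pow, hZ2]
    have h1 : (1-ε) * b ≤ b - 1 := by nlinarith only [hε, hε2, hbε, hb3]
    calc (1-ε)^2 * (2 * (B*b) * L1) = 2 * B * (((1-ε)*b) * ((1-ε)*L1)) := by ring
      _ ≤ 2 * B * ((b-1) * log j) := by
        refine mul_le_mul_of_nonneg_left (mul_le_mul h1 hlog (mul_nonneg (by linarith) hL10) (by linarith)) (by positivity)
      _ = _ := by ring
  have c1 : (1 - 3/2*ε) * (s * ((1-ε)*Z)) ≤ (1 - 3/2*ε) * (s * √(2 * (B*b - B) * log j)) :=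
    mul_le_mul_of_nonneg_left (mul_le_mul_of_nonneg_left hB hs.le) (by linarith)
  have c2 : s * √(2 * B * L) ≤ s * (ε*Z) := by gcongr
  have c4 : 0 ≤ ε^2 * (s * Z) := by positivity
  have c5 : 0 ≤ ε * (s * Z) := by positivity
  linarith only [c1, c2, c4, c5, h1, h2]
lemma lower (hg : Measurable g) (h : MgfBd g σ2 C s0) (hC : 0 ≤ C) (hσ : 0 < σ2) (hs : 0 < s0) {ε : ℝ} (hε : 0 < ε) (hε2 : ε < 1/2) :
    ∀ᵐ x ∂gm, ∃ᶠ n : ℕ in atTop, (1 - 5*ε) * (√σ2 * √(2 * n * log (log n))) ≤ birkhoffSum gaussMap g n x := by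
  obtain ⟨b0, hb0⟩ := exists_nat_gt (1/ε^2)
  obtain ⟨b, hb⟩ : ∃ b, b = b0 + 3 := ⟨_, rfl⟩
  have hbr : (b:ℝ) = b0 + 3 := by rw [hb]; push_cast; rfl
  have hbε : 1 ≤ ε^2 * b := by
    rw [div_lt_iff₀ (by positivity)] at hb0
    rw [hbr]; nlinarith [sq_nonneg ε]
  have hb3 : (3:ℝ) ≤ b := by rw [hbr]; have : (0:ℝ) ≤ b0 := by positivity
                             linarith
  obtain ⟨j0, hj0⟩ := eventually_atTop.1 (block_est hg h hC hσ hs hε hε2 (show 2 ≤ b by omega))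
  have hmono : Monotone (fun j => b^j) := fun i j hij => Nat.pow_le_pow_right (by omega) hij
  have hio := block_io (n := fun j => b^j) (p := fun j => 1/(24*(j:ℝ))) hg hmono hj0 (by
    intro i
    have h0 : ¬ Summable (fun j : ℕ => 1/(24*((i+j:ℕ):ℝ))) := by
      have e : (fun j : ℕ => 1/(24*((i+j:ℕ):ℝ))) = fun j : ℕ => (1/24) * ((j+i:ℕ):ℝ)⁻¹ := by
        funext j; rw [add_comm]; simp only [one_div, mul_inv]
      rw [e, summable_mul_left_iff (by norm_num), summable_nat_add_iff (f := fun j : ℕ => ((j:ℝ))⁻¹) i]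
      exact Real.not_summable_natCast_inv
    exact (not_summable_iff_tendsto_nat_atTop_of_nonneg (fun j => by positivity)).1 h0)
  have hup := upper (g := fun x => - g x) hg.neg h.neg hC hσ hs (ε := 1) one_pos
  have ht : Tendsto (fun j => b^j) atTop atTop := tendsto_pow_atTop_atTop_of_one_lt (by omega)
  have ll : Tendsto (fun j : ℕ => log (j:ℝ)) atTop atTop := Real.tendsto_log_atTop.comp tendsto_natCast_atTop_atTop
  have hlb : 1 ≤ log b := by
    rw [Real.le_log_iff_exp_le (by linarith)]
    linarith [Real.exp_one_lt_d9]
  filter_upwards [hio, hup] with x hx hu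
  have hu2 := ht.eventually hu
  have key := (hx.and_eventually (hu2.and ((eventually_ge_atTop 1).and (ll.eventually_ge_atTop (log (2*log b)/ε)))))
  have ht1 : Tendsto (fun j => b^(j+1)) atTop atTop := ht.comp (tendsto_add_atTop_nat 1)
  refine ht1.frequently (key.mono ?_)
  rintro j ⟨h1, h2, hj, hl⟩
  have hj1 : (1:ℝ) ≤ j := by exact_mod_cast hj
  have hbj : (0:ℝ) < (b:ℝ)^j := by positivity
  have eN : ((b^(j+1) - b^j : ℕ) : ℝ) = b^(j+1) - b^j := by
    rw [Nat.cast_sub (hmono (Nat.le_succ j))]; push_cast; rfl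
  have hS : birkhoffSum gaussMap g (b^(j+1)) x = birkhoffSum gaussMap g (b^j) x + birkhoffSum gaussMap g (b^(j+1) - b^j) (gaussMap^[b^j] x) := by
    rw [← birkhoffSum_add, Nat.add_sub_cancel' (hmono (Nat.le_succ j))]
  rw [bs_neg] at h2
  rw [hS]
  have eL : log (log ((b^j : ℕ):ℝ)) = log (j * log b) := by push_cast; rw [Real.log_pow]
  have eL1 : log (log ((b^(j+1) : ℕ):ℝ)) = log ((j+1) * log b) := by push_cast; rw [Real.log_pow]; push_cast; rfl
  rw [eL] at h2
  rw [eL1]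
  rw [eN] at h1
  push_cast at h1 h2 ⊢
  rw [pow_succ] at h1 ⊢
  rw [div_le_iff₀ hε] at hl
  exact low_calc hε hε2 (by positivity) hbε hb3 hlb hj1 hbj hl h1 h2
end
end KN
namespace KN
open MeasureTheory Filter Set
open scoped Topology ENNReal
open Real (log exp sqrt)
noncomputable section
def RR (m : ℕ) (x : ℝ) : ℝ := birkhoffSum gaussMap (fun x => - log x) m x
def Good (x : ℝ) : Prop := ∀ m : ℕ, gaussMap^[m] x ∈ Ioo (0:ℝ) 1
def phi (n : ℕ) : ℝ := √(2 * n * log (log n))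
lemma gg_sum (u : ℝ → ℝ) (m : ℕ) (x : ℝ) : birkhoffSum gaussMap (gg u) m x = RR m x - lam * m + u x - u (gaussMap^[m] x) := by
  induction m with
  | zero => simp [RR]
  | succ m ih =>
    unfold RR at ih ⊢
    rw [birkhoffSum_succ, birkhoffSum_succ, ih, gg, ← Function.iterate_succ_apply' gaussMap m x]
    push_cast; ring
lemma good_ae : ∀ᵐ x ∂(volume.restrict (Ioo (0:ℝ) 1)), Good x := by
  refine vol_ac.ae_le (ae_all_iff.2 fun m => ?_)
  exact (gauss_mp.iterate m).quasiMeasurePreserving.ae gm_ae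
lemma pkg : ∃ (W : ℕ → ℝ → ℝ) (s B : ℝ), 0 < s ∧ 0 ≤ B ∧ (∀ m x, Good x → |RR m x - lam * m - W m x| ≤ B) ∧
    (∀ (y : ℝ) (m : ℕ → ℕ) (c : ℕ → ℝ), Tendsto m atTop atTop → Tendsto (fun n => c n / (s * √(m n))) atTop (𝓝 y) →
      Tendsto (fun n : ℕ => volume.real ({x | - W (m n) x < c n} ∩ Ioo (0:ℝ) 1)) atTop (𝓝 (Phi y))) ∧
    (∀ᵐ x ∂(volume.restrict (Ioo (0:ℝ) 1)), ∀ ε > 0, (∀ᶠ m in atTop, |W m x| ≤ (1+ε) * (s * phi m)) ∧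
      (∃ᶠ m in atTop, (1-ε) * (s * phi m) ≤ W m x) ∧ (∃ᶠ m in atTop, W m x ≤ -((1-ε) * (s * phi m)))) := by
  obtain ⟨u, K, hK, hu, hKu, h1⟩ := exists_u
  obtain ⟨v, σ2, K', hσ, hK', hv, hKv, h2⟩ := exists_v hK hKu
  obtain ⟨B, hBe⟩ : ∃ B, B = max (|u (1/2)| + K) (|v (1/2)| + K') := ⟨_, rfl⟩
  have hB : ∀ x ∈ Ioo (0:ℝ) 1, |u x| ≤ B := fun x hx => (hKu.bdd hK hx).trans (by rw [hBe]; exact le_max_left _ _)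
  have hBv : ∀ x ∈ Ioo (0:ℝ) 1, |v x| ≤ B := fun x hx => (hKv.bdd hK' hx).trans (by rw [hBe]; exact le_max_right _ _)
  have hB0 : 0 ≤ B := (abs_nonneg _).trans (hB (1/2) (by norm_num))
  obtain ⟨C, s0, hC, hs0, hM⟩ := mgf hu hv hB0 hσ hB hBv h1 h2
  have hg := gg_meas hu
  refine ⟨fun m => birkhoffSum gaussMap (gg u) m, √σ2, 2*B, by positivity, by positivity, ?_, ?_, ?_⟩
  · intro m x hx
    have a := abs_le.1 (hB _ (hx 0))
    have b := abs_le.1 (hB _ (hx m))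
    beta_reduce
    rw [gg_sum, abs_le]
    simp only [Function.iterate_zero, id] at a
    constructor <;> linarith [a.1, a.2, b.1, b.2]
  · intro y m c hm hc
    exact clt_moving hu hv hB0 hσ hB hBv h1 h2 y hm hc
  have hup : ∀ᵐ x ∂gm, ∀ k : ℕ, ∀ᶠ n : ℕ in atTop, birkhoffSum gaussMap (gg u) n x ≤ (1 + 1/(k+3:ℝ)) * (√σ2 * phi n) :=
    ae_all_iff.2 fun k => upper hg hM hC hσ hs0 (by positivity)
  have hun : ∀ᵐ x ∂gm, ∀ k : ℕ, ∀ᶠ n : ℕ in atTop, birkhoffSum gaussMap (fun x => - gg u x) n x ≤ (1 + 1/(k+3:ℝ)) * (√σ2 * phi n) :=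
    ae_all_iff.2 fun k => upper hg.neg hM.neg hC hσ hs0 (by positivity)
  have h3 : ∀ k : ℕ, 1/(k+3:ℝ) < 1/2 := fun k => by
    apply one_div_lt_one_div_of_lt (by norm_num)
    have : (0:ℝ) ≤ k := by positivity
    linarith
  have hlp : ∀ᵐ x ∂gm, ∀ k : ℕ, ∃ᶠ n : ℕ in atTop, (1 - 5*(1/(k+3:ℝ))) * (√σ2 * phi n) ≤ birkhoffSum gaussMap (gg u) n x :=
    ae_all_iff.2 fun k => lower hg hM hC hσ hs0 (by positivity) (h3 k)
  have hln : ∀ᵐ x ∂gm, ∀ k : ℕ, ∃ᶠ n : ℕ in atTop, (1 - 5*(1/(k+3:ℝ))) * (√σ2 * phi n) ≤ birkhoffSum gaussMap (fun x => - gg u x) n x :=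
    ae_all_iff.2 fun k => lower hg.neg hM.neg hC hσ hs0 (by positivity) (h3 k)
  refine vol_ac.ae_le ?_
  filter_upwards [hup, hun, hlp, hln] with x a1 a2 a3 a4 ε hε
  obtain ⟨k, hk⟩ := exists_nat_gt (5/ε)
  have hkε : 5*(1/(k+3:ℝ)) ≤ ε := by
    rw [div_lt_iff₀ hε] at hk
    rw [mul_one_div, div_le_iff₀ (by positivity)]; nlinarith
  have hk0 : 0 < 1/(k+3:ℝ) := by positivity
  have hp : ∀ n, 0 ≤ √σ2 * phi n := fun n => by unfold phi; positivity
  refine ⟨?_, ?_, ?_⟩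
  · filter_upwards [a1 k, a2 k] with n b1 b2
    rw [bs_neg] at b2
    have := hp n
    rw [abs_le]; constructor <;> nlinarith
  · exact (a3 k).mono fun n b => by have := hp n; nlinarith
  · refine (a4 k).mono fun n b => ?_
    rw [bs_neg] at b; have := hp n; nlinarith
end
end KN
namespace KN
open MeasureTheory Filter Set
open scoped Topology ENNReal
open Real (log exp sqrt)
noncomputable section
variable {β : ℝ}
lemma betaT_meas : Measurable (betaT β) := by
  unfold betaT; fun_prop
lemma bT_mem (x : ℝ) : betaT β x ∈ Ico (0:ℝ) 1 := ⟨Int.fract_nonneg (β * x), Int.fract_lt_one (β * x)⟩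
lemma bTn_mem {x : ℝ} (hx : x ∈ Ico (0:ℝ) 1) (n : ℕ) : (betaT β)^[n] x ∈ Ico (0:ℝ) 1 := by
  cases n with
  | zero => exact hx
  | succ n => rw [Function.iterate_succ_apply']; exact bT_mem _
lemma cyl_diff {n : ℕ} {x y : ℝ} (hy : y ∈ betaCyl β n x) : (betaT β)^[n] y - (betaT β)^[n] x = β^n * (y - x) := by
  have key : ∀ k ≤ n, (betaT β)^[k] y - (betaT β)^[k] x = β^k * (y - x) := by
    intro k
    induction k with
    | zero => simp
    | succ k ih =>
      intro hk
      have h1 := ih (by omega)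
      have h2 := hy.2 (k+1) (by omega) hk
      simp only [betaEps, Nat.add_sub_cancel] at h2
      rw [Function.iterate_succ_apply', Function.iterate_succ_apply', betaT, betaT, h2, pow_succ]
      linear_combination β * h1
  exact key n le_rfl
lemma cyl_dist (hβ : 1 < β) {n : ℕ} {x y : ℝ} (hx : x ∈ Ico (0:ℝ) 1) (hy : y ∈ betaCyl β n x) : β^n * |x - y| < 1 := by
  have h := cyl_diff hy
  have h1 := bTn_mem (β := β) hx n
  have h2 := bTn_mem (β := β) hy.1 n
  have hb : 0 < β^n := by positivity
  rw [abs_sub_comm, ← abs_of_pos hb, ← abs_mul, ← h, abs_lt]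
  constructor <;> linarith [h1.1, h1.2, h2.1, h2.2]
lemma cyl_back (hβ : 1 < β) {x y : ℝ} (hx : x ∈ Ico (0:ℝ) 1) (hyx : y ≤ x) (n : ℕ) (h : β^n * (x - y) ≤ (betaT β)^[n] x) :
    y ∈ betaCyl β n x := by
  induction n with
  | zero =>
    simp only [pow_zero, one_mul, Function.iterate_zero, id] at h
    exact ⟨⟨by linarith, by linarith [hx.2]⟩, fun i h1 h2 => by omega⟩
  | succ n ih =>
    have e := Function.iterate_succ_apply' (betaT β) n x
    rw [e, betaT] at h
    have h0 := bTn_mem (β := β) hx n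
    have hfl : (0:ℝ) ≤ ⌊β * (betaT β)^[n] x⌋ := by exact_mod_cast Int.floor_nonneg.2 (mul_nonneg (by linarith) h0.1)
    have hc : β^n * (x-y) ≤ (betaT β)^[n] x := by
      rw [pow_succ] at h
      nlinarith only [h, hfl, hβ]
    have hy := ih hc
    refine ⟨hy.1, fun i h1 h2 => ?_⟩
    rcases Nat.lt_or_ge i (n+1) with h3 | h3
    · exact hy.2 i h1 (by omega)
    obtain rfl : i = n+1 := by omega
    simp only [betaEps, Nat.add_sub_cancel]
    have hd := cyl_diff hy
    have hy2 : β * (betaT β)^[n] y = β * (betaT β)^[n] x - β^(n+1) * (x-y) := by rw [pow_succ]; linear_combination β * hd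
    rw [Int.floor_eq_iff, hy2]
    have := Int.lt_floor_add_one (β * (betaT β)^[n] x)
    have hp : 0 ≤ β^(n+1) * (x-y) := mul_nonneg (by positivity) (by linarith)
    constructor <;> linarith
lemma beta_B (hβ : 1 < β) (n : ℕ) {δ : ℝ} (hδ : 0 < δ) (hδ1 : δ ≤ 1) :
    volume {x ∈ Ico (0:ℝ) 1 | (betaT β)^[n+1] x < δ ∧ 1 ≤ β * (betaT β)^[n] x} ≤ ENNReal.ofReal (2*δ) := by
  obtain ⟨Bs, hBs⟩ : ∃ Bs, Bs = {x ∈ Ico (0:ℝ) 1 | (betaT β)^[n+1] x < δ ∧ 1 ≤ β * (betaT β)^[n] x} := ⟨_, rfl⟩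
  rw [← hBs]
  have mB : MeasurableSet Bs := by
    rw [hBs]
    have m1 := (betaT_meas (β := β)).iterate (n+1)
    have m2 := (betaT_meas (β := β)).iterate n
    exact measurableSet_Ico.inter ((measurableSet_lt m1 measurable_const).inter (measurableSet_le measurable_const (m2.const_mul β)))
  obtain ⟨M, hM⟩ : ∃ M, M = ⌊1/δ⌋₊ := ⟨_, rfl⟩
  have hM1 : 1 ≤ M := by rw [hM, Nat.one_le_floor_iff, le_div_iff₀ hδ]; linarith
  have hMδ : M * δ ≤ 1 := by rw [← le_div_iff₀ hδ, hM]; exact Nat.floor_le (by positivity)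
  have hM2 : 1 ≤ 2 * δ * M := by
    have h1 := Nat.lt_floor_add_one (1/δ)
    rw [← hM, div_lt_iff₀ hδ] at h1
    have h2 : (1:ℝ) ≤ M := by exact_mod_cast hM1
    nlinarith
  obtain ⟨d, hd⟩ : ∃ d, d = δ / β^(n+1) := ⟨_, rfl⟩
  have hb : 0 < β^(n+1) := by positivity
  have hd0 : 0 < d := by rw [hd]; positivity
  have hbd : β^(n+1) * d = δ := by rw [hd]; field_simp
  have back : ∀ x ∈ Bs, ∀ k : ℕ, k ≤ M → x - k*d ∈ betaCyl β n x := by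
    intro x hx k hk
    rw [hBs] at hx
    have hk' : (k:ℝ) ≤ M := by exact_mod_cast hk
    refine cyl_back hβ hx.1 (by have : 0 ≤ k*d := by positivity
                                linarith) n ?_
    have h1 : β * (β^n * (x - (x - k*d))) ≤ β * (betaT β)^[n] x := by
      calc β * (β^n * (x - (x - k*d))) = k * (β^(n+1)*d) := by rw [pow_succ]; ring
        _ = k * δ := by rw [hbd]
        _ ≤ M * δ := by gcongr
        _ ≤ _ := hMδ.trans hx.2.2
    exact le_of_mul_le_mul_left h1 (by linarith)
  have nodup : ∀ x ∈ Bs, ∀ x' ∈ Bs, ∀ k : ℕ, 1 ≤ k → k + 1 ≤ M → x' - k*d ≠ x := by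
    intro x hx x' hx' k hk1 hkM he
    have h1 := cyl_diff (back x' hx' k (by omega))
    rw [he] at h1
    rw [hBs] at hx hx'
    have a1 := hx.2.1
    have a2 := hx'.2.1
    have a3 := (bTn_mem (β := β) hx.1 (n+1)).1
    have a4 := (bTn_mem (β := β) hx'.1 (n+1)).1
    rw [Function.iterate_succ_apply', betaT] at a1 a2 a3 a4
    have h2 : β * (betaT β)^[n] x' - β * (betaT β)^[n] x = k * δ := by
      rw [← hbd, pow_succ]; linear_combination (-β) * h1 + β^n * β * he
    have hkM' : ((k:ℝ) + 1) * δ ≤ 1 := by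
      have : ((k:ℝ)+1) ≤ M := by exact_mod_cast hkM
      nlinarith
    have hk1' : (1:ℝ) ≤ k := by exact_mod_cast hk1
    have h3 : ((⌊β * (betaT β)^[n] x'⌋ - ⌊β * (betaT β)^[n] x⌋ : ℤ) : ℝ) < 1 := by push_cast; nlinarith
    have h4 : (0:ℝ) < ((⌊β * (betaT β)^[n] x'⌋ - ⌊β * (betaT β)^[n] x⌋ : ℤ) : ℝ) := by push_cast; nlinarith
    have h5 : ⌊β * (betaT β)^[n] x'⌋ - ⌊β * (betaT β)^[n] x⌋ < 1 := by exact_mod_cast h3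
    have h6 : 0 < ⌊β * (betaT β)^[n] x'⌋ - ⌊β * (betaT β)^[n] x⌋ := by exact_mod_cast h4
    omega
  have hdisj : ∀ i j : ℕ, i < j → j < M → Disjoint ((fun z => z + i*d) ⁻¹' Bs) ((fun z => z + j*d) ⁻¹' Bs) := by
    intro i j hij hj
    rw [Set.disjoint_left]
    intro z h1 h2
    refine nodup _ h1 _ h2 (j - i) (by omega) (by omega) ?_
    rw [Nat.cast_sub hij.le]; ring
  have hsum : volume (⋃ j ∈ Finset.range M, (fun z => z + j*d) ⁻¹' Bs) = M * volume Bs := by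
    rw [measure_biUnion_finset]
    · simp [measure_preimage_add_right]
    · intro i hi j hj hij
      have hi' := Finset.mem_range.1 hi
      have hj' := Finset.mem_range.1 hj
      rcases lt_or_gt_of_ne hij with h | h
      · exact hdisj i j h hj'
      · exact (hdisj j i h hi').symm
    · intro i _
      exact (measurable_add_const _) mB
  have hsub : (⋃ j ∈ Finset.range M, (fun z => z + j*d) ⁻¹' Bs) ⊆ Ico (0:ℝ) 1 := by
    intro z hz
    simp only [mem_iUnion, mem_preimage] at hz
    obtain ⟨j, hj, hz⟩ := hz
    have := (back _ hz j (Finset.mem_range.1 hj).le).1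
    rwa [add_sub_cancel_right] at this
  have h1 : M * volume Bs ≤ 1 := by
    rw [← hsum]; refine (measure_mono hsub).trans ?_; simp
  calc volume Bs ≤ ENNReal.ofReal (2*δ*M) * volume Bs := by
        refine le_mul_of_one_le_left zero_le ?_
        rw [← ENNReal.ofReal_one]; exact ENNReal.ofReal_le_ofReal hM2
    _ = ENNReal.ofReal (2*δ) * (M * volume Bs) := by
        rw [ENNReal.ofReal_mul (by positivity), ENNReal.ofReal_natCast, mul_assoc]
    _ ≤ ENNReal.ofReal (2*δ) * 1 := by gcongr
    _ = _ := mul_one _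
lemma beta_small (hβ : 1 < β) (n : ℕ) : ∀ {δ : ℝ}, 0 < δ → δ ≤ 1 →
    volume {x ∈ Ico (0:ℝ) 1 | (betaT β)^[n] x < δ} ≤ ENNReal.ofReal (2*β/(β-1)*δ) := by
  have hb : 0 < β - 1 := by linarith
  induction n with
  | zero =>
    intro δ h0 h1
    refine (measure_mono (t := Ico 0 δ) fun x hx => ⟨hx.1.1, hx.2⟩).trans ?_
    rw [Real.volume_Ico, sub_zero]
    refine ENNReal.ofReal_le_ofReal (le_mul_of_one_le_left h0.le ?_)
    rw [le_div_iff₀ hb]; linarith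
  | succ n ih =>
    intro δ h0 h1
    have hsub : {x ∈ Ico (0:ℝ) 1 | (betaT β)^[n+1] x < δ} ⊆ {x ∈ Ico (0:ℝ) 1 | (betaT β)^[n] x < δ/β} ∪
        {x ∈ Ico (0:ℝ) 1 | (betaT β)^[n+1] x < δ ∧ 1 ≤ β * (betaT β)^[n] x} := by
      intro x hx
      by_cases h : 1 ≤ β * (betaT β)^[n] x
      · exact Or.inr ⟨hx.1, hx.2, h⟩
      · refine Or.inl ⟨hx.1, ?_⟩
        have h2 := hx.2
        rw [Function.iterate_succ_apply', betaT] at h2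
        have h3 := (bTn_mem (β := β) hx.1 n).1
        rw [Int.floor_eq_zero_iff.2 ⟨mul_nonneg (by linarith) h3, not_le.1 h⟩] at h2
        rw [lt_div_iff₀ (by linarith)]
        simp only [Int.cast_zero, sub_zero] at h2
        linarith
    refine (measure_mono hsub).trans ((measure_union_le _ _).trans ?_)
    refine (add_le_add (ih (δ := δ/β) (by positivity) ((div_le_self h0.le hβ.le).trans h1)) (beta_B hβ n h0 h1)).trans ?_
    rw [← ENNReal.ofReal_add (by positivity) (by positivity)]
    apply ENNReal.ofReal_le_ofReal
    apply le_of_eq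
    field_simp
    ring
end
end KN
namespace KN
open MeasureTheory Filter Set
open scoped Topology ENNReal
open Real (log exp sqrt)
noncomputable section
variable {β : ℝ}
lemma gauss_of_pos {x : ℝ} (hx : x ≠ 0) : gaussMap x = 1/x - ⌊1/x⌋ := by unfold gaussMap; rw [if_neg hx]
lemma gauss_nn (x : ℝ) : gaussMap x ∈ Ico (0:ℝ) 1 := by
  unfold gaussMap
  split_ifs
  · norm_num
  · exact ⟨Int.fract_nonneg (1/x), Int.fract_lt_one (1/x)⟩
lemma gaussn_mem {x : ℝ} (hx : x ∈ Ico (0:ℝ) 1) (n : ℕ) : gaussMap^[n] x ∈ Ico (0:ℝ) 1 := by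
  cases n with
  | zero => exact hx
  | succ n => rw [Function.iterate_succ_apply']; exact gauss_nn _
lemma Good.shift {x : ℝ} (hx : Good x) : Good (gaussMap x) := fun m => by
  rw [← Function.iterate_succ_apply]; exact hx (m+1)
/-- products of iterates -/
def Pi (m : ℕ) (x : ℝ) : ℝ := ∏ i ∈ Finset.range m, gaussMap^[i] x
lemma Pi_pos {x : ℝ} (hx : Good x) (m : ℕ) : 0 < Pi m x := Finset.prod_pos fun i _ => (hx i).1
lemma Pi_RR {x : ℝ} (hx : Good x) (m : ℕ) : Pi m x = exp (- RR m x) := by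
  rw [← Real.exp_log (Pi_pos hx m), Pi, Real.log_prod fun i _ => (hx i).1.ne', RR, birkhoffSum]
  simp
lemma Pi_succ (m : ℕ) (x : ℝ) : Pi (m+1) x = Pi m x * gaussMap^[m] x := Finset.prod_range_succ _ _
lemma cf_step {x : ℝ} (hx : Good x) {m : ℕ} {y : ℝ} (hy : y ∈ cfCyl m x) {i : ℕ} (hi : i < m) :
    0 < gaussMap^[i] y ∧ ∃ a : ℝ, 1 ≤ a ∧ gaussMap^[i] x * (a + gaussMap^[i+1] x) = 1 ∧ gaussMap^[i] y * (a + gaussMap^[i+1] y) = 1 ∧ a = cfA (i+1) x := by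
  have h := hy.2 (i+1) (by omega) (by omega)
  simp only [cfA, Nat.add_sub_cancel] at h ⊢
  have hxi := hx i
  have h1 : (1:ℤ) ≤ ⌊1 / gaussMap^[i] x⌋ := by
    rw [Int.le_floor, le_div_iff₀ hxi.1]; push_cast; linarith [hxi.2]
  have hyi := gaussn_mem hy.1 i
  have hy0 : gaussMap^[i] y ≠ 0 := by
    intro h0
    rw [h0] at h
    simp at h
    simp only [one_div] at h1
    omega
  refine ⟨lt_of_le_of_ne hyi.1 hy0.symm, ⌊1 / gaussMap^[i] x⌋, by exact_mod_cast h1, ?_, ?_, rfl⟩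
  · rw [Function.iterate_succ_apply', gauss_of_pos hxi.1.ne']
    have := hxi.1.ne'
    field_simp; ring
  · rw [Function.iterate_succ_apply', gauss_of_pos hy0, h]
    field_simp; ring
lemma cfCyl_anti {x : ℝ} {m m' : ℕ} (h : m ≤ m') : cfCyl m' x ⊆ cfCyl m x :=
  fun _ hy => ⟨hy.1, fun i h1 h2 => hy.2 i h1 (h2.trans h)⟩
lemma self_mem {x : ℝ} (hx : Good x) (m : ℕ) : x ∈ cfCyl m x := ⟨⟨(hx 0).1.le, (hx 0).2⟩, fun _ _ _ => rfl⟩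
lemma Pi_pos' {x : ℝ} (hx : Good x) {m : ℕ} {y : ℝ} (hy : y ∈ cfCyl m x) : 0 < Pi m y :=
  Finset.prod_pos fun i hi => (cf_step hx hy (Finset.mem_range.1 hi)).1
lemma cf_dist {x : ℝ} (hx : Good x) (m : ℕ) {y : ℝ} (hy : y ∈ cfCyl m x) :
    |x - y| = |gaussMap^[m] x - gaussMap^[m] y| * (Pi m x * Pi m y) := by
  induction m with
  | zero => simp [Pi]
  | succ m ih =>
    obtain ⟨h0, a, _, e1, e2, _⟩ := cf_step hx hy (Nat.lt_succ_self m)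
    have hx0 := (hx m).1
    rw [ih (cfCyl_anti (Nat.le_succ m) hy), Pi_succ, Pi_succ]
    have e : gaussMap^[m] x - gaussMap^[m] y = -(gaussMap^[m+1] x - gaussMap^[m+1] y) * (gaussMap^[m] x * gaussMap^[m] y) := by
      linear_combination gaussMap^[m] y * e1 - gaussMap^[m] x * e2
    rw [e, abs_mul, abs_neg, abs_of_pos (mul_pos hx0 h0)]
    ring
lemma cf_q {x : ℝ} (hx : Good x) (m : ℕ) : ∃ q q' : ℝ, 0 < q ∧ 0 ≤ q' ∧ q' ≤ q ∧ ∀ y ∈ cfCyl m x, Pi m y * (q + gaussMap^[m] y * q') = 1 := by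
  induction m with
  | zero => exact ⟨1, 0, by norm_num, le_rfl, by norm_num, fun y _ => by simp [Pi]⟩
  | succ m ih =>
    obtain ⟨q, q', hq, hq', hqq, h⟩ := ih
    obtain ⟨_, a, ha, _, _, hae⟩ := cf_step hx (self_mem hx (m+1)) (Nat.lt_succ_self m)
    refine ⟨q*a + q', q, by positivity, hq.le, by nlinarith, fun y hy => ?_⟩
    obtain ⟨_, a', _, _, e2, hae'⟩ := cf_step hx hy (Nat.lt_succ_self m)
    have h1 := h y (cfCyl_anti (Nat.le_succ m) hy)
    rw [Pi_succ, hae]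
    rw [hae'] at e2
    linear_combination h1 + Pi m y * q * e2
lemma cf_distort {x : ℝ} (hx : Good x) (m : ℕ) {y z : ℝ} (hy : y ∈ cfCyl m x) (hz : z ∈ cfCyl m x) : Pi m y ≤ 2 * Pi m z := by
  obtain ⟨q, q', hq, hq', hqq, h⟩ := cf_q hx m
  have h1 := h y hy
  have h2 := h z hz
  have hy1 := gaussn_mem hy.1 m
  have hz1 := gaussn_mem hz.1 m
  have p1 := Pi_pos' hx hy
  have p2 := Pi_pos' hx hz
  have a1 : Pi m y * q ≤ 1 := by
    have : 0 ≤ Pi m y * (gaussMap^[m] y * q') := mul_nonneg p1.le (mul_nonneg hy1.1 hq')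
    linarith
  have a2 : 1 ≤ Pi m z * (2*q) := by
    rw [← h2]
    have : gaussMap^[m] z * q' ≤ q := (mul_le_of_le_one_left hq' hz1.2.le).trans hqq
    exact mul_le_mul_of_nonneg_left (by linarith) p2.le
  refine le_of_mul_le_mul_right (a := q) ?_ hq
  linarith
/-- distance to the endpoints -/
def mu (x : ℝ) : ℝ := min x (1 - x)
lemma mu_pos {x : ℝ} (hx : x ∈ Ioo (0:ℝ) 1) : 0 < mu x := lt_min hx.1 (by linarith [hx.2])
lemma mu_le (x : ℝ) : mu x ≤ 1/2 := by
  unfold mu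
  rcases le_total x (1/2) with h | h
  · exact (min_le_left _ _).trans h
  · exact (min_le_right _ _).trans (by linarith)
lemma mu_step {x : ℝ} (hx : Good x) (i : ℕ) : gaussMap^[i] x ^2 * mu (gaussMap^[i+1] x) ≤ mu (gaussMap^[i] x) := by
  obtain ⟨_, a, ha, e1, _, _⟩ := cf_step hx (self_mem hx (i+1)) (Nat.lt_succ_self i)
  obtain ⟨h1, h2⟩ := hx i
  obtain ⟨h3, h4⟩ := hx (i+1)
  have h5 : mu (gaussMap^[i+1] x) ≤ gaussMap^[i+1] x := min_le_left _ _
  generalize gaussMap^[i] x = z at *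
  generalize gaussMap^[i+1] x = w at *
  have hz : z^2 ≤ z := by nlinarith
  have h6 : z^2 * mu w ≤ z * w := by
    calc z^2 * mu w ≤ z^2 * w := by gcongr
      _ ≤ z * w := by gcongr
  refine le_min (h6.trans (by nlinarith)) (h6.trans (by nlinarith))
lemma mu_chain {x : ℝ} (hx : Good x) {i m : ℕ} (h : i ≤ m) : Pi m x ^ 2 * mu (gaussMap^[m] x) ≤ Pi i x ^ 2 * mu (gaussMap^[i] x) := by
  induction m, h using Nat.le_induction with
  | base => rfl
  | succ m _ ih =>
    refine le_trans ?_ ih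
    rw [Pi_succ, mul_pow, mul_assoc]
    exact mul_le_mul_of_nonneg_left (mu_step hx m) (by positivity)
lemma cf_near {x : ℝ} (hx : Good x) (m : ℕ) {y : ℝ} (hy : y ∈ Ico (0:ℝ) 1) (h : 4 * |x - y| < Pi m x ^ 2 * mu (gaussMap^[m] x)) :
    ∀ i ≤ m, y ∈ cfCyl i x := by
  intro i
  induction i with
  | zero => exact fun _ => ⟨hy, fun i _ _ => by omega⟩
  | succ i ih =>
    intro hi
    have hyi := ih (by omega)
    have hd := cf_dist hx i hyi
    have hdis := cf_distort hx i (self_mem hx i) hyi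
    have hP := Pi_pos hx i
    have hc := h.trans_le (mu_chain hx hi)
    rw [Pi_succ, hd] at hc
    obtain ⟨_, a, ha, e1, _, hae⟩ := cf_step hx (self_mem hx (i+1)) (Nat.lt_succ_self i)
    obtain ⟨h1, h2⟩ := hx i
    have hm1 : mu (gaussMap^[i+1] x) ≤ gaussMap^[i+1] x := min_le_left _ _
    have hm2 : mu (gaussMap^[i+1] x) ≤ 1 - gaussMap^[i+1] x := min_le_right _ _
    have hm3 := mu_le (gaussMap^[i+1] x)
    have hm0 := mu_pos (hx (i+1))
    have hcf : cfA (i+1) y = cfA (i+1) x := by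
      have ey : cfA (i+1) y = ⌊1/gaussMap^[i] y⌋ := rfl
      rw [ey, Int.floor_eq_iff, ← hae]
      clear hae ey ih
      generalize gaussMap^[i] x = z at *
      generalize gaussMap^[i+1] x = w at *
      generalize gaussMap^[i] y = t at *
      generalize Pi i x = P at *
      generalize Pi i y = P' at *
      generalize mu w = μ at *
      have k1 : 2 * |z - t| < z^2 * μ := by
        have h3 : P^2 * (2 * |z-t|) < P^2 * (z^2 * μ) := by
          have : P * P ≤ P * (2 * P') := mul_le_mul_of_nonneg_left hdis hP.le
          have := mul_le_mul_of_nonneg_left this (abs_nonneg (z-t))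
          nlinarith only [this, hc]
        exact lt_of_mul_lt_mul_left h3 (by positivity)
      have k2 := abs_lt.1 (show |z-t| < z^2*μ/2 by linarith)
      have hzz : z^2 * μ ≤ z := by nlinarith
      have ht : z/2 ≤ t := by linarith [k2.2]
      have ht0 : 0 < t := by linarith
      have hzt : z^2*μ/2 ≤ z*t*μ := by
        have := mul_le_mul_of_nonneg_left ht (mul_nonneg h1.le hm0.le)
        linarith
      rw [le_div_iff₀ ht0, div_lt_iff₀ ht0]
      have q1 : t - z < z*t*w := by nlinarith [mul_le_mul_of_nonneg_left hm1 (mul_nonneg h1.le ht0.le)]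
      have q2 : z - t < z*t*(1-w) := by nlinarith [mul_le_mul_of_nonneg_left hm2 (mul_nonneg h1.le ht0.le)]
      constructor
      · refine le_of_mul_le_mul_left (a := z) ?_ h1
        linear_combination q1.le + t * e1
      · refine lt_of_mul_lt_mul_left (a := z) ?_ h1.le
        linear_combination q2 - t * e1
    refine ⟨hy, fun k hk1 hk2 => ?_⟩
    rcases Nat.lt_or_ge k (i+1) with h3 | h3
    · exact hyi.2 k hk1 (by omega)
    · obtain rfl : k = i+1 := by omega
      exact hcf
lemma RR_two {x : ℝ} (hx : Good x) (m : ℕ) : (m:ℝ) * log 2 ≤ RR (2*m) x := by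
  induction m with
  | zero => simp [RR]
  | succ m ih =>
    obtain ⟨_, a, ha, e1, _, _⟩ := cf_step hx (self_mem hx (2*m+1)) (Nat.lt_succ_self (2*m))
    have e : RR (2*(m+1)) x = RR (2*m) x - log (gaussMap^[2*m] x * gaussMap^[2*m+1] x) := by
      rw [Real.log_mul (hx _).1.ne' (hx _).1.ne', RR, RR, show 2*(m+1) = 2*m+1+1 by ring, birkhoffSum_succ, birkhoffSum_succ]; ring
    have h := hx (2*m)
    have h' := hx (2*m+1)
    have hl : log (gaussMap^[2*m] x * gaussMap^[2*m+1] x) ≤ log (1/2) :=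
      Real.log_le_log (mul_pos h.1 h'.1) (by nlinarith [h.1, h.2, h'.1, h'.2])
    rw [one_div, Real.log_inv] at hl
    rw [e]; push_cast; linarith
lemma sub_A (hβ : 1 < β) {n m : ℕ} {x : ℝ} (hx : Good x) (hτ : 0 < (betaT β)^[n] x) (h : betaCyl β n x ⊆ cfCyl m x) :
    2 * RR m x ≤ log 2 + n * log β - log ((betaT β)^[n] x) := by
  obtain ⟨τ, hτe⟩ : ∃ τ, τ = (betaT β)^[n] x := ⟨_, rfl⟩
  rw [← hτe] at hτ ⊢
  have hb : 0 < β^n := by positivity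
  have hy := h (cyl_back hβ (self_mem hx 0).1 (y := x - τ/β^n) (by have : 0 ≤ τ/β^n := by positivity
                                                                   linarith) n (by rw [← hτe, sub_sub_cancel, mul_div_cancel₀ _ hb.ne']))
  have hd := cf_dist hx m hy
  rw [sub_sub_cancel, abs_of_pos (by positivity)] at hd
  have h1 := cf_distort hx m hy (self_mem hx m)
  have h2 := gaussn_mem hy.1 m
  have h3 := hx m
  have h4 : |gaussMap^[m] x - gaussMap^[m] (x - τ/β^n)| ≤ 1 := by rw [abs_le]; constructor <;> linarith [h2.1, h2.2, h3.1, h3.2]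
  have hP := Pi_pos hx m
  have h5 : τ/β^n ≤ 2 * Pi m x ^ 2 := by
    rw [hd]
    calc _ ≤ 1 * (Pi m x * (2 * Pi m x)) := by
          gcongr
          exact mul_nonneg hP.le (Pi_pos' hx hy).le
      _ = _ := by ring
  have h6 := Real.log_le_log (by positivity) h5
  rw [Real.log_div hτ.ne' hb.ne', Real.log_pow, Real.log_mul (by norm_num) (by positivity), Real.log_pow, Pi_RR hx, Real.log_exp] at h6
  push_cast at h6
  linarith
lemma sub_B (hβ : 1 < β) {n m : ℕ} {x : ℝ} (hx : Good x) (h : 2 * RR m x + log 4 - log (mu (gaussMap^[m] x)) ≤ n * log β) :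
    betaCyl β n x ⊆ cfCyl m x := by
  intro y hy
  refine cf_near hx m hy.1 ?_ m le_rfl
  have h1 := cyl_dist hβ (self_mem hx 0).1 hy
  have hb : 0 < β^n := by positivity
  have hm := mu_pos (hx m)
  have hP := Pi_pos hx m
  have h2 : 4 ≤ β^n * (Pi m x ^ 2 * mu (gaussMap^[m] x)) := by
    rw [← Real.log_le_log_iff (by norm_num) (by positivity), Real.log_mul hb.ne' (by positivity), Real.log_mul (by positivity) hm.ne',
      Real.log_pow, Real.log_pow, Pi_RR hx, Real.log_exp]
    push_cast; linarith
  refine lt_of_mul_lt_mul_left (a := β^n) ?_ hb.le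
  linarith
lemma k_iff (hβ : 1 < β) {n m : ℕ} {x : ℝ} (hx : Good x) (hτ : 0 < (betaT β)^[n] x) : m ≤ kCF β n x ↔ betaCyl β n x ⊆ cfCyl m x := by
  obtain ⟨S, hS⟩ : ∃ S, S = {m | betaCyl β n x ⊆ cfCyl m x} := ⟨_, rfl⟩
  have hne : S.Nonempty := ⟨0, by rw [hS]; exact fun y hy => ⟨hy.1, fun i _ _ => by omega⟩⟩
  have hbd : BddAbove S := by
    obtain ⟨M, hM⟩ := exists_nat_gt ((log 2 + n * log β - log ((betaT β)^[n] x))/(2 * log 2))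
    refine ⟨2*M, fun m hm => ?_⟩
    by_contra hlt
    rw [hS] at hm
    have h1 := sub_A (m := 2*M) hβ hx hτ (hm.trans (cfCyl_anti (by omega)))
    have h2 := RR_two hx M
    have := Real.log_pos (show (1:ℝ) < 2 by norm_num)
    rw [div_lt_iff₀ (by positivity)] at hM
    linarith
  have hk : kCF β n x = sSup S := by rw [hS]; rfl
  rw [hk]
  constructor
  · intro h
    have : sSup S ∈ S := Nat.sSup_mem hne hbd
    rw [hS, mem_ofPred_eq, ← hS] at this
    exact this.trans (cfCyl_anti h)
  · intro h
    exact le_csSup hbd (by rw [hS]; exact h)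
lemma k_A (hβ : 1 < β) {n m : ℕ} {x : ℝ} (hx : Good x) (hτ : 0 < (betaT β)^[n] x) (h : m ≤ kCF β n x) :
    2 * RR m x ≤ log 2 + n * log β - log ((betaT β)^[n] x) := sub_A hβ hx hτ ((k_iff hβ hx hτ).1 h)
lemma k_B (hβ : 1 < β) {n m : ℕ} {x : ℝ} (hx : Good x) (hτ : 0 < (betaT β)^[n] x)
    (h : 2 * RR m x + log 4 - log (mu (gaussMap^[m] x)) ≤ n * log β) : m ≤ kCF β n x :=
  (k_iff hβ hx hτ).2 (sub_B hβ hx h)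
lemma mu_small (m : ℕ) {δ : ℝ} (hδ : 0 < δ) : volume ({x | mu (gaussMap^[m] x) < δ} ∩ Ioo (0:ℝ) 1) ≤ ENNReal.ofReal (8*δ) := by
  have m0 : Measurable mu := by unfold mu; fun_prop
  have m1 : MeasurableSet {x | mu x < δ} := measurableSet_lt m0 measurable_const
  have e : {x | mu (gaussMap^[m] x) < δ} = gaussMap^[m] ⁻¹' {x | mu x < δ} := rfl
  rw [e]
  have hm := gauss_mp.iterate m
  refine (vol_le _ (hm.measurable m1)).trans ?_
  rw [hm.measure_preimage m1.nullMeasurableSet]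
  have h2 : volume ({x | mu x < δ} ∩ Ioo (0:ℝ) 1) ≤ ENNReal.ofReal (2*δ) := by
    refine (measure_mono (t := Ioo 0 δ ∪ Ioo (1-δ) 1) ?_).trans ((measure_union_le _ _).trans ?_)
    · rintro x ⟨h1, h2⟩
      rcases min_lt_iff.1 (show min x (1-x) < δ from h1) with h | h
      · exact Or.inl ⟨h2.1, h⟩
      · exact Or.inr ⟨by linarith, h2.2⟩
    · rw [Real.volume_Ioo, Real.volume_Ioo, ← ENNReal.ofReal_add (by linarith) (by linarith)]
      exact ENNReal.ofReal_le_ofReal (by linarith)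
  calc 2 * gm {x | mu x < δ} ≤ 2 * (2 * ENNReal.ofReal (2*δ)) := by
        gcongr
        exact (gm_le _ m1).trans (by gcongr)
    _ = _ := by
      rw [← mul_assoc, show (2:ℝ≥0∞)*2 = ENNReal.ofReal 4 by norm_num, ← ENNReal.ofReal_mul (by norm_num)]
      congr 1; ring
end
end KN
namespace KN
open MeasureTheory Filter Set
open scoped Topology ENNReal
open Real (log exp sqrt)
noncomputable section
variable {β : ℝ}
lemma tau_pos_ae (hβ : 1 < β) : ∀ᵐ x ∂(volume.restrict (Ioo (0:ℝ) 1)), ∀ n, 0 < (betaT β)^[n] x := by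
  refine ae_all_iff.2 fun n => ?_
  rw [ae_iff, Measure.restrict_apply' measurableSet_Ioo]
  refine le_antisymm (ge_of_tendsto (f := fun δ : ℝ => ENNReal.ofReal (2*β/(β-1)*δ)) (x := 𝓝[>] 0) ?_ ?_) zero_le
  · have : Tendsto (fun δ : ℝ => ENNReal.ofReal (2*β/(β-1)*δ)) (𝓝 0) (𝓝 (ENNReal.ofReal (2*β/(β-1)*0))) :=
      (ENNReal.continuous_ofReal.comp (continuous_const.mul continuous_id)).tendsto 0
    rw [mul_zero, ENNReal.ofReal_zero] at this
    exact this.mono_left nhdsWithin_le_nhds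
  · filter_upwards [Ioc_mem_nhdsGT (show (0:ℝ) < 1 by norm_num)] with δ hδ
    refine (measure_mono ?_).trans (beta_small hβ n hδ.1 hδ.2)
    rintro x ⟨h1, h2⟩
    exact ⟨⟨h2.1.le, h2.2⟩, (not_lt.1 h1).trans_lt hδ.1⟩
lemma m_tendsto {a : ℝ} (ha : 0 < a) (z : ℝ) : Tendsto (fun n : ℕ => a * n + z * √n) atTop atTop := by
  have hs : Tendsto (fun n : ℕ => √(n:ℝ)) atTop atTop := Real.tendsto_sqrt_atTop.comp tendsto_natCast_atTop_atTop
  have h1 : Tendsto (fun n : ℕ => √(n:ℝ) * (a * √n + z)) atTop atTop :=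
    hs.atTop_mul_atTop₀ (tendsto_atTop_add_const_right _ _ (hs.const_mul_atTop ha))
  refine h1.congr fun n => ?_
  have : √(n:ℝ) * √n = n := Real.mul_self_sqrt (by positivity)
  linear_combination a * this
lemma m_lim {a s L : ℝ} (ha : 0 < a) (hs : 0 < s) (hL : 0 < L) (y K : ℝ) {m : ℕ → ℕ} (hm : ∀ n : ℕ, m n = ⌊a * n + y * (s * √a / L) * √n⌋₊ + 1) :
    Tendsto m atTop atTop ∧ Tendsto (fun n : ℕ => (L * (m n - a * n) + K) / (s * √(m n))) atTop (𝓝 y) := by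
  obtain ⟨z, hz⟩ : ∃ z, z = y * (s * √a / L) := ⟨_, rfl⟩
  rw [← hz] at hm
  have ht := m_tendsto ha z
  have hsq : Tendsto (fun n : ℕ => √(n:ℝ)) atTop atTop := Real.tendsto_sqrt_atTop.comp tendsto_natCast_atTop_atTop
  have hmt : Tendsto m atTop atTop := by
    have := (tendsto_nat_floor_atTop.comp ht)
    exact ((tendsto_add_atTop_nat 1).comp this).congr fun n => (hm n).symm
  refine ⟨hmt, ?_⟩
  have hinv : Tendsto (fun n : ℕ => (√(n:ℝ))⁻¹) atTop (𝓝 0) := tendsto_inv_atTop_zero.comp hsq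
  have hr : Tendsto (fun n : ℕ => (m n - (a * n + z * √n)) * (√(n:ℝ))⁻¹) atTop (𝓝 0) := by
    refine squeeze_zero' ?_ ?_ hinv
    · filter_upwards [ht.eventually_ge_atTop 0] with n hn
      have := Nat.lt_floor_add_one (a * n + z * √n)
      rw [hm]; push_cast
      exact mul_nonneg (by linarith) (by positivity)
    · filter_upwards [ht.eventually_ge_atTop 0] with n hn
      have := Nat.floor_le hn
      rw [hm]; push_cast
      exact mul_le_of_le_one_left (by positivity) (by linarith)
  have h1 : Tendsto (fun n : ℕ => (L * (m n - a * n) + K) * (√(n:ℝ))⁻¹) atTop (𝓝 (L * z)) := by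
    have h := ((hr.add_const z).const_mul L).add (hinv.const_mul K)
    rw [zero_add, mul_zero, add_zero] at h
    refine h.congr' ?_
    filter_upwards [eventually_ge_atTop 1] with n hn
    have : (0:ℝ) < n := by exact_mod_cast hn
    have : √(n:ℝ) ≠ 0 := by positivity
    field_simp
    ring
  have h2 : Tendsto (fun n : ℕ => (m n : ℝ) / n) atTop (𝓝 a) := by
    have h := (hr.mul hinv).add ((hinv.const_mul z).const_add a)
    simp only [mul_zero, add_zero, zero_add] at h
    refine h.congr' ?_
    filter_upwards [eventually_ge_atTop 1] with n hn
    have h0 : (0:ℝ) < n := by exact_mod_cast hn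
    have h3 : √(n:ℝ) ≠ 0 := by positivity
    have h4 : √(n:ℝ)^2 = n := Real.sq_sqrt h0.le
    have h5 : (√(n:ℝ))⁻¹ = √n / n := by field_simp; rw [h4]
    rw [h5]
    field_simp
    rw [h4]; ring
  have h3 := h1.div (h2.sqrt.const_mul s) (by positivity)
  have e : L * z / (s * √a) = y := by rw [hz]; field_simp
  rw [e] at h3
  refine h3.congr' ?_
  filter_upwards [eventually_ge_atTop 1] with n hn
  have h0 : (0:ℝ) < n := by exact_mod_cast hn
  simp only [Pi.div_apply]
  rw [Real.sqrt_div (by positivity)]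
  have h3 : √(n:ℝ) ≠ 0 := by positivity
  rw [← div_eq_mul_inv, ← mul_div_assoc, div_div_div_cancel_right₀ h3]
lemma clt_fin (hβ : 1 < β) {W : ℕ → ℝ → ℝ} {s B a : ℝ} (hs : 0 < s) (ha : 0 < a) (hal : 2 * lam * a = log β)
    (hW : ∀ m x, Good x → |RR m x - lam * m - W m x| ≤ B)
    (hclt : ∀ (y : ℝ) (m : ℕ → ℕ) (c : ℕ → ℝ), Tendsto m atTop atTop → Tendsto (fun n => c n / (s * √(m n))) atTop (𝓝 y) →
      Tendsto (fun n : ℕ => volume.real ({x | - W (m n) x < c n} ∩ Ioo (0:ℝ) 1)) atTop (𝓝 (Phi y))) (y : ℝ) :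
    Tendsto (fun n : ℕ => (volume {x ∈ Ico (0:ℝ) 1 | ((kCF β n x : ℝ) - a * n) / (s * √a / lam * √n) ≤ y}).toReal) atTop (𝓝 (Phi y)) := by
  obtain ⟨m, hm⟩ : ∃ m : ℕ → ℕ, ∀ n : ℕ, m n = ⌊a * n + y * (s * √a / lam) * √n⌋₊ + 1 := ⟨_, fun n => rfl⟩
  have hl := lam_pos
  obtain ⟨ν, hν⟩ : ∃ ν, ν = volume.restrict (Ioo (0:ℝ) 1) := ⟨_, rfl⟩
  have : IsFiniteMeasure ν := by rw [hν]; infer_instance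
  have hνa : ∀ S, ν.real S = volume.real (S ∩ Ioo (0:ℝ) 1) := fun S => by
    rw [hν, Measure.real, Measure.restrict_apply' measurableSet_Ioo]; rfl
  have hmt := (m_lim ha hs hl y 0 hm).1
  have hE : ∀ᶠ n : ℕ in atTop, (volume {x ∈ Ico (0:ℝ) 1 | ((kCF β n x : ℝ) - a * n) / (s * √a / lam * √n) ≤ y}).toReal =
      ν.real {x | kCF β n x < m n} := by
    filter_upwards [(m_tendsto ha (y * (s * √a / lam))).eventually_ge_atTop 0, eventually_ge_atTop 1] with n h0 hn
    have hn0 : (0:ℝ) < n := by exact_mod_cast hn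
    have e1 : {x ∈ Ico (0:ℝ) 1 | ((kCF β n x : ℝ) - a * n) / (s * √a / lam * √n) ≤ y} = {x | kCF β n x < m n} ∩ Ico (0:ℝ) 1 := by
      ext x
      have : ((kCF β n x : ℝ) - a * n) / (s * √a / lam * √n) ≤ y ↔ kCF β n x < m n := by
        rw [div_le_iff₀ (by positivity), hm, Nat.lt_succ_iff, Nat.le_floor_iff h0]
        constructor <;> intro h <;> linarith
      simp only [mem_ofPred_eq, mem_inter_iff, this]
      tauto
    rw [e1, hνa, Measure.real]
    congr 1
    exact measure_congr ((ae_eq_refl _).inter Ioo_ae_eq_Ico.symm)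
  have hgood : ∀ᵐ x ∂ν, Good x ∧ ∀ n, 0 < (betaT β)^[n] x := by
    rw [hν]; exact good_ae.and (tau_pos_ae hβ)
  rw [tendsto_congr' hE, Metric.tendsto_atTop']
  intro η hη
  obtain ⟨D, hD⟩ : ∃ D, D = 2*β/(β-1) := ⟨_, rfl⟩
  have hb : 0 < β - 1 := by linarith
  have hD0 : 0 < D := by rw [hD]; positivity
  obtain ⟨δ, hδ⟩ : ∃ δ, δ = min 1 (min (η/(4*D)) (η/32)) := ⟨_, rfl⟩
  have hδ0 : 0 < δ := by rw [hδ]; positivity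
  have hδ1 : δ ≤ 1 := by rw [hδ]; exact min_le_left _ _
  have hδD : D * δ ≤ η/4 := by
    have : δ ≤ η/(4*D) := by rw [hδ]; exact (min_le_right _ _).trans (min_le_left _ _)
    rw [le_div_iff₀ (by positivity)] at this; linarith
  have hδ8 : 8 * δ ≤ η/4 := by
    have : δ ≤ η/32 := by rw [hδ]; exact (min_le_right _ _).trans (min_le_right _ _)
    linarith
  obtain ⟨Kp, hKp⟩ : ∃ K, K = B + (log 4 - log δ)/2 := ⟨_, rfl⟩
  obtain ⟨Km, hKm⟩ : ∃ K, K = -B - (log 2 - log δ)/2 := ⟨_, rfl⟩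
  have cp := hclt y m _ hmt (m_lim ha hs hl y Kp hm).2
  have cm := hclt y m _ hmt (m_lim ha hs hl y Km hm).2
  have h1 : ∀ n, ν.real {x | kCF β n x < m n} ≤ ν.real {x | - W (m n) x < lam * (m n - a * n) + Kp} + 8*δ := by
    intro n
    have hsub : {x | kCF β n x < m n} ≤ᵐ[ν] ({x | - W (m n) x < lam * (m n - a * n) + Kp} ∪ {x | mu (gaussMap^[m n] x) < δ} : Set ℝ) := by
      filter_upwards [hgood] with x hx hk
      by_cases hmu : mu (gaussMap^[m n] x) < δ
      · exact Or.inr hmu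
      left
      have hk' : kCF β n x < m n := hk
      have h2 := mt (k_B hβ hx.1 (hx.2 n)) (not_le.2 hk')
      have h3 := Real.log_le_log hδ0 (not_lt.1 hmu)
      have h4 := (abs_le.1 (hW (m n) x hx.1)).2
      rw [mem_ofPred_eq, hKp]
      rw [not_le, ← hal] at h2
      linarith
    have h5 : ν {x | mu (gaussMap^[m n] x) < δ} ≤ ENNReal.ofReal (8*δ) := by
      rw [hν, Measure.restrict_apply' measurableSet_Ioo]; exact mu_small _ hδ0
    have h6 := (measure_mono_ae hsub).trans ((measure_union_le _ _).trans (add_le_add le_rfl h5))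
    have h7 := ENNReal.toReal_mono (by finiteness) h6
    rwa [ENNReal.toReal_add (by finiteness) (by finiteness), ENNReal.toReal_ofReal (by positivity)] at h7
  have h2 : ∀ n, ν.real {x | - W (m n) x < lam * (m n - a * n) + Km} ≤ ν.real {x | kCF β n x < m n} + D*δ := by
    intro n
    have hsub : {x | - W (m n) x < lam * (m n - a * n) + Km} ≤ᵐ[ν] ({x | kCF β n x < m n} ∪ {x | (betaT β)^[n] x < δ} : Set ℝ) := by
      filter_upwards [hgood] with x hx hk
      by_cases hmu : (betaT β)^[n] x < δ
      · exact Or.inr hmu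
      left
      have hk' : - W (m n) x < lam * (m n - a * n) + Km := hk
      rw [mem_ofPred_eq]
      by_contra hcon
      have h2 := k_A hβ hx.1 (hx.2 n) (not_lt.1 hcon)
      have h3 := Real.log_le_log hδ0 (not_lt.1 hmu)
      have h4 := (abs_le.1 (hW (m n) x hx.1)).1
      rw [hKm] at hk'
      rw [← hal] at h2
      linarith
    have h5 : ν {x | (betaT β)^[n] x < δ} ≤ ENNReal.ofReal (D*δ) := by
      rw [hν, Measure.restrict_apply' measurableSet_Ioo, hD]
      refine (measure_mono ?_).trans (beta_small hβ n hδ0 hδ1)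
      rintro x ⟨h1, h2⟩
      exact ⟨⟨h2.1.le, h2.2⟩, h1⟩
    have h6 := (measure_mono_ae hsub).trans ((measure_union_le _ _).trans (add_le_add le_rfl h5))
    have h7 := ENNReal.toReal_mono (by finiteness) h6
    rwa [ENNReal.toReal_add (by finiteness) (by finiteness), ENNReal.toReal_ofReal (by positivity)] at h7
  simp only [← hνa] at cp cm
  obtain ⟨N1, hN1⟩ := Metric.tendsto_atTop'.1 cp (η/4) (by positivity)
  obtain ⟨N2, hN2⟩ := Metric.tendsto_atTop'.1 cm (η/4) (by positivity)
  refine ⟨max N1 N2, fun n hn => ?_⟩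
  have a1 := hN1 n ((le_max_left _ _).trans_lt hn)
  have a2 := hN2 n ((le_max_right _ _).trans_lt hn)
  rw [Real.dist_eq, abs_lt] at a1 a2 ⊢
  have b1 := h1 n
  have b2 := h2 n
  constructor <;> linarith [a1.1, a1.2, a2.1, a2.2]
end
end KN
namespace KN
open MeasureTheory Filter Set
open scoped Topology ENNReal
open Real (log exp sqrt)
noncomputable section
lemma logn_top : Tendsto (fun n : ℕ => log (n:ℝ)) atTop atTop := Real.tendsto_log_atTop.comp tendsto_natCast_atTop_atTop
lemma loglogn_top : Tendsto (fun n : ℕ => log (log (n:ℝ))) atTop atTop := Real.tendsto_log_atTop.comp logn_top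
lemma phi_ge : ∀ᶠ n : ℕ in atTop, √(n:ℝ) ≤ phi n := by
  filter_upwards [loglogn_top.eventually_ge_atTop 1] with n hn
  unfold phi
  apply Real.sqrt_le_sqrt
  have : (0:ℝ) ≤ n := by positivity
  nlinarith
lemma phi_top : Tendsto phi atTop atTop :=
  tendsto_atTop_mono' _ phi_ge (Real.tendsto_sqrt_atTop.comp tendsto_natCast_atTop_atTop)
lemma log_div_sqrt : Tendsto (fun n : ℕ => log (n:ℝ) / √(n:ℝ)) atTop (𝓝 0) := by
  have h := (isLittleO_log_rpow_atTop (show (0:ℝ) < 1/2 by norm_num)).tendsto_div_nhds_zero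
  refine (h.comp tendsto_natCast_atTop_atTop).congr fun n => ?_
  simp only [Function.comp, Real.sqrt_eq_rpow]
lemma log_phi : Tendsto (fun n : ℕ => log (n:ℝ) / phi n) atTop (𝓝 0) := by
  refine squeeze_zero' ?_ ?_ log_div_sqrt
  · filter_upwards [logn_top.eventually_ge_atTop 0] with n hn
    unfold phi; positivity
  · filter_upwards [logn_top.eventually_ge_atTop 0, phi_ge, eventually_ge_atTop 1] with n hn h1 h2
    have : (0:ℝ) < n := by exact_mod_cast h2
    gcongr
lemma phi_div : Tendsto (fun n : ℕ => phi n / n) atTop (𝓝 0) := by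
  have h : Tendsto (fun n : ℕ => √2 * √(log (n:ℝ) / n)) atTop (𝓝 0) := by
    have h1 : Tendsto (fun n : ℕ => log (n:ℝ) / n) atTop (𝓝 0) := by
      have h := (Real.isLittleO_log_id_atTop).tendsto_div_nhds_zero
      exact h.comp tendsto_natCast_atTop_atTop
    have := h1.sqrt.const_mul √2
    rwa [Real.sqrt_zero, mul_zero] at this
  refine squeeze_zero' (Eventually.of_forall fun n => by unfold phi; positivity) ?_ h
  filter_upwards [logn_top.eventually_gt_atTop 0, eventually_ge_atTop 1] with n hn h2
  have h0 : (0:ℝ) < n := by exact_mod_cast h2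
  rw [div_le_iff₀ h0, phi, ← Real.sqrt_mul (by positivity)]
  have e : √(2 * (log (n:ℝ) / n)) * n = √(2 * (log (n:ℝ) / n) * n^2) := by
    rw [Real.sqrt_mul' _ (sq_nonneg _), Real.sqrt_sq h0.le]
  rw [e]
  apply Real.sqrt_le_sqrt
  have h3 := Real.log_le_sub_one_of_pos hn
  have e2 : 2 * (log (n:ℝ) / n) * n^2 = 2 * n * log n := by field_simp
  rw [e2]
  exact mul_le_mul_of_nonneg_left (by linarith) (by positivity)
lemma phi_ratio {f : ℕ → ℕ} {a : ℝ} (ha : 0 < a) (hf : Tendsto (fun n : ℕ => (f n : ℝ) / n) atTop (𝓝 a)) :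
    Tendsto f atTop atTop ∧ Tendsto (fun n : ℕ => phi (f n) / phi n) atTop (𝓝 √a) := by
  have hc : Tendsto (fun n : ℕ => (n:ℝ)) atTop atTop := tendsto_natCast_atTop_atTop
  have hft : Tendsto f atTop atTop := by
    have h1 : Tendsto (fun n : ℕ => (f n : ℝ)/n * n) atTop atTop := hf.pos_mul_atTop ha hc
    rw [← tendsto_natCast_atTop_iff (R := ℝ)]
    refine h1.congr' ?_
    filter_upwards [eventually_ge_atTop 1] with n hn
    have h0 : (0:ℝ) < n := by exact_mod_cast hn
    field_simp
  refine ⟨hft, ?_⟩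
  have hpos : ∀ᶠ n : ℕ in atTop, 1 ≤ n ∧ 1 ≤ f n ∧ 1 < log (n:ℝ) ∧ 1 < log (f n:ℝ) :=
    (eventually_ge_atTop 1).and ((hft.eventually_ge_atTop 1).and ((logn_top.eventually_gt_atTop 1).and ((logn_top.comp hft).eventually_gt_atTop 1)))
  have g1 : Tendsto (fun n : ℕ => log (f n:ℝ) / log n) atTop (𝓝 1) := by
    have h := ((hf.log ha.ne').div_atTop logn_top).const_add 1
    rw [add_zero] at h
    refine h.congr' ?_
    filter_upwards [hpos] with n hn
    have h0 : (0:ℝ) < n := by exact_mod_cast hn.1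
    have h1 : (0:ℝ) < f n := by exact_mod_cast hn.2.1
    rw [Real.log_div h1.ne' h0.ne']
    have := hn.2.2.1
    field_simp
    ring
  have g2 : Tendsto (fun n : ℕ => log (log (f n:ℝ)) / log (log n)) atTop (𝓝 1) := by
    have h := ((g1.log one_ne_zero).div_atTop loglogn_top).const_add 1
    rw [add_zero] at h
    refine h.congr' ?_
    filter_upwards [hpos] with n hn
    have h2 := hn.2.2.1
    have h3 := hn.2.2.2
    have h4 := Real.log_pos h2
    rw [Real.log_div (by positivity) (by positivity)]
    field_simp
    ring
  have g3 := (hf.mul g2).sqrt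
  rw [mul_one] at g3
  refine g3.congr' ?_
  filter_upwards [hpos] with n hn
  have h2 := hn.2.2.1
  have h4 := Real.log_pos h2
  have h0 : (0:ℝ) < n := by exact_mod_cast hn.1
  rw [phi, phi, ← Real.sqrt_div' _ (by positivity)]
  congr 1
  field_simp
lemma ratio_of {f : ℕ → ℕ} {a : ℝ} {e : ℕ → ℝ} (he : Tendsto (fun n : ℕ => e n / n) atTop (𝓝 0))
    (hf : ∀ᶠ n : ℕ in atTop, |(f n : ℝ) - (a * n + e n)| ≤ 1) : Tendsto (fun n : ℕ => (f n : ℝ) / n) atTop (𝓝 a) := by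
  have hi : Tendsto (fun n : ℕ => (1:ℝ) / n) atTop (𝓝 0) := tendsto_one_div_atTop_nhds_zero_nat
  have h1 : Tendsto (fun n : ℕ => ((f n : ℝ) - (a * n + e n)) / n) atTop (𝓝 0) := by
    refine squeeze_zero_norm' ?_ hi
    filter_upwards [hf] with n hn
    rw [Real.norm_eq_abs, abs_div, abs_of_nonneg (show (0:ℝ) ≤ n by positivity)]
    gcongr
  have h2 := (h1.add he).add_const a
  rw [zero_add, zero_add] at h2
  refine h2.congr' ?_
  filter_upwards [eventually_ge_atTop 1] with n hn
  have h0 : (0:ℝ) < n := by exact_mod_cast hn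
  field_simp
  ring
lemma lin_pos {a : ℝ} (ha : 0 < a) {e : ℕ → ℝ} (he : Tendsto (fun n : ℕ => e n / n) atTop (𝓝 0)) : ∀ᶠ n : ℕ in atTop, 0 ≤ a * n + e n := by
  filter_upwards [he.eventually_const_lt (show -a < 0 by linarith), eventually_ge_atTop 1] with n h1 hn
  have h0 : (0:ℝ) < n := by exact_mod_cast hn
  rw [lt_div_iff₀ h0] at h1
  linarith
lemma log_div_n : Tendsto (fun n : ℕ => log (n:ℝ) / n) atTop (𝓝 0) :=
  (Real.isLittleO_log_id_atTop).tendsto_div_nhds_zero.comp tendsto_natCast_atTop_atTop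
section det
variable {k : ℕ → ℕ} {W : ℕ → ℝ} {a l s C : ℝ}
lemma det_up (ha : 0 < a) (hl : 0 < l) (hs : 0 < s)
    (hA : ∀ᶠ n : ℕ in atTop, ∀ m ≤ k n, l * m + W m ≤ l * a * n + C + log n)
    (hW : ∀ ε > 0, ∀ᶠ m in atTop, |W m| ≤ (1+ε) * (s * phi m)) {ε : ℝ} (hε : 0 < ε) :
    ∀ᶠ n : ℕ in atTop, (k n : ℝ) - a * n ≤ (1+ε) * (s * √a / l * phi n) := by
  obtain ⟨e, he⟩ : ∃ e : ℕ → ℝ, ∀ n, e n = (1+ε) * (s * √a / l * phi n) := ⟨_, fun n => rfl⟩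
  have he0 : Tendsto (fun n : ℕ => e n / n) atTop (𝓝 0) := by
    have := phi_div.const_mul ((1+ε) * (s * √a / l))
    rw [mul_zero] at this
    exact this.congr fun n => by rw [he]; ring
  obtain ⟨f, hf⟩ : ∃ f : ℕ → ℕ, ∀ n, f n = ⌊a * n + e n⌋₊ + 1 := ⟨_, fun n => rfl⟩
  have hfl : ∀ᶠ n : ℕ in atTop, a * n + e n < f n ∧ (f n : ℝ) ≤ a * n + e n + 1 := by
    filter_upwards [lin_pos ha he0] with n hn
    rw [hf]; push_cast
    exact ⟨Nat.lt_floor_add_one _, by linarith [Nat.floor_le hn]⟩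
  obtain ⟨hft, hr⟩ := phi_ratio ha (ratio_of he0 (hfl.mono fun n hn => by rw [abs_le]; constructor <;> linarith [hn.1, hn.2]))
  have lim : Tendsto (fun n : ℕ => (1+ε/2) * s * (phi (f n) / phi n) + C / phi n + log n / phi n) atTop (𝓝 ((1+ε/2)*s*√a + 0 + 0)) :=
    ((hr.const_mul _).add (phi_top.const_div_atTop C)).add log_phi
  have hlt : (1+ε/2)*s*√a + 0 + 0 < (1+ε)*s*√a := by
    have : 0 < s * √a := by positivity
    nlinarith
  filter_upwards [hA, hfl, hft.eventually (hW (ε/2) (by positivity)), lim.eventually_lt_const hlt, phi_top.eventually_gt_atTop 0] with n h1 h2 h3 h4 h5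
  rw [← he]
  by_contra hcon
  have hm : f n ≤ k n := by
    rw [hf, Nat.succ_le_iff]
    refine Nat.floor_lt' ?_ |>.2 (by linarith)
    rintro h0
    rw [h0, Nat.cast_zero] at hcon
    have h0' := h1 0 (Nat.zero_le _)
    have := h2.1
    rw [hf] at this
    have h00 := h2.2
    have : 0 ≤ a * n := by positivity
    have : 0 ≤ e n := by rw [he]; positivity
    linarith
  have h6 := h1 _ hm
  have h7 := (abs_le.1 h3).1
  have h8 : l * e n = (1+ε)*s*√a * phi n := by rw [he]; field_simp
  have h9 := mul_lt_mul_of_pos_right h4 h5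
  have h10 : ((1+ε/2) * s * (phi (f n) / phi n) + C / phi n + log n / phi n) * phi n = (1+ε/2)*(s*phi (f n)) + C + log n := by field_simp
  have h11 := mul_lt_mul_of_pos_left h2.1 hl
  linarith
lemma det_low (ha : 0 < a) (hl : 0 < l) (hs : 0 < s)
    (hB : ∀ᶠ m : ℕ in atTop, ∀ n : ℕ, l * m + W m + C + log m ≤ l * a * n → m ≤ k n)
    (hW : ∀ ε > 0, ∀ᶠ m in atTop, |W m| ≤ (1+ε) * (s * phi m)) {ε : ℝ} (hε : 0 < ε) :
    ∀ᶠ n : ℕ in atTop, -((1+ε) * (s * √a / l * phi n)) ≤ (k n : ℝ) - a * n := by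
  obtain ⟨e, he⟩ : ∃ e : ℕ → ℝ, ∀ n, e n = -((1+ε/2) * (s * √a / l * phi n)) := ⟨_, fun n => rfl⟩
  have he0 : Tendsto (fun n : ℕ => e n / n) atTop (𝓝 0) := by
    have := phi_div.const_mul (-((1+ε/2) * (s * √a / l)))
    rw [mul_zero] at this
    exact this.congr fun n => by rw [he]; ring
  obtain ⟨f, hf⟩ : ∃ f : ℕ → ℕ, ∀ n, f n = ⌊a * n + e n⌋₊ := ⟨_, fun n => rfl⟩
  have hfl : ∀ᶠ n : ℕ in atTop, a * n + e n < f n + 1 ∧ (f n : ℝ) ≤ a * n + e n := by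
    filter_upwards [lin_pos ha he0] with n hn
    rw [hf]
    exact ⟨Nat.lt_floor_add_one _, Nat.floor_le hn⟩
  obtain ⟨hft, hr⟩ := phi_ratio ha (ratio_of he0 (hfl.mono fun n hn => by rw [abs_le]; constructor <;> linarith [hn.1, hn.2]))
  have lim : Tendsto (fun n : ℕ => (1+ε/4) * s * (phi (f n) / phi n) + C / phi n + log (f n) / phi (f n) * (phi (f n) / phi n)) atTop
      (𝓝 ((1+ε/4)*s*√a + 0 + 0 * √a)) :=
    ((hr.const_mul _).add (phi_top.const_div_atTop C)).add ((log_phi.comp hft).mul hr)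
  have hp : 0 < s * √a := by positivity
  have hlt : (1+ε/4)*s*√a + 0 + 0*√a < (1+ε/2)*s*√a := by nlinarith
  filter_upwards [hft.eventually hB, hfl, hft.eventually (hW (ε/4) (by positivity)), lim.eventually_lt_const hlt, phi_top.eventually_gt_atTop 0,
    (phi_top.const_mul_atTop (show 0 < ε/2 * (s*√a/l) by positivity)).eventually_ge_atTop 1, (phi_top.comp hft).eventually_gt_atTop 0] with n h1 h2 h3 h4 h5 h6 h12
  have h12 : 0 < phi (f n) := h12
  have h7 := (abs_le.1 h3).2
  have h8 : l * e n = -((1+ε/2)*s*√a * phi n) := by rw [he]; field_simp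
  have h9 := mul_lt_mul_of_pos_right h4 h5
  have h10 : ((1+ε/4) * s * (phi (f n) / phi n) + C / phi n + log (f n) / phi (f n) * (phi (f n) / phi n)) * phi n =
    (1+ε/4)*(s*phi (f n)) + C + log (f n) := by field_simp
  have h11 := mul_le_mul_of_nonneg_left h2.2 hl.le
  have hk : (f n : ℝ) ≤ k n := by exact_mod_cast h1 n (by linarith)
  have h13 := he n
  linarith [h2.1]
lemma det_fup (ha : 0 < a) (hl : 0 < l) (hs : 0 < s)
    (hB : ∀ᶠ m : ℕ in atTop, ∀ n : ℕ, l * m + W m + C + log m ≤ l * a * n → m ≤ k n)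
    (hW : ∀ ε > 0, ∃ᶠ m in atTop, W m ≤ -((1-ε) * (s * phi m))) {ε : ℝ} (hε : 0 < ε) :
    ∃ᶠ n : ℕ in atTop, (1-ε) * (s * √a / l * phi n) ≤ (k n : ℝ) - a * n := by
  obtain ⟨e, he⟩ : ∃ e : ℕ → ℝ, ∀ m : ℕ, e m = -(((1-ε/2) * (s * phi m) - C - log m)/(l*a)) := ⟨_, fun n => rfl⟩
  have he0 : Tendsto (fun n : ℕ => e n / n) atTop (𝓝 0) := by
    have := (((phi_div.const_mul ((1-ε/2)*s)).sub (tendsto_natCast_atTop_atTop.const_div_atTop C)).sub log_div_n).const_mul (-(1/(l*a)))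
    simp only [mul_zero, sub_zero] at this
    exact this.congr fun n => by rw [he]; ring
  have ha' : 0 < 1/a := by positivity
  obtain ⟨f, hf⟩ : ∃ f : ℕ → ℕ, ∀ n : ℕ, f n = ⌈1/a * n + e n⌉₊ := ⟨_, fun n => rfl⟩
  have hfl : ∀ᶠ n : ℕ in atTop, 1/a * n + e n ≤ f n ∧ (f n : ℝ) < 1/a * n + e n + 1 := by
    filter_upwards [lin_pos ha' he0] with n hn
    rw [hf]
    exact ⟨Nat.le_ceil _, Nat.ceil_lt_add_one hn⟩
  obtain ⟨hft, hr⟩ := phi_ratio ha' (ratio_of he0 (hfl.mono fun n hn => by rw [abs_le]; constructor <;> linarith [hn.1, hn.2]))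
  have hsa : √(1/a) * √a = 1 := by rw [← Real.sqrt_mul ha'.le, one_div_mul_cancel ha.ne', Real.sqrt_one]
  have lim : Tendsto (fun m : ℕ => (1-ε) * (s * √a / l) * (phi (f m) / phi m) + (C/l + a) / phi m + 1/l * (log m / phi m)) atTop
      (𝓝 ((1-ε) * (s * √a / l) * √(1/a) + 0 + 1/l*0)) :=
    ((hr.const_mul _).add (phi_top.const_div_atTop _)).add (log_phi.const_mul _)
  have hp : 0 < s / l := by positivity
  have hlt : (1-ε) * (s * √a / l) * √(1/a) + 0 + 1/l*0 < (1-ε/2)*(s/l) := by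
    have : (1-ε) * (s * √a / l) * √(1/a) = (1-ε)*(s/l) := by linear_combination (1-ε)*(s/l) * hsa
    rw [this]; nlinarith
  refine hft.frequently (((hW (ε/2) (by positivity)).and_eventually (hB.and (hfl.and ((lim.eventually_lt_const hlt).and (phi_top.eventually_gt_atTop 0))))).mono ?_)
  rintro m ⟨h1, h2, h3, h4, h5⟩
  have h8 : l * a * e m = -((1-ε/2) * (s * phi m) - C - log m) := by rw [he]; field_simp
  have h8' : a * e m = -((1-ε/2) * (s/l) * phi m - C/l - 1/l*log m) := by rw [he]; field_simp
  have h9 := mul_lt_mul_of_pos_right h4 h5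
  have h10 : ((1-ε) * (s * √a / l) * (phi (f m) / phi m) + (C/l + a) / phi m + 1/l * (log m / phi m)) * phi m =
    (1-ε)*(s*√a/l*phi (f m)) + C/l + a + 1/l*log m := by field_simp; ring
  have ea : a * (1/a * m) = m := by field_simp
  have h11 := mul_le_mul_of_nonneg_left h3.1 (show 0 ≤ l * a by positivity)
  have h11' : l * a * (1/a * m + e m) = l * (a * (1/a*m)) + l * a * e m := by ring
  rw [h11', ea] at h11
  have hk : (m : ℝ) ≤ k (f m) := by exact_mod_cast h2 (f m) (by linarith)
  have h12 := mul_le_mul_of_nonneg_left h3.2.le ha.le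
  have h12' : a * (1/a * m + e m + 1) = a * (1/a*m) + a * e m + a := by ring
  rw [h12', ea] at h12
  linarith
lemma det_flow (ha : 0 < a) (hl : 0 < l) (hs : 0 < s)
    (hA : ∀ᶠ n : ℕ in atTop, ∀ m ≤ k n, l * m + W m ≤ l * a * n + C + log n)
    (hW : ∀ ε > 0, ∃ᶠ m in atTop, (1-ε) * (s * phi m) ≤ W m) {ε : ℝ} (hε : 0 < ε) :
    ∃ᶠ n : ℕ in atTop, (k n : ℝ) - a * n ≤ -((1-ε) * (s * √a / l * phi n)) := by
  obtain ⟨e, he⟩ : ∃ e : ℕ → ℝ, ∀ m : ℕ, e m = ((1-ε/2) * (s * phi m) - C - 2 * log m)/(l*a) := ⟨_, fun n => rfl⟩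
  have he0 : Tendsto (fun n : ℕ => e n / n) atTop (𝓝 0) := by
    have := (((phi_div.const_mul ((1-ε/2)*s)).sub (tendsto_natCast_atTop_atTop.const_div_atTop C)).sub (log_div_n.const_mul 2)).const_mul (1/(l*a))
    simp only [mul_zero, sub_zero] at this
    exact this.congr fun n => by rw [he]; ring
  have ha' : 0 < 1/a := by positivity
  obtain ⟨f, hf⟩ : ∃ f : ℕ → ℕ, ∀ n : ℕ, f n = ⌊1/a * n + e n⌋₊ := ⟨_, fun n => rfl⟩
  have hfl : ∀ᶠ n : ℕ in atTop, 1/a * n + e n < f n + 1 ∧ (f n : ℝ) ≤ 1/a * n + e n := by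
    filter_upwards [lin_pos ha' he0] with n hn
    rw [hf]
    exact ⟨Nat.lt_floor_add_one _, Nat.floor_le hn⟩
  have hrat := ratio_of (a := 1/a) he0 (hfl.mono fun n hn => by rw [abs_le]; constructor <;> linarith [hn.1, hn.2])
  obtain ⟨hft, hr⟩ := phi_ratio ha' hrat
  have hsa : √(1/a) * √a = 1 := by rw [← Real.sqrt_mul ha'.le, one_div_mul_cancel ha.ne', Real.sqrt_one]
  have hlog : ∀ᶠ m : ℕ in atTop, log (f m) < 2 * log m := by
    filter_upwards [hrat.eventually_lt_const (show 1/a < 1/a+1 by linarith), (tendsto_natCast_atTop_atTop (R := ℝ)).eventually_gt_atTop (1/a+1),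
      hft.eventually_ge_atTop 1] with m h1 h2 h3
    have h0 : (0:ℝ) < m := by linarith
    have h3' : (0:ℝ) < f m := by exact_mod_cast h3
    rw [div_lt_iff₀ h0] at h1
    have e2 : 2 * log m = log ((m:ℝ)*m) := by rw [Real.log_mul h0.ne' h0.ne']; ring
    rw [e2]
    exact Real.log_lt_log h3' (h1.trans (mul_lt_mul_of_pos_right h2 h0))
  have lim : Tendsto (fun m : ℕ => (1-ε) * (s * √a / l) * (phi (f m) / phi m) + (C/l + a) / phi m + 2/l * (log m / phi m)) atTop
      (𝓝 ((1-ε) * (s * √a / l) * √(1/a) + 0 + 2/l*0)) :=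
    ((hr.const_mul _).add (phi_top.const_div_atTop _)).add (log_phi.const_mul _)
  have hp : 0 < s / l := by positivity
  have hlt : (1-ε) * (s * √a / l) * √(1/a) + 0 + 2/l*0 < (1-ε/2)*(s/l) := by
    have : (1-ε) * (s * √a / l) * √(1/a) = (1-ε)*(s/l) := by linear_combination (1-ε)*(s/l) * hsa
    rw [this]; nlinarith
  refine hft.frequently (((hW (ε/2) (by positivity)).and_eventually ((hft.eventually hA).and (hfl.and ((lim.eventually_lt_const hlt).and
    ((phi_top.eventually_gt_atTop 0).and hlog))))).mono ?_)
  rintro m ⟨h1, h2, h3, h4, h5, h6⟩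
  have h8 : l * a * e m = (1-ε/2) * (s * phi m) - C - 2 * log m := by rw [he]; field_simp
  have h8' : a * e m = (1-ε/2) * (s/l) * phi m - C/l - 2/l*log m := by rw [he]; field_simp
  have h9 := mul_lt_mul_of_pos_right h4 h5
  have h10 : ((1-ε) * (s * √a / l) * (phi (f m) / phi m) + (C/l + a) / phi m + 2/l * (log m / phi m)) * phi m =
    (1-ε)*(s*√a/l*phi (f m)) + C/l + a + 2/l*log m := by field_simp; ring
  have ea : a * (1/a * m) = m := by field_simp
  have h11 := mul_le_mul_of_nonneg_left h3.2 (show 0 ≤ l * a by positivity)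
  have h11' : l * a * (1/a * m + e m) = l * (a * (1/a*m)) + l * a * e m := by ring
  rw [h11', ea] at h11
  have hk : (k (f m) : ℝ) ≤ m := by
    by_contra hcon
    have := h2 m (by exact_mod_cast (not_le.1 hcon).le)
    linarith
  have h12 := mul_le_mul_of_nonneg_left h3.1.le ha.le
  have h12' : a * (1/a * m + e m) = a * (1/a*m) + a * e m := by ring
  rw [h12', ea] at h12
  linarith
end det
end
end KN
namespace KN
open MeasureTheory Filter Set
open scoped Topology ENNReal
open Real (log exp sqrt)
noncomputable section
lemma bc {ν : Measure ℝ} {S : ℕ → Set ℝ} {K : ℝ} (h : ∀ n, 1 ≤ n → ν (S n) ≤ ENNReal.ofReal (K * (1/(n:ℝ)^2))) :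
    ∀ᵐ x ∂ν, ∀ᶠ n in atTop, x ∉ S n := by
  have hs : Summable fun n : ℕ => K * (1/((n+1:ℕ):ℝ)^2) :=
    ((summable_nat_add_iff 1).2 (Real.summable_one_div_nat_pow.2 one_lt_two)).mul_left K
  have h1 : ∑' n, ν (S (n+1)) ≠ ∞ := by
    refine ne_top_of_le_ne_top hs.tsum_ofReal_ne_top (ENNReal.tsum_le_tsum fun n => h (n+1) (by omega))
  filter_upwards [ae_eventually_notMem h1] with x hx
  obtain ⟨N, hN⟩ := eventually_atTop.1 hx
  refine eventually_atTop.2 ⟨N+1, fun n hn => ?_⟩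
  have := hN (n-1) (by omega)
  rwa [Nat.sub_add_cancel (by omega)] at this
lemma lil_conv {u p : ℕ → ℝ} {σ : ℝ} (hσ : 0 < σ) (hp : ∀ᶠ n in atTop, 0 < p n)
    (h1 : ∀ ε > 0, ∀ᶠ n in atTop, u n ≤ (1+ε) * (σ * p n))
    (h2 : ∀ ε > 0, ∀ᶠ n in atTop, -((1+ε) * (σ * p n)) ≤ u n)
    (h3 : ∀ ε > 0, ∃ᶠ n in atTop, (1-ε) * (σ * p n) ≤ u n)
    (h4 : ∀ ε > 0, ∃ᶠ n in atTop, u n ≤ -((1-ε) * (σ * p n))) :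
    limsup (fun n => u n / (σ * p n)) atTop = 1 ∧ liminf (fun n => u n / (σ * p n)) atTop = -1 := by
  have g1 : ∀ ε > 0, ∀ᶠ n in atTop, u n / (σ * p n) ≤ 1 + ε := fun ε he => by
    filter_upwards [hp, h1 ε he] with n hn h
    rwa [div_le_iff₀ (by positivity)]
  have g2 : ∀ ε > 0, ∀ᶠ n in atTop, -(1 + ε) ≤ u n / (σ * p n) := fun ε he => by
    filter_upwards [hp, h2 ε he] with n hn h
    rw [le_div_iff₀ (by positivity)]; linarith
  have g3 : ∀ ε > 0, ∃ᶠ n in atTop, 1 - ε ≤ u n / (σ * p n) := fun ε he => by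
    refine ((h3 ε he).and_eventually hp).mono fun n hn => ?_
    have := hn.2
    rw [le_div_iff₀ (by positivity)]; exact hn.1
  have g4 : ∀ ε > 0, ∃ᶠ n in atTop, u n / (σ * p n) ≤ -(1 - ε) := fun ε he => by
    refine ((h4 ε he).and_eventually hp).mono fun n hn => ?_
    have := hn.2
    rw [div_le_iff₀ (by positivity)]; linarith [hn.1]
  have b1 : IsBoundedUnder (· ≤ ·) atTop (fun n => u n / (σ * p n)) := ⟨1+1, eventually_map.2 (g1 1 one_pos)⟩
  have b2 : IsBoundedUnder (· ≥ ·) atTop (fun n => u n / (σ * p n)) := ⟨-(1+1), eventually_map.2 (g2 1 one_pos)⟩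
  refine ⟨le_antisymm ?_ ?_, le_antisymm ?_ ?_⟩
  · exact le_of_forall_pos_le_add fun ε he => limsup_le_of_le b2.isCoboundedUnder_le (g1 ε he)
  · refine le_of_forall_pos_le_add fun ε he => ?_
    have := le_limsup_of_frequently_le (g3 ε he) b1
    linarith
  · refine le_of_forall_pos_le_add fun ε he => ?_
    have := liminf_le_of_frequently_le (g4 ε he) b2
    linarith
  · refine le_of_forall_pos_le_add fun ε he => ?_
    have := le_liminf_of_le b1.isCoboundedUnder_ge (g2 ε he)
    linarith
lemma log_of_ge {t : ℝ} {n : ℕ} (hn : 1 ≤ n) (h : 1/(n:ℝ)^2 ≤ t) : -log t ≤ 2 * log n := by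
  have h0 : (0:ℝ) < n := by exact_mod_cast hn
  have := Real.log_le_log (by positivity) h
  rw [Real.log_div one_ne_zero (by positivity), Real.log_one, Real.log_pow] at this
  push_cast at this
  linarith
lemma lil_fin {β : ℝ} (hβ : 1 < β) {W : ℕ → ℝ → ℝ} {s B a : ℝ} (hs : 0 < s) (ha : 0 < a) (hal : 2 * lam * a = log β)
    (hW : ∀ m x, Good x → |RR m x - lam * m - W m x| ≤ B)
    (hl : ∀ᵐ x ∂(volume.restrict (Ioo (0:ℝ) 1)), ∀ ε > 0, (∀ᶠ m in atTop, |W m x| ≤ (1+ε) * (s * phi m)) ∧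
      (∃ᶠ m in atTop, (1-ε) * (s * phi m) ≤ W m x) ∧ (∃ᶠ m in atTop, W m x ≤ -((1-ε) * (s * phi m)))) :
    ∀ᵐ x ∂(volume.restrict (Ioo (0:ℝ) 1)),
      limsup (fun n : ℕ => ((kCF β n x : ℝ) - a * n) / (s * √a / lam * phi n)) atTop = 1 ∧
      liminf (fun n : ℕ => ((kCF β n x : ℝ) - a * n) / (s * √a / lam * phi n)) atTop = -1 := by
  have hlam := lam_pos
  have c1 : ∀ᵐ x ∂(volume.restrict (Ioo (0:ℝ) 1)), ∀ᶠ n : ℕ in atTop, x ∉ {x | (betaT β)^[n] x < 1/(n:ℝ)^2} := by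
    refine bc (K := 2*β/(β-1)) fun n hn => ?_
    have h0 : (1:ℝ) ≤ n := by exact_mod_cast hn
    rw [Measure.restrict_apply' measurableSet_Ioo]
    refine (measure_mono ?_).trans (beta_small hβ n (δ := 1/(n:ℝ)^2) (by positivity) ?_)
    · rintro x ⟨h1, h2⟩; exact ⟨⟨h2.1.le, h2.2⟩, h1⟩
    · rw [div_le_one (by positivity)]; exact one_le_pow₀ h0
  have c2 : ∀ᵐ x ∂(volume.restrict (Ioo (0:ℝ) 1)), ∀ᶠ n : ℕ in atTop, x ∉ {x | mu (gaussMap^[n] x) < 1/(n:ℝ)^2} := by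
    refine bc (K := 8) fun n hn => ?_
    have h0 : (1:ℝ) ≤ n := by exact_mod_cast hn
    rw [Measure.restrict_apply' measurableSet_Ioo]
    exact mu_small n (by positivity)
  filter_upwards [hl, c1, c2, good_ae, tau_pos_ae hβ] with x hx h1 h2 hg hτ
  have hA : ∀ᶠ n : ℕ in atTop, ∀ m ≤ kCF β n x, lam * m + W m x ≤ lam * a * n + (B + log 4) + log n := by
    filter_upwards [h1, eventually_ge_atTop 1] with n hn h3 m hm
    have e1 := log_of_ge h3 (not_lt.1 hn)
    have e2 := k_A hβ hg (hτ n) hm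
    have e3 := (abs_le.1 (hW m x hg)).1
    have e4 : log 2 ≤ log 4 := Real.log_le_log (by norm_num) (by norm_num)
    have e5 : 0 < log 4 := Real.log_pos (by norm_num)
    rw [← hal] at e2
    linarith
  have hB : ∀ᶠ m : ℕ in atTop, ∀ n : ℕ, lam * m + W m x + (B + log 4) + log m ≤ lam * a * n → m ≤ kCF β n x := by
    filter_upwards [h2, eventually_ge_atTop 1] with m hm h3 n hn
    have e1 := log_of_ge h3 (not_lt.1 hm)
    have e3 := (abs_le.1 (hW m x hg)).2
    have e5 : 0 < log 4 := Real.log_pos (by norm_num)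
    refine k_B hβ hg (hτ n) ?_
    rw [← hal]
    linarith
  exact lil_conv (by positivity) (phi_top.eventually_gt_atTop 0)
    (fun ε he => det_up (W := fun m => W m x) ha hlam hs hA (fun ε he => (hx ε he).1) he)
    (fun ε he => det_low (W := fun m => W m x) ha hlam hs hB (fun ε he => (hx ε he).1) he)
    (fun ε he => det_fup (W := fun m => W m x) ha hlam hs hB (fun ε he => (hx ε he).2.2) he)
    (fun ε he => det_flow (W := fun m => W m x) ha hlam hs hA (fun ε he => (hx ε he).2.1) he)
end
end KN

theorem clt_and_lil_for_kn (β : ℝ) (hβ : 1 < β) :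
    ∃ σ : ℝ, 0 < σ ∧
      ((∀ y : ℝ,
        Tendsto (fun n : ℕ =>
            (volume {x ∈ Set.Ico (0:ℝ) 1 |
              ((kCF β n x : ℝ) - (6 * Real.log 2 * Real.log β / Real.pi ^ 2) * n) /
                (σ * Real.sqrt n) ≤ y}).toReal)
          atTop (nhds ((1 / Real.sqrt (2 * Real.pi)) * ∫ t in Set.Iic y, Real.exp (-t ^ 2 / 2)))) ∧
      (∀ᵐ x ∂(volume.restrict (Set.Ico (0:ℝ) 1)),
        Filter.limsup (fun n : ℕ =>
            ((kCF β n x : ℝ) - (6 * Real.log 2 * Real.log β / Real.pi ^ 2) * n) /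
              (σ * Real.sqrt (2 * n * Real.log (Real.log n)))) atTop = 1 ∧
        Filter.liminf (fun n : ℕ =>
            ((kCF β n x : ℝ) - (6 * Real.log 2 * Real.log β / Real.pi ^ 2) * n) /
              (σ * Real.sqrt (2 * n * Real.log (Real.log n)))) atTop = -1)) := by
  obtain ⟨W, s, B, hs, hB, hW, hclt, hlil⟩ := KN.pkg
  have hlb := Real.log_pos hβ
  have hl2 := Real.log_pos one_lt_two
  have hpi := Real.pi_pos
  have hlam := KN.lam_pos
  have ha : 0 < 6 * Real.log 2 * Real.log β / Real.pi ^ 2 := by positivity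
  have hal : 2 * KN.lam * (6 * Real.log 2 * Real.log β / Real.pi ^ 2) = Real.log β := by
    unfold KN.lam
    field_simp
    ring
  refine ⟨s * Real.sqrt (6 * Real.log 2 * Real.log β / Real.pi ^ 2) / KN.lam, by positivity, ?_, ?_⟩
  · exact fun y => KN.clt_fin hβ hs ha hal hW hclt y
  · rw [← Measure.restrict_congr_set (Ioo_ae_eq_Ico (μ := volume))]
    exact KN.lil_fin hβ hs ha hal hW hlil
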